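/- arXiv:1810.09599 — 4 statements merged into one kernel-verified Lean document; each statement's English description precedes it below -/
import Mathlib

section
/- Fix b ∈ (0,1) and Λ > 0. There exist a constant σ ∈ (0, 1/16) depending only on n, W, b, Λ, a constant C = C(σ, Λ) and ε₀ > 0 such that the following holds. Let ε ≤ ε₀ and let u_ε be a stable solution of the singularly perturbed Allen–Cahn equation in B₁(0) ⊂ ℝⁿ satisfying ∇u_ε ≠ 0 and |B(u_ε)| ≤ Λ on {|u_ε| ≤ 1−b} ∩ B₁(0). Then for any x⋆ ∈ {|u_ε| ≤ 1−b} ∩ B_{7/8}(0) there is an orthonormal coordinate system (x′, x_n) ∈ ℝ^{n−1} × ℝ of ℝⁿ and a finite family of functions f_α ∈ C¹(B_{2σ}^{n−1}(x⋆′)) with Lipschitz gradients, such that {u_ε = u_ε(x⋆)} ∩ B_σ(x⋆) = ⋃_α {(x′, f_α(x′)) : x′ ∈ B_{2σ}^{n−1}(x⋆′)} ∩ B_σ(x⋆), and each f_α satisfies ‖f_α‖_{C^{1,1}(B_{2σ}^{n−1}(x⋆′))} ≤ C (i.e. sup|f_α| + sup|∇f_α| + Lip(∇f_α) ≤ C).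 -/
open Set Metric MeasureTheory Filter
open scoped RealInnerProductSpace

noncomputable section

/-- Euclidean space `ℝⁿ`. -/
abbrev Euc (n : ℕ) : Type := EuclideanSpace ℝ (Fin n)

/-- Standard orthonormal basis vector of `ℝⁿ`. -/
def eb (n : ℕ) (i : Fin n) : Euc n := EuclideanSpace.basisFun (Fin n) ℝ i

/-- Laplacian, as the trace of the second derivative along the standard orthonormal basis. -/
def lap {n : ℕ} (f : Euc n → ℝ) (x : Euc n) : ℝ :=
  ∑ i : Fin n, iteratedFDeriv ℝ 2 f x ![eb n i, eb n i]

/-- Divergence of a vector field. -/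
def divg {n : ℕ} (F : Euc n → Euc n) (x : Euc n) : ℝ :=
  ∑ i : Fin n, ⟪fderiv ℝ F x (eb n i), eb n i⟫

/-- Squared Frobenius norm of the Hessian. -/
def hessSq {n : ℕ} (f : Euc n → ℝ) (x : Euc n) : ℝ :=
  ∑ i : Fin n, ∑ j : Fin n, (iteratedFDeriv ℝ 2 f x ![eb n i, eb n j]) ^ 2

open Classical in
/-- `|B(u)(x)|`, with value `0` where the gradient vanishes. -/
def Bnorm {n : ℕ} (u : Euc n → ℝ) (x : Euc n) : ℝ :=
  if gradient u x = 0 then 0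
  else Real.sqrt ((hessSq u x - ‖gradient (fun y => ‖gradient u y‖) x‖ ^ 2) /
    ‖gradient u x‖ ^ 2)

/-- Mean curvature of level sets: `div(∇u/|∇u|)`. -/
def meanCurv {n : ℕ} (u : Euc n → ℝ) (x : Euc n) : ℝ :=
  divg (fun y => ‖gradient u y‖⁻¹ • gradient u y) x

/-- Orthogonal projection onto the tangent space of the level set of `u` through `x`. -/
def tproj {n : ℕ} (u : Euc n → ℝ) (x X : Euc n) : Euc n :=
  X - (⟪gradient u x, X⟫ / ‖gradient u x‖ ^ 2) • gradient u x

/-- Second fundamental form of the level set of `u` through `x`, extended to all of `ℝⁿ`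
via the tangential projection. -/
def sff {n : ℕ} (u : Euc n → ℝ) (x X Y : Euc n) : ℝ :=
  iteratedFDeriv ℝ 2 u x ![tproj u x X, tproj u x Y] / ‖gradient u x‖

/-- `W` is a double-well potential. -/
def IsDoubleWell (W : ℝ → ℝ) : Prop :=
  ContDiffOn ℝ 3 W (Icc (-1) 1) ∧ (∀ t ∈ Ioo (-1:ℝ) 1, 0 < W t) ∧
  W (-1) = 0 ∧ W 1 = 0 ∧ deriv W (-1) = 0 ∧ deriv W 1 = 0 ∧
  iteratedDeriv 2 W (-1) = 1 ∧ iteratedDeriv 2 W 1 = 1 ∧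
  deriv W 0 = 0 ∧ ∀ t ∈ Ioo (-1:ℝ) 1, deriv W t = 0 → t = 0

/-- `u` is a classical solution of the singularly perturbed Allen–Cahn equation
`ε Δu = ε⁻¹ W′(u)`, `|u| < 1`, on `Ω`. -/
def ACSolution {n : ℕ} (W : ℝ → ℝ) (ε : ℝ) (u : Euc n → ℝ) (Ω : Set (Euc n)) : Prop :=
  ContDiffOn ℝ 2 u Ω ∧ (∀ x ∈ Ω, u x ∈ Ioo (-1:ℝ) 1) ∧
  ∀ x ∈ Ω, ε * lap u x = ε⁻¹ * deriv W (u x)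

/-- Stability: `∫_Ω ε²|∇η|² + W″(u)η² ≥ 0` for all smooth `η` compactly supported in `Ω`. -/
def StableAC {n : ℕ} (W : ℝ → ℝ) (ε : ℝ) (u : Euc n → ℝ) (Ω : Set (Euc n)) : Prop :=
  ∀ η : Euc n → ℝ, ContDiff ℝ (⊤ : ℕ∞) η → HasCompactSupport η → tsupport η ⊆ Ω →
    0 ≤ ∫ x in Ω, (ε ^ 2 * ‖gradient η x‖ ^ 2 + iteratedDeriv 2 W (u x) * (η x) ^ 2)

/-- `∇u ≠ 0` and `|B(u)| ≤ Λ` on `{|u| ≤ 1−b} ∩ Ω`. -/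
def CurvBound {n : ℕ} (u : Euc n → ℝ) (b Λ : ℝ) (Ω : Set (Euc n)) : Prop :=
  ∀ x ∈ Ω, |u x| ≤ 1 - b → gradient u x ≠ 0 ∧ Bnorm u x ≤ Λ

/-- The part of the zero set `{u = 0}` away from the connected component of `x`. -/
def compSet {n : ℕ} (u : Euc n → ℝ) (x : Euc n) : Set (Euc n) :=
  {y | u y = 0} \ connectedComponentIn {y | u y = 0} x

/-- `A(r) = sup { e^{−D(x)} : x ∈ {u = 0} ∩ closure(B_r(0)) }`, where
`D(x) = dist(x, {u=0} ∖ Γ_x)` and points with `{u=0} ∖ Γ_x = ∅` contribute `0`. -/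
def Afun {n : ℕ} (u : Euc n → ℝ) (r : ℝ) : ℝ :=
  sSup {t : ℝ | ∃ x : Euc n, u x = 0 ∧ x ∈ closedBall 0 r ∧ (compSet u x).Nonempty ∧
    t = Real.exp (-Metric.infDist x (compSet u x))}

/-- The rescaled stable Allen–Cahn setting: `Δu = W′(u)` on `B_{1/ε}(0)`, stable, with
`∇u ≠ 0` and `|B(u)| ≤ Λε` on `{|u| ≤ 1−b}`. -/
def RescaledSetting {n : ℕ} (W : ℝ → ℝ) (b Λ ε : ℝ) (u : Euc n → ℝ) : Prop :=
  ACSolution W 1 u (ball 0 (1/ε)) ∧ StableAC W 1 u (ball 0 (1/ε)) ∧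
  CurvBound u b (Λ * ε) (ball 0 (1/ε))


/-- Projection of `ℝ^{m+1}` onto the first `m` coordinates. -/
def projE (m : ℕ) (x : Euc (m+1)) : Euc m :=
  (EuclideanSpace.equiv (Fin m) ℝ).symm (fun i => x i.castSucc)

/-- The open cylinder `B_r^{m}(0) × (−s, s) ⊂ ℝ^{m+1}`. -/
def cyl (m : ℕ) (r s : ℝ) : Set (Euc (m+1)) :=
  {x | ‖projE m x‖ < r ∧ |x (Fin.last m)| < s}

/-- The hyperplane `ker L` has slope at most `a` over the first factor. -/
def SlopeLE {F : Type*} [NormedAddCommGroup F] [NormedSpace ℝ F] (a : ℝ)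
    (L : F × ℝ →L[ℝ] ℝ) : Prop :=
  ∀ v : F, |L (v, 0)| ≤ a * |L (0, 1)| * ‖v‖

/-- The linear function whose graph is `ker L`. -/
def kerSlope {F : Type*} [NormedAddCommGroup F] [NormedSpace ℝ F]
    (L : F × ℝ →L[ℝ] ℝ) : F →L[ℝ] ℝ :=
  -((L (0, 1))⁻¹ • L.comp (ContinuousLinearMap.inl ℝ F ℝ))

section Graph

variable {F : Type*} [NormedAddCommGroup F] [NormedSpace ℝ F]

lemma apply_prod_eq (L : F × ℝ →L[ℝ] ℝ) (v : F) (t : ℝ) :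
    L (v, t) = L (v, 0) + t * L (0, 1) := by
  have : (v, t) = (v, (0:ℝ)) + t • ((0:F), (1:ℝ)) := by simp
  rw [this, map_add, map_smul, smul_eq_mul]

lemma SlopeLE.mono {a a' : ℝ} {L : F × ℝ →L[ℝ] ℝ} (h : SlopeLE a L) (haa : a ≤ a') :
    SlopeLE a' L := fun v => (h v).trans (by gcongr)

lemma SlopeLE.ne_zero {a : ℝ} {L : F × ℝ →L[ℝ] ℝ} (h : SlopeLE a L) (hL : L ≠ 0) :
    L (0, 1) ≠ 0 := by
  intro h0
  apply hL
  ext v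
  · have := h v
    simp only [h0, abs_zero, mul_zero, zero_mul] at this
    simpa using abs_eq_zero.1 (le_antisymm this (abs_nonneg _))
  · simpa using h0

lemma kerSlope_apply (L : F × ℝ →L[ℝ] ℝ) (v : F) : kerSlope L v = -(L (v, 0) / L (0, 1)) := by
  simp [kerSlope, div_eq_inv_mul]

lemma apply_kerSlope {L : F × ℝ →L[ℝ] ℝ} (hL : L (0, 1) ≠ 0) (v : F) : L (v, kerSlope L v) = 0 := by
  rw [apply_prod_eq, kerSlope_apply]
  field_simp
  ring

lemma SlopeLE.norm_kerSlope_le {a : ℝ} {L : F × ℝ →L[ℝ] ℝ} (h : SlopeLE a L)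
    (ha : 0 ≤ a) (hL : L (0, 1) ≠ 0) : ‖kerSlope L‖ ≤ a := by
  refine ContinuousLinearMap.opNorm_le_bound _ ha fun v => ?_
  rw [kerSlope_apply, norm_neg, norm_div, Real.norm_eq_abs, Real.norm_eq_abs,
    div_le_iff₀ (abs_pos.2 hL)]
  linarith [h v]

lemma slopeLE_of_norm_kerSlope_le {a : ℝ} {L : F × ℝ →L[ℝ] ℝ} (hL : L (0, 1) ≠ 0)
    (h : ‖kerSlope L‖ ≤ a) : SlopeLE a L := by
  intro v
  have h1 := (kerSlope L).le_of_opNorm_le h v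
  rw [kerSlope_apply, norm_neg, norm_div, Real.norm_eq_abs, Real.norm_eq_abs,
    div_le_iff₀ (abs_pos.2 hL)] at h1
  linarith

/-- Slope bounds are stable under small perturbations. -/
lemma SlopeLE.perturb {L L' : F × ℝ →L[ℝ] ℝ} (h : SlopeLE (3/8) L)
    (hLL : ‖L' - L‖ ≤ |L (0, 1)| / 20) : SlopeLE (1/2) L' := by
  intro v
  have h1 := (L' - L).le_of_opNorm_le hLL (v, 0)
  have h2 := (L' - L).le_of_opNorm_le hLL (0, 1)
  have n1 : ‖((v, 0) : F × ℝ)‖ = ‖v‖ := by simp [Prod.norm_def]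
  have n2 : ‖((0, 1) : F × ℝ)‖ = 1 := by simp [Prod.norm_def]
  rw [n1, sub_apply, Real.norm_eq_abs] at h1
  rw [n2, sub_apply, Real.norm_eq_abs] at h2
  have h3 : |L' (v, 0)| ≤ |L (v, 0)| + |L' (v, 0) - L (v, 0)| := by
    have := abs_add_le (L (v, 0)) (L' (v, 0) - L (v, 0))
    simpa using this
  have h4 : |L (0, 1)| ≤ |L' (0, 1)| + |L' (0, 1) - L (0, 1)| := by
    have := abs_sub_abs_le_abs_sub (L (0, 1)) (L' (0, 1))
    rw [abs_sub_comm] at this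
    linarith
  have h5 : 17/40 * |L (0, 1)| ≤ 1/2 * |L' (0, 1)| := by linarith [abs_nonneg (L' (0,1))]
  calc |L' (v, 0)| ≤ 17/40 * |L (0, 1)| * ‖v‖ := by linarith [h v]
    _ ≤ _ := by gcongr

/-- `G` is affine up to a small error on `V`, with level sets of slope less than one. -/
def NearlyFlat (G : F × ℝ → ℝ) (V : Set (F × ℝ)) : Prop :=
  ∃ L : F × ℝ →L[ℝ] ℝ, L (0, 1) ≠ 0 ∧ SlopeLE (3/8) L ∧
    ∀ z₁ ∈ V, ∀ z₂ ∈ V, |G z₁ - G z₂ - L (z₁ - z₂)| ≤ |L (0, 1)| / 4 * ‖z₁ - z₂‖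

lemma NearlyFlat.mono {G : F × ℝ → ℝ} {V V' : Set (F × ℝ)} (h : NearlyFlat G V)
    (hV : V' ⊆ V) : NearlyFlat G V' := by
  obtain ⟨L, h1, h2, h3⟩ := h
  exact ⟨L, h1, h2, fun z₁ hz₁ z₂ hz₂ => h3 z₁ (hV hz₁) z₂ (hV hz₂)⟩

lemma NearlyFlat.abs_sub_le {G : F × ℝ → ℝ} {V : Set (F × ℝ)} (h : NearlyFlat G V)
    {z₁ z₂ : F × ℝ} (h₁ : z₁ ∈ V) (h₂ : z₂ ∈ V) (e₁ : G z₁ = 0) (e₂ : G z₂ = 0) :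
    |z₁.2 - z₂.2| ≤ ‖z₁.1 - z₂.1‖ := by
  obtain ⟨L, hL, hs, hG⟩ := h
  by_contra! hlt
  have h1 := hG z₁ h₁ z₂ h₂
  have hn : ‖z₁ - z₂‖ = |z₁.2 - z₂.2| := by
    rw [Prod.norm_def]; exact max_eq_right hlt.le
  have h2 := hs (z₁ - z₂).1
  have h3 : L (z₁ - z₂) = L ((z₁ - z₂).1, 0) + (z₁ - z₂).2 * L (0, 1) := apply_prod_eq L _ _
  rw [e₁, e₂, hn, h3] at h1
  have h4 : |(z₁ - z₂).2 * L (0, 1)| ≤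
      |0 - 0 - (L ((z₁ - z₂).1, 0) + (z₁ - z₂).2 * L (0, 1))| + |L ((z₁ - z₂).1, 0)| := by
    rw [← abs_neg ((z₁ - z₂).2 * L (0, 1))]
    refine le_trans (le_of_eq ?_) (abs_add_le _ _)
    congr 1; ring
  rw [abs_mul] at h4
  simp only [Prod.fst_sub, Prod.snd_sub] at *
  have hp := abs_pos.2 hL
  have h5 := h4.trans (add_le_add h1 h2)
  have h6 := mul_lt_mul_of_pos_left hlt hp
  have h7 := mul_nonneg hp.le (norm_nonneg (z₁.1 - z₂.1))
  linarith

lemma NearlyFlat.exists_zero {G : F × ℝ → ℝ} {V : Set (F × ℝ)} (h : NearlyFlat G V)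
    (hc : ContinuousOn G V) {z : F × ℝ} (hz : G z = 0) {y : F}
    (hV : ∀ s, |s - z.2| ≤ ‖y - z.1‖ → (y, s) ∈ V) (hzV : z ∈ V) :
    ∃ s, |s - z.2| ≤ ‖y - z.1‖ ∧ G (y, s) = 0 := by
  obtain ⟨L, hL, hs, hG⟩ := h
  set d := ‖y - z.1‖ with hd
  have hd0 : 0 ≤ d := norm_nonneg _
  have key : ∀ t : ℝ, |t| = d → |G (y, z.2 + t) - t * L (0, 1)| ≤ 5/8 * |L (0, 1)| * d := by
    intro t ht
    have hmem : (y, z.2 + t) ∈ V := hV _ (by simp [ht])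
    have h1 := hG _ hmem z hzV
    have hsub : ((y, z.2 + t) : F × ℝ) - z = (y - z.1, t) := by ext <;> simp
    have hn : ‖((y - z.1, t) : F × ℝ)‖ = d := by
      rw [Prod.norm_def]; simp [ht, ← hd]
    rw [hsub, hn, apply_prod_eq, hz] at h1
    have h2 := hs (y - z.1)
    have h3 : |G (y, z.2 + t) - t * L (0, 1)| ≤
        |G (y, z.2 + t) - 0 - (L (y - z.1, 0) + t * L (0, 1))| + |L (y - z.1, 0)| := by
      refine le_trans (le_of_eq ?_) (abs_add_le _ _)
      congr 1; ring
    linarith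
  have hcont : ContinuousOn (fun s => G (y, s)) (Icc (z.2 + -d) (z.2 + d)) := by
    refine hc.comp (by fun_prop) fun s hs => hV s ?_
    rw [abs_le]; constructor <;> linarith [hs.1, hs.2]
  have h1 := abs_le.1 (key d (abs_of_nonneg hd0))
  have h2 := abs_le.1 (key (-d) (by rw [abs_neg, abs_of_nonneg hd0]))
  have hle : z.2 + -d ≤ z.2 + d := by linarith
  have hmem : (0:ℝ) ∈ (fun s => G (y, s)) '' Icc (z.2 + -d) (z.2 + d) := by
    rcases lt_or_gt_of_ne hL with hneg | hpos
    · rw [abs_of_neg hneg] at h1 h2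
      exact intermediate_value_Icc' hle hcont ⟨by nlinarith, by nlinarith⟩
    · rw [abs_of_pos hpos] at h1 h2
      exact intermediate_value_Icc hle hcont ⟨by nlinarith, by nlinarith⟩
  obtain ⟨s, hs, h0⟩ := hmem
  exact ⟨s, by rw [abs_le]; constructor <;> linarith [hs.1, hs.2], h0⟩

/-- On a compact piece of the zero set with small slope, `G` is nearly flat and its
level sets have slope at most `1/2` at a uniform scale. -/
lemma exists_uniform_scale {G : F × ℝ → ℝ} {G' : F × ℝ → F × ℝ →L[ℝ] ℝ} {O K : Set (F × ℝ)}
    (hO : IsOpen O) (hG : ∀ z ∈ O, HasStrictFDerivAt G (G' z) z) (hG' : ContinuousOn G' O)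
    (hK : IsCompact K) (hKO : K ⊆ O) (hsl : ∀ z ∈ K, SlopeLE (3/8) (G' z))
    (hne : ∀ z ∈ K, G' z (0, 1) ≠ 0) :
    ∃ δ > 0, ∀ z ∈ K, NearlyFlat G (ball z δ) ∧ ball z δ ⊆ O ∧
      ∀ w ∈ ball z δ, SlopeLE (1/2) (G' w) := by
  have hloc : ∀ z ∈ K, ∃ V : Set (F × ℝ), IsOpen V ∧ z ∈ V ∧ NearlyFlat G V ∧ V ⊆ O ∧
      ∀ w ∈ V, SlopeLE (1/2) (G' w) := by
    intro z hz
    have hp := abs_pos.2 (hne z hz)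
    have h1 := (hG z (hKO hz)).isLittleO.def (c := |G' z (0, 1)| / 4) (by positivity)
    rw [nhds_prod_eq, Filter.eventually_prod_self_iff'] at h1
    obtain ⟨V₁, hV₁, h1⟩ := h1
    have h2 : ∀ᶠ w in nhds z, ‖G' w - G' z‖ ≤ |G' z (0, 1)| / 20 := by
      have hc := hG'.continuousAt (hO.mem_nhds (hKO hz))
      have := (Metric.continuousAt_iff'.1 hc) (|G' z (0, 1)| / 20) (by positivity)
      filter_upwards [this] with w hw
      rw [dist_eq_norm] at hw
      exact hw.le
    obtain ⟨V, hVs, hVo, hzV⟩ := _root_.mem_nhds_iff.1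
      (Filter.inter_mem (Filter.inter_mem hV₁ h2) (hO.mem_nhds (hKO hz)))
    exact ⟨V, hVo, hzV, ⟨G' z, hne z hz, hsl z hz, fun z₁ h₁ z₂ h₂ =>
      h1 z₁ (hVs h₁).1.1 z₂ (hVs h₂).1.1⟩, fun w hw => (hVs hw).2,
      fun w hw => (hsl z hz).perturb (hVs hw).1.2⟩
  choose! V hVo hzV hflat hVO hVs using hloc
  obtain ⟨δ, hδ, hball⟩ := lebesgue_number_lemma_of_metric (c := fun z : K => V z) hK
    (fun z => hVo z z.2) (fun z hz => mem_iUnion.2 ⟨⟨z, hz⟩, hzV z hz⟩)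
  refine ⟨δ, hδ, fun z hz => ?_⟩
  obtain ⟨⟨w, hw⟩, hsub⟩ := hball z hz
  exact ⟨(hflat w hw).mono hsub, hsub.trans (hVO w hw), fun x hx => hVs w hw x (hsub hx)⟩

lemma isInvertible_comp_inr {L : F × ℝ →L[ℝ] ℝ} (hL : L (0, 1) ≠ 0) :
    (L ∘L .inr ℝ F ℝ).IsInvertible := by
  refine ⟨ContinuousLinearEquiv.unitsEquivAut ℝ (Units.mk0 _ hL), ?_⟩
  ext
  simp

/-- A continuous function whose graph lies in a level set agrees locally with the implicit
function. -/
lemma exists_eventually_zero_iff [CompleteSpace F] {G : F × ℝ → ℝ} {L : F × ℝ →L[ℝ] ℝ} {z : F × ℝ}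
    (hG : HasStrictFDerivAt G L z) (hL : L (0, 1) ≠ 0) (hz : G z = 0) :
    ∃ ψ : F → ℝ, HasFDerivAt ψ (kerSlope L) z.1 ∧ ∀ᶠ w in nhds z, G w = 0 ↔ ψ w.1 = w.2 := by
  have hinv := isInvertible_comp_inr hL
  refine ⟨hG.implicitFunctionOfProdDomain hinv, ?_, ?_⟩
  · have h := (hG.hasStrictFDerivAt_implicitFunctionOfProdDomain hinv).hasFDerivAt
    have h1 : (L ∘L .inr ℝ F ℝ).inverse = (L (0, 1))⁻¹ • ContinuousLinearMap.id ℝ ℝ := by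
      refine ContinuousLinearMap.inverse_eq ?_ ?_ <;> ext <;> simp [hL]
    have h2 : kerSlope L = -(L ∘L .inr ℝ F ℝ).inverse ∘L (L ∘L .inl ℝ F ℝ) := by
      rw [h1]; ext v; simp [kerSlope]
    rw [h2]
    exact h
  · have h := hG.eventually_apply_eq_iff_implicitFunctionOfProdDomain hinv
    rwa [hz] at h

lemma eventually_zero_iff [CompleteSpace F] {G : F × ℝ → ℝ} {L : F × ℝ →L[ℝ] ℝ} {φ : F → ℝ} {y : F}
    (hG : HasStrictFDerivAt G L (y, φ y)) (hL : L (0, 1) ≠ 0) (hφ : ContinuousAt φ y)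
    (hz : ∀ᶠ x in nhds y, G (x, φ x) = 0) :
    HasFDerivAt φ (kerSlope L) y ∧ ∀ᶠ w in nhds (y, φ y), G w = 0 ↔ φ w.1 = w.2 := by
  obtain ⟨ψ, hψ, h⟩ := exists_eventually_zero_iff hG hL hz.self_of_nhds
  have hψφ : ∀ᶠ x in nhds y, ψ x = φ x := by
    have hc : ContinuousAt (fun x => (x, φ x)) y := continuousAt_id.prodMk hφ
    filter_upwards [hc.eventually h, hz] with x h1 h2 using h1.1 h2
  refine ⟨hψ.congr_of_eventuallyEq (hψφ.mono fun x hx => hx.symm), ?_⟩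
  filter_upwards [h, continuousAt_fst.eventually hψφ] with w h1 h2
  rw [h1, h2]

/-- The derivative of the slope along the graph. -/
lemma hasFDerivAt_kerSlope_graph {G' : F × ℝ → F × ℝ →L[ℝ] ℝ}
    {Q : F × ℝ →L[ℝ] F × ℝ →L[ℝ] ℝ} {φ : F → ℝ} {y : F}
    (hG' : HasFDerivAt G' Q (y, φ y)) (hL : G' (y, φ y) (0, 1) ≠ 0)
    (hφ : HasFDerivAt φ (kerSlope (G' (y, φ y))) y) (w : F) :
    ∃ D : F →L[ℝ] ℝ, HasFDerivAt (fun x => kerSlope (G' (x, φ x)) w) D y ∧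
      ∀ v, D v = -(Q (v, kerSlope (G' (y, φ y)) v) (w, kerSlope (G' (y, φ y)) w) /
        G' (y, φ y) (0, 1)) := by
  set L := G' (y, φ y) with hLdef
  have h0 : HasFDerivAt (fun x => (x, φ x)) ((ContinuousLinearMap.id ℝ F).prod (kerSlope L)) y :=
    (hasFDerivAt_id y).prodMk hφ
  have h1 : HasFDerivAt (fun x => G' (x, φ x))
      (Q.comp ((ContinuousLinearMap.id ℝ F).prod (kerSlope L))) y :=
    HasFDerivAt.comp y hG' h0
  have h2 := h1.clm_apply (hasFDerivAt_const ((w, 0) : F × ℝ) y)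
  have h3 := h1.clm_apply (hasFDerivAt_const ((0, 1) : F × ℝ) y)
  have h4 := (h2.mul ((hasDerivAt_inv hL).comp_hasFDerivAt y h3)).neg
  refine ⟨_, h4.congr_of_eventuallyEq (Filter.Eventually.of_forall fun x => ?_), fun v => ?_⟩
  · simp [kerSlope_apply, div_eq_mul_inv]
  · rw [apply_prod_eq (Q _) w]
    simp [kerSlope_apply, ← hLdef]
    field_simp
    ring

/-- `G` has first and second derivatives `G'`, `G''` on the open set `O`, its zeros are regular,
and at zeros of slope at most `1/2` the level set has curvature at most `M`. -/
structure CurvedLevel (G : F × ℝ → ℝ) (G' : F × ℝ → F × ℝ →L[ℝ] ℝ)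
    (G'' : F × ℝ → F × ℝ →L[ℝ] F × ℝ →L[ℝ] ℝ) (O : Set (F × ℝ)) (M : ℝ) : Prop where
  isOpen : IsOpen O
  deriv₁ : ∀ z ∈ O, HasStrictFDerivAt G (G' z) z
  deriv₂ : ∀ z ∈ O, HasFDerivAt G' (G'' z) z
  regular : ∀ z ∈ O, G z = 0 → G' z ≠ 0
  curv : ∀ z ∈ O, G z = 0 → SlopeLE (1/2) (G' z) → ∀ T T', G' z T = 0 → G' z T' = 0 →
    |G'' z T T'| ≤ M * |G' z (0, 1)| * ‖T.1‖ * ‖T'.1‖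

/-- `φ` parametrises a piece of the zero set through `z₀` as a graph over `D`. -/
structure GraphOver (G : F × ℝ → ℝ) (G' : F × ℝ → F × ℝ →L[ℝ] ℝ) (z₀ : F × ℝ) (r : ℝ)
    (φ : F → ℝ) (D : Set F) : Prop where
  continuousOn : ContinuousOn φ D
  center : φ z₀.1 = z₀.2
  zero : ∀ y ∈ D, G (y, φ y) = 0
  slopeLE : ∀ y ∈ D, SlopeLE (1/2) (G' (y, φ y))
  near : ∀ y ∈ D, |φ y - z₀.2| ≤ r

variable {G : F × ℝ → ℝ} {G' : F × ℝ → F × ℝ →L[ℝ] ℝ}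
  {G'' : F × ℝ → F × ℝ →L[ℝ] F × ℝ →L[ℝ] ℝ} {O : Set (F × ℝ)} {M : ℝ} {z₀ : F × ℝ} {r : ℝ}

lemma GraphOver.mem {φ : F → ℝ} {R : ℝ} (hφ : GraphOver G G' z₀ r φ (ball z₀.1 R)) (hR : R ≤ r)
    (hzO : closedBall z₀ r ⊆ O) {y : F} (hy : y ∈ ball z₀.1 R) : (y, φ y) ∈ O := by
  apply hzO
  rw [mem_closedBall, Prod.dist_eq, max_le_iff, Real.dist_eq]
  exact ⟨((mem_ball.1 hy).trans_le hR).le, hφ.near y hy⟩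

lemma GraphOver.hasFDerivAt [CompleteSpace F] (hG : CurvedLevel G G' G'' O M) {φ : F → ℝ} {R : ℝ}
    (hφ : GraphOver G G' z₀ r φ (ball z₀.1 R)) (hR : R ≤ r) (hzO : closedBall z₀ r ⊆ O)
    {y : F} (hy : y ∈ ball z₀.1 R) :
    HasFDerivAt φ (kerSlope (G' (y, φ y))) y ∧
      ∀ᶠ w in nhds (y, φ y), G w = 0 ↔ φ w.1 = w.2 := by
  have hO := hφ.mem hR hzO hy
  refine eventually_zero_iff (hG.deriv₁ _ hO)
    ((hφ.slopeLE y hy).ne_zero (hG.regular _ hO (hφ.zero y hy)))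
    (hφ.continuousOn.continuousAt (isOpen_ball.mem_nhds hy)) ?_
  filter_upwards [isOpen_ball.mem_nhds hy] with x hx using hφ.zero x hx

lemma GraphOver.lipschitz_kerSlope [CompleteSpace F] (hG : CurvedLevel G G' G'' O M) (hM : 0 ≤ M)
    {φ : F → ℝ} {R : ℝ} (hφ : GraphOver G G' z₀ r φ (ball z₀.1 R)) (hR : R ≤ r)
    (hzO : closedBall z₀ r ⊆ O) {y x : F} (hy : y ∈ ball z₀.1 R) (hx : x ∈ ball z₀.1 R) :
    ‖kerSlope (G' (y, φ y)) - kerSlope (G' (x, φ x))‖ ≤ M * ‖y - x‖ := by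
  refine ContinuousLinearMap.opNorm_le_bound _ (by positivity) fun w => ?_
  have key : ∀ p ∈ ball z₀.1 R, ∃ D : F →L[ℝ] ℝ,
      HasFDerivAt (fun p => kerSlope (G' (p, φ p)) w) D p ∧ ‖D‖ ≤ M * ‖w‖ := by
    intro p hp
    have hO := hφ.mem hR hzO hp
    have hne := (hφ.slopeLE p hp).ne_zero (hG.regular _ hO (hφ.zero p hp))
    obtain ⟨D, hD, hDv⟩ := hasFDerivAt_kerSlope_graph (hG.deriv₂ _ hO) hne
      (hφ.hasFDerivAt hG hR hzO hp).1 w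
    refine ⟨D, hD, ContinuousLinearMap.opNorm_le_bound _ (by positivity) fun v => ?_⟩
    have hc := hG.curv _ hO (hφ.zero p hp) (hφ.slopeLE p hp) _ _
      (apply_kerSlope hne v) (apply_kerSlope hne w)
    rw [hDv, norm_neg, norm_div, Real.norm_eq_abs, Real.norm_eq_abs, div_le_iff₀ (abs_pos.2 hne)]
    simp only at hc
    linarith
  choose! D hD hDn using key
  have h := (convex_ball z₀.1 R).norm_image_sub_le_of_norm_hasFDerivWithin_le
    (fun p hp => (hD p hp).hasFDerivWithinAt) hDn hx hy
  rw [sub_apply]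
  linarith

lemma GraphOver.norm_kerSlope_le [CompleteSpace F] (hG : CurvedLevel G G' G'' O M) (hM : 0 ≤ M)
    {φ : F → ℝ} {R : ℝ} (hφ : GraphOver G G' z₀ r φ (ball z₀.1 R)) (hR : R ≤ r)
    (hzO : closedBall z₀ r ⊆ O) {a : ℝ} (ha : 0 ≤ a) (ha₀ : SlopeLE a (G' z₀))
    {y : F} (hy : y ∈ ball z₀.1 R) : ‖kerSlope (G' (y, φ y))‖ ≤ a + M * r := by
  have h0 : z₀.1 ∈ ball z₀.1 R := mem_ball_self (dist_nonneg.trans_lt (mem_ball.1 hy))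
  have hz : (z₀.1, φ z₀.1) = z₀ := by rw [hφ.center]
  have h1 := hφ.lipschitz_kerSlope hG hM hR hzO hy h0
  have h2 : ‖kerSlope (G' (z₀.1, φ z₀.1))‖ ≤ a := by
    have hO := hφ.mem hR hzO h0
    have hne := (hφ.slopeLE _ h0).ne_zero (hG.regular _ hO (hφ.zero _ h0))
    rw [hz] at hne ⊢
    exact ha₀.norm_kerSlope_le ha hne
  have h3 : M * ‖y - z₀.1‖ ≤ M * r := by
    rw [← dist_eq_norm]
    exact mul_le_mul_of_nonneg_left ((mem_ball.1 hy).le.trans hR) hM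
  have h4 := norm_add_le (kerSlope (G' (y, φ y)) - kerSlope (G' (z₀.1, φ z₀.1)))
    (kerSlope (G' (z₀.1, φ z₀.1)))
  rw [sub_add_cancel] at h4
  linarith

lemma GraphOver.abs_sub_le [CompleteSpace F] (hG : CurvedLevel G G' G'' O M) (hM : 0 ≤ M)
    {φ : F → ℝ} {R : ℝ} (hφ : GraphOver G G' z₀ r φ (ball z₀.1 R)) (hR : R ≤ r)
    (hzO : closedBall z₀ r ⊆ O) {a : ℝ} (ha : 0 ≤ a) (ha₀ : SlopeLE a (G' z₀))
    {y : F} (hy : y ∈ ball z₀.1 R) : |φ y - z₀.2| ≤ (a + M * r) * ‖y - z₀.1‖ := by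
  have h0 : z₀.1 ∈ ball z₀.1 R := mem_ball_self (dist_nonneg.trans_lt (mem_ball.1 hy))
  rw [← hφ.center, ← Real.norm_eq_abs]
  exact (convex_ball z₀.1 R).norm_image_sub_le_of_norm_hasFDerivWithin_le
    (fun p hp => (hφ.hasFDerivAt hG hR hzO hp).1.hasFDerivWithinAt)
    (fun p hp => hφ.norm_kerSlope_le hG hM hR hzO ha ha₀ hp) h0 hy

/-- Continuation of a graph along a contraction `κ` of the larger ball. -/
lemma GraphOver.extend {φ : F → ℝ} {D D' : Set F} {δ : ℝ} {κ : F → F} (hδ : 0 < δ) (hδr : δ ≤ r)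
    (hφ : ContinuousOn φ D)
    (hcenter : φ z₀.1 = z₀.2) (hzero : ∀ y ∈ D, G (y, φ y) = 0)
    (hnear : ∀ y ∈ D, |φ y - z₀.2| ≤ r / 2)
    (hGc : ContinuousOn G O)
    (hscale : ∀ y ∈ D, NearlyFlat G (ball (y, φ y) δ) ∧ ball (y, φ y) δ ⊆ O ∧
      ∀ w ∈ ball (y, φ y) δ, SlopeLE (1/2) (G' w))
    (hκ : Continuous κ) (hκD : MapsTo κ D' D) (hκ₀ : κ z₀.1 = z₀.1) (hz₀ : z₀.1 ∈ D')
    (hκδ : ∀ y ∈ D', ‖y - κ y‖ ≤ δ / 2) :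
    ∃ φ' : F → ℝ, GraphOver G G' z₀ r φ' D' := by
  have hmem : ∀ y ∈ D', ∀ s, |s - φ (κ y)| ≤ ‖y - κ y‖ → (y, s) ∈ ball (κ y, φ (κ y)) δ := by
    intro y hy s hs
    rw [mem_ball, Prod.dist_eq, max_lt_iff, Real.dist_eq, dist_eq_norm]
    have := hκδ y hy
    constructor <;> dsimp only <;> linarith
  have hex : ∀ y ∈ D', ∃ s, |s - φ (κ y)| ≤ ‖y - κ y‖ ∧ G (y, s) = 0 := by
    intro y hy
    obtain ⟨h1, h2, -⟩ := hscale _ (hκD hy)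
    exact h1.exists_zero (hGc.mono h2) (hzero _ (hκD hy)) (hmem y hy) (mem_ball_self hδ)
  choose! φ' hφ' hφ'0 using hex
  refine ⟨φ', ?_, ?_, hφ'0, fun y hy => ?_, fun y hy => ?_⟩
  · intro y hy
    have hc : Tendsto (fun x => φ (κ x)) (nhdsWithin y D') (nhds (φ (κ y))) :=
      (hφ.comp hκ.continuousOn hκD) y hy
    have hk : Tendsto κ (nhdsWithin y D') (nhds (κ y)) := hκ.continuousWithinAt
    have hid : Tendsto (fun x => x) (nhdsWithin y D') (nhds y) := tendsto_id.mono_left inf_le_left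
    have e1 : ∀ᶠ x in nhdsWithin y D', |φ (κ x) - φ (κ y)| < δ / 4 := by
      have := Metric.tendsto_nhds.1 hc (δ/4) (by positivity)
      simpa [Real.dist_eq] using this
    have e2 : ∀ᶠ x in nhdsWithin y D', ‖x - y‖ < δ / 4 := by
      have := Metric.tendsto_nhds.1 hid (δ/4) (by positivity)
      simpa [dist_eq_norm] using this
    have e3 : ∀ᶠ x in nhdsWithin y D', ‖κ x - κ y‖ < δ / 4 := by
      have := Metric.tendsto_nhds.1 hk (δ/4) (by positivity)
      simpa [dist_eq_norm] using this
    have hle : ∀ᶠ x in nhdsWithin y D', |φ' x - φ' y| ≤ ‖x - y‖ := by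
      filter_upwards [e1, e2, e3, self_mem_nhdsWithin] with x h1 h2 h3 hx
      have m1 : (x, φ' x) ∈ ball (κ y, φ (κ y)) δ := by
        rw [mem_ball, Prod.dist_eq, max_lt_iff, Real.dist_eq, dist_eq_norm]
        constructor
        · have := norm_add_le (x - κ x) (κ x - κ y)
          rw [sub_add_sub_cancel] at this
          dsimp only
          linarith [hκδ x hx]
        · have := abs_add_le (φ' x - φ (κ x)) (φ (κ x) - φ (κ y))
          rw [sub_add_sub_cancel] at this
          dsimp only
          linarith [hκδ x hx, hφ' x hx]
      exact (hscale _ (hκD hy)).1.abs_sub_le m1 (hmem y hy _ (hφ' y hy)) (hφ'0 x hx) (hφ'0 y hy)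
    have hlim : Tendsto (fun x => ‖x - y‖) (nhdsWithin y D') (nhds 0) := by
      rw [← tendsto_iff_norm_sub_tendsto_zero]
      exact hid
    refine tendsto_iff_norm_sub_tendsto_zero.2 (squeeze_zero' ?_ hle hlim)
    exact Filter.Eventually.of_forall fun _ => norm_nonneg _
  · have := hφ' _ hz₀
    rw [hκ₀, sub_self, norm_zero, hcenter] at this
    exact sub_eq_zero.1 (abs_eq_zero.1 (le_antisymm this (abs_nonneg _)))
  · exact (hscale _ (hκD hy)).2.2 _ (hmem y hy _ (hφ' y hy))
  · have := abs_add_le (φ' y - φ (κ y)) (φ (κ y) - z₀.2)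
    rw [sub_add_sub_cancel] at this
    linarith [hκδ y hy, hφ' y hy, hnear _ (hκD hy)]

lemma isCompact_zero_slopeLE [ProperSpace F] {C : Set (F × ℝ)} (hC : IsCompact C)
    (hG : ContinuousOn G C) (hG' : ContinuousOn G' C) (a c d : ℝ) :
    IsCompact {z ∈ C | G z = 0 ∧ SlopeLE a (G' z) ∧ |z.2 - c| ≤ d} := by
  have h1 : IsClosed {z ∈ C | |G z| ≤ 0} := hC.isClosed.isClosed_le hG.abs continuousOn_const
  have h2 : ∀ v : F, IsClosed {z ∈ C | |G' z (v, 0)| ≤ a * |G' z (0, 1)| * ‖v‖} := fun v =>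
    hC.isClosed.isClosed_le (hG'.clm_apply continuousOn_const).abs
      ((continuousOn_const.mul (hG'.clm_apply continuousOn_const).abs).mul continuousOn_const)
  have h3 : IsClosed {z : F × ℝ | |z.2 - c| ≤ d} := isClosed_le (by fun_prop) (by fun_prop)
  refine hC.of_isClosed_subset ?_ fun z hz => hz.1
  convert (h1.inter (isClosed_iInter h2)).inter h3 using 1
  ext z
  simp only [SlopeLE, mem_ofPred_eq, mem_inter_iff, mem_iInter, abs_nonpos_iff]
  constructor
  · rintro ⟨hz, h, h', h''⟩
    exact ⟨⟨⟨hz, h⟩, fun v => ⟨hz, h' v⟩⟩, h''⟩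
  · rintro ⟨⟨⟨hz, h⟩, h'⟩, h''⟩
    exact ⟨hz, h, fun v => (h' v).2, h''⟩

/-- A level set of bounded curvature is, near a point where it is almost horizontal, a graph
over a ball of controlled size. -/
theorem CurvedLevel.exists_graph [ProperSpace F]
    (hG : CurvedLevel G G' G'' O M) (hM : 0 ≤ M)
    (hr : 0 < r) (hMr : M * r ≤ 1/8) (hzO : closedBall z₀ r ⊆ O) (hz₀ : G z₀ = 0)
    (hs : SlopeLE (1/4) (G' z₀)) : ∃ φ : F → ℝ, GraphOver G G' z₀ r φ (ball z₀.1 r) := by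
  have hGc : ContinuousOn G O := fun z hz => (hG.deriv₁ z hz).continuousAt.continuousWithinAt
  have hGc' : ContinuousOn G' O := fun z hz => (hG.deriv₂ z hz).continuousAt.continuousWithinAt
  obtain ⟨δ₀, hδ₀, hscale₀⟩ := exists_uniform_scale hG.isOpen hG.deriv₁ hGc'
    (isCompact_zero_slopeLE (isCompact_closedBall z₀ r) (hGc.mono hzO) (hGc'.mono hzO)
      (3/8) z₀.2 (r/2)) (fun z hz => hzO hz.1) (fun z hz => hz.2.2.1)
      (fun z hz => hz.2.2.1.ne_zero (hG.regular z (hzO hz.1) hz.2.1))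
  set δ := min δ₀ r
  have hδ : 0 < δ := lt_min hδ₀ hr
  have hδr : δ ≤ r := min_le_right _ _
  have hscale : ∀ z ∈ closedBall z₀ r, G z = 0 → SlopeLE (3/8) (G' z) → |z.2 - z₀.2| ≤ r/2 →
      NearlyFlat G (ball z δ) ∧ ball z δ ⊆ O ∧ ∀ w ∈ ball z δ, SlopeLE (1/2) (G' w) := by
    intro z h1 h2 h3 h4
    obtain ⟨k1, k2, k3⟩ := hscale₀ z ⟨h1, h2, h3, h4⟩
    have hsub : ball z δ ⊆ ball z δ₀ := ball_subset_ball (min_le_left _ _)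
    exact ⟨k1.mono hsub, hsub.trans k2, fun w hw => k3 w (hsub hw)⟩
  have hstep : ∀ k : ℕ, ∃ φ : F → ℝ,
      GraphOver G G' z₀ r φ (ball z₀.1 (min ((k + 1) * (δ / 2)) r)) := by
    intro k
    induction k with
    | zero =>
      refine GraphOver.extend (φ := fun _ => z₀.2) (D := {z₀.1}) (κ := fun _ => z₀.1) hδ hδr
        continuousOn_const rfl ?_ ?_ hGc ?_ continuous_const (fun _ _ => rfl) rfl ?_ ?_
      · rintro y rfl; exact hz₀
      · intro y _; simp only [sub_self, abs_zero]; positivity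
      · rintro y rfl
        exact hscale z₀ (mem_closedBall_self hr.le) hz₀ (hs.mono (by norm_num))
          (by simp only [sub_self, abs_zero]; positivity)
      · exact mem_ball_self (lt_min (by positivity) hr)
      · intro y hy
        have := (mem_ball.1 hy).le.trans (min_le_left _ _)
        rw [dist_eq_norm] at this
        simpa using this
    | succ k ih =>
      obtain ⟨φ, hφ⟩ := ih
      set R := min ((k + 1) * (δ / 2)) r
      set R' := min (((k + 1 : ℕ) + 1) * (δ / 2)) r
      have hR0 : 0 < R := lt_min (by positivity) hr
      have hRr : R ≤ r := min_le_right _ _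
      have hRR : R ≤ R' := by
        refine min_le_min_right _ ?_
        push_cast
        linarith
      have hR'0 : 0 < R' := hR0.trans_le hRR
      have hRδ : R' ≤ R + δ / 2 := by
        rcases min_choice ((k + 1) * (δ / 2)) r with h | h
        · refine (min_le_left _ _).trans (le_of_eq ?_)
          simp only [R, h]
          push_cast
          ring
        · have : R = r := h
          have := min_le_right (((k + 1 : ℕ) + 1) * (δ / 2)) r
          linarith
      have hslope : ∀ y ∈ ball z₀.1 R, SlopeLE (3/8) (G' (y, φ y)) := by
        intro y hy
        have hO := hφ.mem hRr hzO hy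
        refine slopeLE_of_norm_kerSlope_le
          ((hφ.slopeLE y hy).ne_zero (hG.regular _ hO (hφ.zero y hy))) ?_
        have := hφ.norm_kerSlope_le hG hM hRr hzO (by norm_num) hs hy
        linarith
      have hnear : ∀ y ∈ ball z₀.1 R, |φ y - z₀.2| ≤ r / 2 := by
        intro y hy
        have h1 := hφ.abs_sub_le hG hM hRr hzO (by norm_num) hs hy
        have h2 : ‖y - z₀.1‖ ≤ r := by
          rw [← dist_eq_norm]; exact (mem_ball.1 hy).le.trans hRr
        nlinarith [norm_nonneg (y - z₀.1)]
      have hnorm : ∀ y, ‖y - (z₀.1 + (R / R') • (y - z₀.1))‖ = (1 - R / R') * ‖y - z₀.1‖ := by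
        intro y
        have : y - (z₀.1 + (R / R') • (y - z₀.1)) = (1 - R / R') • (y - z₀.1) := by module
        rw [this, norm_smul, Real.norm_of_nonneg (sub_nonneg.2 ((div_le_one hR'0).2 hRR))]
      refine GraphOver.extend (κ := fun y => z₀.1 + (R / R') • (y - z₀.1)) hδ hδr
        hφ.continuousOn hφ.center hφ.zero hnear hGc ?_ (by fun_prop) ?_ (by simp)
        (mem_ball_self hR'0) ?_
      · intro y hy
        refine hscale _ ?_ (hφ.zero y hy) (hslope y hy) (hnear y hy)
        rw [mem_closedBall, Prod.dist_eq, max_le_iff, Real.dist_eq]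
        exact ⟨((mem_ball.1 hy).trans_le hRr).le, hφ.near y hy⟩
      · intro y hy
        rw [mem_ball, dist_eq_norm] at hy ⊢
        rw [add_sub_cancel_left, norm_smul, Real.norm_of_nonneg (by positivity), div_mul_eq_mul_div,
          div_lt_iff₀ hR'0]
        exact mul_lt_mul_of_pos_left hy hR0
      · intro y hy
        rw [mem_ball, dist_eq_norm] at hy
        rw [hnorm]
        have h1 : (1 - R / R') * ‖y - z₀.1‖ ≤ (1 - R / R') * R' :=
          mul_le_mul_of_nonneg_left hy.le (sub_nonneg.2 ((div_le_one hR'0).2 hRR))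
        have h2 : (1 - R / R') * R' = R' - R := by field_simp
        linarith
  obtain ⟨k, hk⟩ := exists_nat_ge (r / (δ / 2))
  rw [div_le_iff₀ (by positivity)] at hk
  obtain ⟨φ, hφ⟩ := hstep k
  rw [min_eq_right (by nlinarith)] at hφ
  exact ⟨φ, hφ⟩

end Graph

section Hessian

lemma inner_sq_add_inner_sq_le {E : Type*} [NormedAddCommGroup E] [InnerProductSpace ℝ E]
    {g T : E} (h : E) (hg : g ≠ 0) (hT : ⟪g, T⟫ = 0) :
    ⟪h, T⟫ ^ 2 + (⟪h, g⟫ / ‖g‖) ^ 2 * ‖T‖ ^ 2 ≤ ‖h‖ ^ 2 * ‖T‖ ^ 2 := by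
  have hg' : 0 < ‖g‖ := norm_pos_iff.2 hg
  have h1 := real_inner_mul_inner_self_le (h - (⟪h, g⟫ / ‖g‖ ^ 2) • g) T
  have h2 : ⟪h - (⟪h, g⟫ / ‖g‖ ^ 2) • g, T⟫ = ⟪h, T⟫ := by
    rw [inner_sub_left, real_inner_smul_left, hT]; ring
  have h3 : ⟪h - (⟪h, g⟫ / ‖g‖ ^ 2) • g, h - (⟪h, g⟫ / ‖g‖ ^ 2) • g⟫
      = ‖h‖ ^ 2 - (⟪h, g⟫ / ‖g‖) ^ 2 := by
    rw [inner_sub_left, inner_sub_right, inner_sub_right, real_inner_smul_left,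
      real_inner_smul_right, real_inner_smul_right, real_inner_smul_left, real_inner_self_eq_norm_sq,
      real_inner_self_eq_norm_sq, real_inner_comm g h]
    field_simp
    ring
  rw [h2, h3, real_inner_self_eq_norm_sq] at h1
  linarith

variable {n : ℕ} {u : Euc n → ℝ} {x : Euc n}

lemma norm_gradient (f : Euc n → ℝ) (y : Euc n) : ‖gradient f y‖ = ‖fderiv ℝ f y‖ :=
  (InnerProductSpace.toDual ℝ (Euc n)).symm.norm_map _

lemma hasFDerivAt_norm_gradient (hu : DifferentiableAt ℝ (fderiv ℝ u) x) (hg : gradient u x ≠ 0) :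
    ∃ D : Euc n →L[ℝ] ℝ, HasFDerivAt (fun y => ‖gradient u y‖) D x ∧
      ∀ X, D X = fderiv ℝ (fderiv ℝ u) x X (gradient u x) / ‖gradient u x‖ := by
  have h1 : HasFDerivAt (gradient u)
      ((InnerProductSpace.toDual ℝ (Euc n)).symm.toContinuousLinearEquiv.toContinuousLinearMap.comp
        (fderiv ℝ (fderiv ℝ u) x)) x :=
    (InnerProductSpace.toDual ℝ (Euc n)).symm.toContinuousLinearEquiv.hasFDerivAt.comp x
      hu.hasFDerivAt
  have hpos : 0 < ‖gradient u x‖ := norm_pos_iff.2 hg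
  have h2 := h1.norm_sq.sqrt (by positivity)
  simp only [Real.sqrt_sq (norm_nonneg _)] at h2
  refine ⟨_, h2, fun X => ?_⟩
  have h3 : ⟪gradient u x, (InnerProductSpace.toDual ℝ (Euc n)).symm
      (fderiv ℝ (fderiv ℝ u) x X)⟫ = fderiv ℝ (fderiv ℝ u) x X (gradient u x) := by
    rw [real_inner_comm, InnerProductSpace.toDual_symm_apply]
  simp [h3]
  field_simp

lemma Bnorm_hessian_le {Λ : ℝ} (hu : ContDiffAt ℝ 2 u x) (hg : gradient u x ≠ 0)
    (hB : Bnorm u x ≤ Λ) {T : Euc n} (hT : fderiv ℝ u x T = 0) (X : Euc n) :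
    |fderiv ℝ (fderiv ℝ u) x X T| ≤ Λ * ‖fderiv ℝ u x‖ * ‖X‖ * ‖T‖ := by
  set A := fderiv ℝ (fderiv ℝ u) x
  set g := gradient u x
  have hpos : 0 < ‖g‖ := norm_pos_iff.2 hg
  have hdiff : DifferentiableAt ℝ (fderiv ℝ u) x :=
    (hu.fderiv_right (m := 1) (by norm_num)).differentiableAt (by norm_num)
  have hgT : ⟪g, T⟫ = 0 := by rw [inner_gradient_left]; exact hT
  obtain ⟨D, hD, hDX⟩ := hasFDerivAt_norm_gradient hdiff hg
  have hΛ : 0 ≤ Λ := by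
    refine le_trans ?_ hB
    rw [Bnorm]; split_ifs
    · exact le_rfl
    · exact Real.sqrt_nonneg _
  have hq : hessSq u x - ‖D‖ ^ 2 ≤ Λ ^ 2 * ‖g‖ ^ 2 := by
    rw [Bnorm, if_neg hg, Real.sqrt_le_left hΛ, norm_gradient, hD.fderiv,
      div_le_iff₀ (by positivity)] at hB
    exact hB
  have hess : hessSq u x = ∑ i, ‖A (eb n i)‖ ^ 2 := by
    refine Finset.sum_congr rfl fun i _ => ?_
    rw [(EuclideanSpace.basisFun (Fin n) ℝ).norm_dual]
    refine Finset.sum_congr rfl fun j _ => ?_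
    rw [iteratedFDeriv_two_apply]
    rfl
  have hDn : ‖D‖ ^ 2 = ∑ i, (A (eb n i) g / ‖g‖) ^ 2 := by
    rw [(EuclideanSpace.basisFun (Fin n) ℝ).norm_dual]
    refine Finset.sum_congr rfl fun j _ => ?_
    rw [hDX]
    rfl
  have hflip : ‖A.flip T‖ ^ 2 = ∑ i, (A (eb n i) T) ^ 2 := by
    rw [(EuclideanSpace.basisFun (Fin n) ℝ).norm_dual]
    rfl
  have hsum : ‖A.flip T‖ ^ 2 + ‖D‖ ^ 2 * ‖T‖ ^ 2 ≤ hessSq u x * ‖T‖ ^ 2 := by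
    rw [hess, hDn, hflip, Finset.sum_mul, Finset.sum_mul, ← Finset.sum_add_distrib]
    refine Finset.sum_le_sum fun i _ => ?_
    have := inner_sq_add_inner_sq_le
      ((InnerProductSpace.toDual ℝ (Euc n)).symm (A (eb n i))) hg hgT
    rwa [InnerProductSpace.toDual_symm_apply, InnerProductSpace.toDual_symm_apply,
      LinearIsometryEquiv.norm_map] at this
  have hfl : ‖A.flip T‖ ≤ Λ * ‖g‖ * ‖T‖ := by
    refine (sq_le_sq₀ (norm_nonneg _) (by positivity)).1 ?_
    nlinarith [sq_nonneg ‖T‖]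
  have h := (A.flip T).le_of_opNorm_le hfl X
  rw [ContinuousLinearMap.flip_apply, Real.norm_eq_abs] at h
  rw [← norm_gradient]
  linarith

end Hessian

section Chart

variable {m : ℕ}

/-- `ℝ^m × ℝ ≃ ℝ^{m+1}`. -/
def joinE (m : ℕ) : (Euc m × ℝ) ≃ₗ[ℝ] Euc (m+1) where
  toFun z := (EuclideanSpace.equiv (Fin (m+1)) ℝ).symm (Fin.snoc (α := fun _ => ℝ) z.1 z.2)
  invFun x := (projE m x, x (Fin.last m))
  map_add' z w := by ext i; induction i using Fin.lastCases <;> simp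
  map_smul' c z := by ext i; induction i using Fin.lastCases <;> simp
  left_inv z := by ext <;> simp [projE]
  right_inv x := by ext i; induction i using Fin.lastCases <;> simp [projE]

/-- The parametrisation of `ℝ^{m+1}` by `ℝ^m × ℝ` given by the coordinate system `Φ`. -/
def chart (Φ : Euc (m+1) ≃ₗᵢ[ℝ] Euc (m+1)) : (Euc m × ℝ) ≃L[ℝ] Euc (m+1) :=
  (joinE m).toContinuousLinearEquiv.trans Φ.symm.toContinuousLinearEquiv

variable (Φ : Euc (m+1) ≃ₗᵢ[ℝ] Euc (m+1))

lemma chart_symm_apply (x : Euc (m+1)) :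
    (chart Φ).symm x = (projE m (Φ x), (Φ x) (Fin.last m)) := rfl

lemma norm_chart_sq (z : Euc m × ℝ) : ‖chart Φ z‖ ^ 2 = ‖z.1‖ ^ 2 + z.2 ^ 2 := by
  have : ‖chart Φ z‖ = ‖joinE m z‖ := Φ.symm.norm_map _
  rw [this, EuclideanSpace.norm_sq_eq, EuclideanSpace.norm_sq_eq, Fin.sum_univ_castSucc]
  simp [joinE]

lemma norm_chart_le (z : Euc m × ℝ) : ‖chart Φ z‖ ≤ ‖z.1‖ + |z.2| := by
  refine (sq_le_sq₀ (norm_nonneg _) (by positivity)).1 ?_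
  rw [norm_chart_sq, add_sq, sq_abs]
  nlinarith [mul_nonneg (norm_nonneg z.1) (abs_nonneg z.2)]

lemma norm_fst_le_norm_chart (z : Euc m × ℝ) : ‖z.1‖ ≤ ‖chart Φ z‖ := by
  refine (sq_le_sq₀ (norm_nonneg _) (norm_nonneg _)).1 ?_
  rw [norm_chart_sq]
  nlinarith [sq_nonneg z.2]

lemma abs_snd_le_norm_chart (z : Euc m × ℝ) : |z.2| ≤ ‖chart Φ z‖ := by
  refine (sq_le_sq₀ (abs_nonneg _) (norm_nonneg _)).1 ?_
  rw [norm_chart_sq, sq_abs]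
  nlinarith [sq_nonneg ‖z.1‖]

lemma norm_chart_inl (v : Euc m) : ‖chart Φ (v, 0)‖ = ‖v‖ := by
  refine (sq_eq_sq₀ (norm_nonneg _) (norm_nonneg _)).1 ?_
  rw [norm_chart_sq]; simp

variable {Φ} {e : Euc (m+1)}

lemma inner_chart (he : Φ e = eb (m+1) (Fin.last m)) (z : Euc m × ℝ) : ⟪e, chart Φ z⟫ = z.2 := by
  have h : Φ (chart Φ z) = joinE m z := Φ.apply_symm_apply _
  rw [← Φ.inner_map_map, he, h, eb, EuclideanSpace.basisFun_inner]
  simp [joinE]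

lemma chart_inr (he : Φ e = eb (m+1) (Fin.last m)) : chart Φ (0, 1) = e := by
  apply Φ.injective
  have h : Φ (chart Φ (0, 1)) = joinE m (0, 1) := Φ.apply_symm_apply _
  rw [he, h]
  ext i
  induction i using Fin.lastCases <;> simp [joinE, eb]

lemma exists_coordinates (he : ‖e‖ = 1) :
    ∃ Φ : Euc (m+1) ≃ₗᵢ[ℝ] Euc (m+1), Φ e = eb (m+1) (Fin.last m) :=
  ⟨(ℝ ∙ (e - eb (m+1) (Fin.last m)))ᗮ.reflection,
    Submodule.reflection_sub (by simp [he, eb])⟩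

end Chart

section Level

variable {m : ℕ}

/-- The level set `{u = c}` is regular with curvature at most `Λ` in the unit ball. -/
structure LevelBound (u : Euc (m+1) → ℝ) (c Λ : ℝ) : Prop where
  contDiffOn : ContDiffOn ℝ 2 u (ball 0 1)
  nonneg : 0 ≤ Λ
  regular : ∀ x ∈ ball (0 : Euc (m+1)) 1, u x = c → gradient u x ≠ 0
  curv : ∀ x ∈ ball (0 : Euc (m+1)) 1, u x = c → Bnorm u x ≤ Λ

/-- The derivative of `u` in the coordinate system `Φ`. -/
def chartDeriv (u : Euc (m+1) → ℝ) (Φ : Euc (m+1) ≃ₗᵢ[ℝ] Euc (m+1)) (z : Euc m × ℝ) :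
    Euc m × ℝ →L[ℝ] ℝ :=
  (fderiv ℝ u (chart Φ z)).comp (chart Φ : Euc m × ℝ →L[ℝ] Euc (m+1))

/-- The second derivative of `u` in the coordinate system `Φ`. -/
def chartHess (u : Euc (m+1) → ℝ) (Φ : Euc (m+1) ≃ₗᵢ[ℝ] Euc (m+1)) (z : Euc m × ℝ) :
    Euc m × ℝ →L[ℝ] Euc m × ℝ →L[ℝ] ℝ :=
  ((ContinuousLinearMap.compL ℝ (Euc m × ℝ) (Euc (m+1)) ℝ).flip
    (chart Φ : Euc m × ℝ →L[ℝ] Euc (m+1))).comp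
    ((fderiv ℝ (fderiv ℝ u) (chart Φ z)).comp (chart Φ : Euc m × ℝ →L[ℝ] Euc (m+1)))

lemma chartDeriv_apply (u : Euc (m+1) → ℝ) (Φ : Euc (m+1) ≃ₗᵢ[ℝ] Euc (m+1)) (z T : Euc m × ℝ) :
    chartDeriv u Φ z T = fderiv ℝ u (chart Φ z) (chart Φ T) := rfl

variable {u : Euc (m+1) → ℝ} {c Λ : ℝ}

lemma LevelBound.curvedLevel (h : LevelBound u c Λ) (Φ : Euc (m+1) ≃ₗᵢ[ℝ] Euc (m+1)) :
    CurvedLevel (fun z => u (chart Φ z) - c) (chartDeriv u Φ) (chartHess u Φ)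
      (chart Φ ⁻¹' ball 0 1) (4 * Λ) := by
  have hcd : ∀ x ∈ ball (0 : Euc (m+1)) 1, ContDiffAt ℝ 2 u x := fun x hx =>
    h.contDiffOn.contDiffAt (isOpen_ball.mem_nhds hx)
  have hne : ∀ z ∈ chart Φ ⁻¹' ball 0 1, u (chart Φ z) - c = 0 → chartDeriv u Φ z ≠ 0 := by
    intro z hz h0 hL
    refine h.regular _ hz (sub_eq_zero.1 h0) (norm_eq_zero.1 ?_)
    rw [norm_gradient, norm_eq_zero]
    ext X
    have := chartDeriv_apply u Φ z ((chart Φ).symm X)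
    rw [hL, (chart Φ).apply_symm_apply] at this
    exact this.symm
  refine ⟨isOpen_ball.preimage (chart Φ).continuous, fun z hz => ?_, fun z hz => ?_, hne, ?_⟩
  · exact (((hcd _ hz).hasStrictFDerivAt (by norm_num)).comp z
      (chart Φ).hasStrictFDerivAt).sub_const c
  · have hd : HasFDerivAt (fderiv ℝ u) (fderiv ℝ (fderiv ℝ u) (chart Φ z)) (chart Φ z) :=
      (((hcd _ hz).fderiv_right (m := 1) (by norm_num)).differentiableAt (by norm_num)).hasFDerivAt
    exact ((ContinuousLinearMap.compL ℝ (Euc m × ℝ) (Euc (m+1)) ℝ).flip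
      (chart Φ : Euc m × ℝ →L[ℝ] Euc (m+1))).hasFDerivAt.comp z
      (hd.comp z (chart Φ).hasFDerivAt)
  · intro z hz h0 hs T T' hT hT'
    set L := chartDeriv u Φ z
    have hL := hs.ne_zero (hne z hz h0)
    have hLpos := abs_pos.2 hL
    have hlen : ∀ T : Euc m × ℝ, L T = 0 → ‖chart Φ T‖ ≤ 3 / 2 * ‖T.1‖ := by
      intro T hT
      have h1 : L (T.1, 0) = -(T.2 * L (0, 1)) := by
        have := apply_prod_eq L T.1 T.2
        rw [hT] at this
        linarith
      have h2 := hs T.1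
      rw [h1, abs_neg, abs_mul] at h2
      have h3 : |T.2| ≤ 1 / 2 * ‖T.1‖ := by
        refine le_of_mul_le_mul_right ?_ hLpos
        linarith
      linarith [norm_chart_le Φ T]
    have hDu : ‖fderiv ℝ u (chart Φ z)‖ ≤ 3 / 2 * |L (0, 1)| := by
      refine ContinuousLinearMap.opNorm_le_bound _ (by positivity) fun X => ?_
      obtain ⟨T, rfl⟩ := (chart Φ).surjective X
      have h1 := apply_prod_eq L T.1 T.2
      have h2 := hs T.1
      have h3 := abs_add_le (L (T.1, 0)) (T.2 * L (0, 1))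
      rw [← h1, abs_mul] at h3
      have h4 := norm_fst_le_norm_chart Φ T
      have h5 := abs_snd_le_norm_chart Φ T
      rw [Real.norm_eq_abs]
      change |L T| ≤ _
      have : |L T| ≤ |L (T.1, T.2)| := le_rfl
      nlinarith
    have hb := Bnorm_hessian_le (hcd _ hz) (h.regular _ hz (sub_eq_zero.1 h0))
      (h.curv _ hz (sub_eq_zero.1 h0)) (T := chart Φ T') hT' (chart Φ T)
    have hΛ := h.nonneg
    calc |chartHess u Φ z T T'|
        = |fderiv ℝ (fderiv ℝ u) (chart Φ z) (chart Φ T) (chart Φ T')| := rfl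
      _ ≤ Λ * ‖fderiv ℝ u (chart Φ z)‖ * ‖chart Φ T‖ * ‖chart Φ T'‖ := hb
      _ ≤ Λ * (3 / 2 * |L (0, 1)|) * (3 / 2 * ‖T.1‖) * (3 / 2 * ‖T'.1‖) := by
        gcongr
        exacts [hlen T hT, hlen T' hT']
      _ = 27 / 8 * (Λ * |L (0, 1)| * ‖T.1‖ * ‖T'.1‖) := by ring
      _ ≤ 4 * (Λ * |L (0, 1)| * ‖T.1‖ * ‖T'.1‖) := by gcongr; norm_num
      _ = 4 * Λ * |L (0, 1)| * ‖T.1‖ * ‖T'.1‖ := by ring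

lemma closedBall_subset_chart_preimage {Φ : Euc (m+1) ≃ₗᵢ[ℝ] Euc (m+1)} {q : Euc (m+1)} {r : ℝ}
    (hq : ‖q‖ < 15 / 16) (hr : r ≤ 1 / 32) :
    closedBall ((chart Φ).symm q) r ⊆ chart Φ ⁻¹' ball 0 1 := by
  intro z hz
  rw [mem_closedBall, Prod.dist_eq, max_le_iff, Real.dist_eq, dist_eq_norm] at hz
  have h1 := norm_chart_le Φ (z - (chart Φ).symm q)
  rw [map_sub, (chart Φ).apply_symm_apply] at h1
  have h2 := norm_add_le (chart Φ z - q) q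
  rw [sub_add_cancel] at h2
  rw [mem_preimage, mem_ball_zero_iff]
  simp only [Prod.fst_sub, Prod.snd_sub] at h1
  linarith

lemma LevelBound.exists_graph (h : LevelBound u c Λ) {Φ : Euc (m+1) ≃ₗᵢ[ℝ] Euc (m+1)}
    {q : Euc (m+1)} {r : ℝ} (hq : ‖q‖ < 15 / 16) (hr₀ : 0 < r) (hr : r ≤ 1 / 32)
    (hΛr : 4 * Λ * r ≤ 1 / 80) (huq : u q = c)
    (hs : SlopeLE (1/4) (chartDeriv u Φ ((chart Φ).symm q))) :
    ∃ φ : Euc m → ℝ, GraphOver (fun z => u (chart Φ z) - c) (chartDeriv u Φ)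
      ((chart Φ).symm q) r φ (ball ((chart Φ).symm q).1 r) :=
  (h.curvedLevel Φ).exists_graph (by linarith [h.nonneg]) hr₀ (by linarith)
    (closedBall_subset_chart_preimage hq hr) (by simp [huq]) hs

/-- `e` is a unit normal of the level set of `u` through `q`. -/
structure IsUnitNormal (u : Euc (m+1) → ℝ) (q e : Euc (m+1)) : Prop where
  norm_eq : ‖e‖ = 1
  fderiv_eq : ∀ X, fderiv ℝ u q X = ‖gradient u q‖ * ⟪e, X⟫

lemma exists_isUnitNormal {q : Euc (m+1)} (hq : gradient u q ≠ 0) : ∃ e, IsUnitNormal u q e := by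
  have hpos := norm_pos_iff.2 hq
  refine ⟨‖gradient u q‖⁻¹ • gradient u q, ?_, fun X => ?_⟩
  · rw [norm_smul, norm_inv, norm_norm, inv_mul_cancel₀ hpos.ne']
  · rw [real_inner_smul_left, inner_gradient_left, mul_inv_cancel_left₀ hpos.ne']

lemma IsUnitNormal.slopeLE {q e : Euc (m+1)} (hn : IsUnitNormal u q e)
    {Φ : Euc (m+1) ≃ₗᵢ[ℝ] Euc (m+1)} (he : Φ e = eb (m+1) (Fin.last m)) :
    SlopeLE 0 (chartDeriv u Φ ((chart Φ).symm q)) := by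
  intro v
  rw [chartDeriv_apply, (chart Φ).apply_symm_apply, hn.fderiv_eq, inner_chart he]
  simp

end Level

section Tilt

variable {m : ℕ} {u : Euc (m+1) → ℝ} {c Λ r : ℝ}

/-- Near a point `p` the level set contains a graph over the tangent plane at `p`, described by
the height function `F` along the normal `e`. -/
lemma LevelBound.exists_height (h : LevelBound u c Λ) {p e : Euc (m+1)}
    (hp : ‖p‖ < 15 / 16) (hr₀ : 0 < r) (hr : r ≤ 1 / 32) (hΛr : 4 * Λ * r ≤ 1 / 80) (hup : u p = c)
    (hn : IsUnitNormal u p e) :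
    ∃ F : Euc (m+1) → ℝ, ContinuousOn F (ball p r) ∧
      ∀ x ∈ ball p r, |F x - ⟪e, x - p⟫| ≤ 1 / 80 * ‖x - p‖ ∧ fderiv ℝ u (x - F x • e) ≠ 0 ∧
        ∀ w, ⟪e, w⟫ = 0 →
          |fderiv ℝ u (x - F x • e) w| ≤ 1 / 80 * |fderiv ℝ u (x - F x • e) e| * ‖w‖ := by
  obtain ⟨Φ, he⟩ := exists_coordinates hn.norm_eq
  have hs := hn.slopeLE he
  have hG := h.curvedLevel Φ
  have hM : 0 ≤ 4 * Λ := by linarith [h.nonneg]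
  have hO := closedBall_subset_chart_preimage (Φ := Φ) hp hr
  obtain ⟨φ, hφ⟩ := h.exists_graph hp hr₀ hr hΛr hup (hs.mono (by norm_num))
  have hdist : ∀ x, ‖((chart Φ).symm x).1 - ((chart Φ).symm p).1‖ ≤ ‖x - p‖ := by
    intro x
    have := norm_fst_le_norm_chart Φ ((chart Φ).symm x - (chart Φ).symm p)
    rwa [map_sub, (chart Φ).apply_symm_apply, (chart Φ).apply_symm_apply] at this
  have hsnd : ∀ x, ((chart Φ).symm x).2 = ⟪e, x⟫ := by
    intro x
    rw [← inner_chart he, (chart Φ).apply_symm_apply]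
  have hmem : ∀ x ∈ ball p r, ((chart Φ).symm x).1 ∈ ball ((chart Φ).symm p).1 r := by
    intro x hx
    rw [mem_ball, dist_eq_norm] at hx ⊢
    exact (hdist x).trans_lt hx
  have hpt : ∀ x, x - (⟪e, x⟫ - φ ((chart Φ).symm x).1) • e =
      chart Φ (((chart Φ).symm x).1, φ ((chart Φ).symm x).1) := by
    intro x
    apply (chart Φ).symm.injective
    rw [(chart Φ).symm_apply_apply, map_sub, map_smul, ← chart_inr he, (chart Φ).symm_apply_apply,
      chart_inr he, ← hsnd x]
    ext1 <;> simp
  refine ⟨fun x => ⟪e, x⟫ - φ ((chart Φ).symm x).1, ?_, fun x hx => ?_⟩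
  · refine ContinuousOn.sub (by fun_prop) (hφ.continuousOn.comp ?_ hmem)
    exact (continuous_fst.comp (chart Φ).symm.continuous).continuousOn
  · have hy := hmem x hx
    have hyO := hφ.mem le_rfl hO hy
    have hne := hG.regular _ hyO (hφ.zero _ hy)
    have hL := (hφ.slopeLE _ hy).ne_zero hne
    dsimp only
    rw [hpt]
    refine ⟨?_, fun h0 => hne ?_, fun w hw => ?_⟩
    · have h1 := hφ.abs_sub_le hG hM le_rfl hO le_rfl hs hy
      rw [hsnd] at h1
      rw [inner_sub_right, abs_sub_comm]
      have h2 : ⟪e, x⟫ - ⟪e, p⟫ - (⟪e, x⟫ - φ ((chart Φ).symm x).1)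
          = φ ((chart Φ).symm x).1 - ⟪e, p⟫ := by ring
      rw [h2]
      refine h1.trans ?_
      have := hdist x
      gcongr
      linarith
    · rw [chartDeriv, h0, ContinuousLinearMap.zero_comp]
    · have h1 := slopeLE_of_norm_kerSlope_le hL
        (hφ.norm_kerSlope_le hG hM le_rfl hO le_rfl hs hy)
      have h2 := (h1.mono (show 0 + 4 * Λ * r ≤ 1 / 80 by linarith)) ((chart Φ).symm w).1
      have h3 : (((chart Φ).symm w).1, (0:ℝ)) = (chart Φ).symm w := by
        ext1
        · rfl
        · rw [hsnd, hw]
      rw [← norm_chart_inl Φ, chartDeriv_apply, chartDeriv_apply, chart_inr he, h3,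
        (chart Φ).apply_symm_apply] at h2
      exact h2

lemma inner_sub_inner_smul_eq_zero {E : Type*} [NormedAddCommGroup E] [InnerProductSpace ℝ E]
    {e v : E} (he : ‖e‖ = 1) : ⟪e, v - ⟪e, v⟫ • e⟫ = 0 ∧ ‖v - ⟪e, v⟫ • e‖ ≤ ‖v‖ := by
  have h1 : ⟪e, v - ⟪e, v⟫ • e⟫ = 0 := by
    rw [inner_sub_right, real_inner_smul_right, real_inner_self_eq_norm_sq, he]; ring
  refine ⟨h1, ?_⟩
  have h2 := norm_sub_sq_real v (⟪e, v⟫ • e)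
  rw [real_inner_smul_right, norm_smul, he, Real.norm_eq_abs, mul_one, sq_abs,
    real_inner_comm e v] at h2
  refine (sq_le_sq₀ (norm_nonneg _) (norm_nonneg _)).1 ?_
  nlinarith [sq_nonneg ⟪e, v⟫]

/-- Two unit vectors to which `ker L` is almost orthogonal are almost parallel. -/
lemma inner_le_of_slope {E : Type*} [NormedAddCommGroup E] [InnerProductSpace ℝ E]
    {L : E →L[ℝ] ℝ} {e e' v : E} (hL : L ≠ 0) (he : ‖e‖ = 1) (he' : ‖e'‖ = 1) (hv : ‖v‖ = 1)
    (hev : ⟪e, v⟫ = 0) (h : ∀ w, ⟪e, w⟫ = 0 → |L w| ≤ 1 / 80 * |L e| * ‖w‖)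
    (h' : ∀ w, ⟪e', w⟫ = 0 → |L w| ≤ 1 / 80 * |L e'| * ‖w‖) : ⟪e', v⟫ ≤ 1 / 5 := by
  have hdec : ∀ w, |L w - ⟪e', w⟫ * L e'| ≤ 1 / 80 * |L e'| * ‖w‖ := by
    intro w
    obtain ⟨h1, h2⟩ := inner_sub_inner_smul_eq_zero (v := w) he'
    have h3 := h' _ h1
    rw [map_sub, map_smul, smul_eq_mul] at h3
    exact h3.trans (by gcongr)
  have hpos : 0 < |L e'| := by
    refine abs_pos.2 fun h0 => hL ?_
    ext w
    have := hdec w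
    rw [h0] at this
    simpa using this
  have h1 := h v hev
  have h2 := hdec v
  have h3 := hdec e
  rw [he, mul_one] at h3
  rw [hv, mul_one] at h1 h2
  have h4 : |⟪e', e⟫ * L e'| ≤ |L e'| := by
    rw [abs_mul]
    have := abs_real_inner_le_norm e' e
    rw [he, he', mul_one] at this
    nlinarith
  have h5 : |L e| ≤ 81 / 80 * |L e'| := by
    have := abs_add_le (L e - ⟪e', e⟫ * L e') (⟪e', e⟫ * L e')
    rw [sub_add_cancel] at this
    linarith
  have h6 : |⟪e', v⟫| * |L e'| ≤ 1 / 5 * |L e'| := by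
    have := abs_sub_abs_le_abs_sub (⟪e', v⟫ * L e') (L v)
    rw [abs_sub_comm (⟪e', v⟫ * L e'), abs_mul] at this
    linarith
  exact (le_abs_self _).trans (le_of_mul_le_mul_right h6 hpos)

/-- Normals of the level set at nearby points, possibly on different sheets, are almost parallel,
since otherwise the sheets would cross transversally. -/
lemma LevelBound.inner_normal_le (h : LevelBound u c Λ) {p q e e' v : Euc (m+1)}
    (hp : ‖p‖ < 15 / 16) (hq : ‖q‖ < 15 / 16) (hr₀ : 0 < r) (hr : r ≤ 1 / 32)
    (hΛr : 4 * Λ * r ≤ 1 / 80) (hup : u p = c) (huq : u q = c) (hpq : ‖q - p‖ ≤ r / 200)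
    (hn : IsUnitNormal u p e) (hn' : IsUnitNormal u q e') (hv : ‖v‖ = 1) (hev : ⟪e, v⟫ = 0) :
    ⟪e', v⟫ ≤ 1 / 5 := by
  by_contra! hτ
  obtain ⟨F, hFc, hF⟩ := h.exists_height hp hr₀ hr hΛr hup hn
  obtain ⟨F', hFc', hF'⟩ := h.exists_height hq hr₀ hr hΛr huq hn'
  obtain ⟨ρ, hρr⟩ : ∃ ρ, ρ = r / 2 := ⟨_, rfl⟩
  have hnorm : ∀ t : ℝ, ‖p + t • v - p‖ = |t| := fun t => by
    rw [add_sub_cancel_left, norm_smul, hv, mul_one, Real.norm_eq_abs]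
  have hx : ∀ t ∈ Icc (-ρ) ρ, p + t • v ∈ ball p r := by
    intro t ht
    rw [mem_ball, dist_eq_norm, hnorm]
    have := abs_le.2 ht
    linarith
  have hFt : ∀ t ∈ Icc (-ρ) ρ, |F (p + t • v)| ≤ 1 / 80 * |t| := by
    intro t ht
    have := (hF _ (hx t ht)).1
    rwa [hnorm, add_sub_cancel_left, real_inner_smul_right, hev, mul_zero, sub_zero] at this
  set γ : ℝ → Euc (m+1) := fun t => p + t • v - F (p + t • v) • e
  have hγq : ∀ t, γ t - q = t • v - (q - p) - F (p + t • v) • e := fun t => by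
    simp only [γ]; module
  have hγn : ∀ t ∈ Icc (-ρ) ρ, ‖γ t - q‖ ≤ 81 / 80 * ρ + r / 200 := by
    intro t ht
    rw [hγq]
    have h1 := norm_sub_le (t • v - (q - p)) (F (p + t • v) • e)
    have h2 := norm_sub_le (t • v) (q - p)
    rw [norm_smul, hn.norm_eq, mul_one, Real.norm_eq_abs] at h1
    rw [norm_smul, hv, mul_one, Real.norm_eq_abs] at h2
    have := abs_le.2 ht
    linarith [hFt t ht]
  have hγm : ∀ t ∈ Icc (-ρ) ρ, γ t ∈ ball q r := by
    intro t ht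
    rw [mem_ball, dist_eq_norm]
    have := hγn t ht
    linarith
  have hγc : ContinuousOn γ (Icc (-ρ) ρ) := by
    have hlin : ContinuousOn (fun t : ℝ => p + t • v) (Icc (-ρ) ρ) := by fun_prop
    exact hlin.sub ((hFc.comp hlin hx).smul continuousOn_const)
  have hgc : ContinuousOn (F' ∘ γ) (Icc (-ρ) ρ) := hFc'.comp hγc hγm
  have hval : ∀ t ∈ Icc (-ρ) ρ, |F' (γ t) - t * ⟪e', v⟫| < r / 10 := by
    intro t ht
    have h1 := (hF' _ (hγm t ht)).1
    have h2 : ⟪e', γ t - q⟫ = t * ⟪e', v⟫ - ⟪e', q - p⟫ - F (p + t • v) * ⟪e', e⟫ := by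
      rw [hγq, inner_sub_right, inner_sub_right, real_inner_smul_right, real_inner_smul_right]
    have h3 := abs_real_inner_le_norm e' (q - p)
    have h4 := abs_real_inner_le_norm e' e
    rw [hn'.norm_eq, one_mul] at h3 h4
    rw [hn.norm_eq] at h4
    have h5 : |F (p + t • v) * ⟪e', e⟫| ≤ 1 / 80 * ρ := by
      rw [abs_mul]
      have := abs_le.2 ht
      have := hFt t ht
      nlinarith [abs_nonneg (F (p + t • v))]
    have h6 := hγn t ht
    have h7 : F' (γ t) - t * ⟪e', v⟫ =
        (F' (γ t) - ⟪e', γ t - q⟫) - (⟪e', q - p⟫ + F (p + t • v) * ⟪e', e⟫) := by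
      rw [h2]; ring
    rw [h7]
    have h8 := abs_sub (F' (γ t) - ⟪e', γ t - q⟫) (⟪e', q - p⟫ + F (p + t • v) * ⟪e', e⟫)
    have h9 := abs_add_le ⟪e', q - p⟫ (F (p + t • v) * ⟪e', e⟫)
    linarith
  have hρ : 0 < ρ := by linarith
  have hl : -ρ ∈ Icc (-ρ) ρ := ⟨le_rfl, by linarith⟩
  have hu : ρ ∈ Icc (-ρ) ρ := ⟨by linarith, le_rfl⟩
  have hρτ : ρ * (1 / 5) < ρ * ⟪e', v⟫ := mul_lt_mul_of_pos_left hτ hρ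
  obtain ⟨t, ht, ht0⟩ : (0:ℝ) ∈ F' ∘ γ '' Icc (-ρ) ρ := by
    refine intermediate_value_Icc (by linarith) hgc ⟨?_, ?_⟩
    · have := (abs_lt.1 (hval _ hl)).2
      simp only [Function.comp]
      linarith
    · have := (abs_lt.1 (hval _ hu)).1
      simp only [Function.comp]
      linarith
  obtain ⟨-, hL, hs⟩ := hF _ (hx t ht)
  obtain ⟨-, -, hs'⟩ := hF' _ (hγm t ht)
  have h0 : F' (γ t) = 0 := ht0
  rw [h0, zero_smul, sub_zero] at hs'
  exact absurd (inner_le_of_slope hL hn.norm_eq hn'.norm_eq hv hev hs hs') (not_le.2 hτ)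

/-- In coordinates adapted to the level set at `p`, the level set has small slope at nearby
points. -/
lemma LevelBound.slopeLE_of_near (h : LevelBound u c Λ) {p q e : Euc (m+1)}
    (hp : ‖p‖ < 15 / 16) (hq : ‖q‖ < 15 / 16) (hr₀ : 0 < r) (hr : r ≤ 1 / 32)
    (hΛr : 4 * Λ * r ≤ 1 / 80) (hup : u p = c) (huq : u q = c) (hpq : ‖q - p‖ ≤ r / 200)
    (hn : IsUnitNormal u p e) {Φ : Euc (m+1) ≃ₗᵢ[ℝ] Euc (m+1)}
    (he : Φ e = eb (m+1) (Fin.last m)) : SlopeLE (1/4) (chartDeriv u Φ ((chart Φ).symm q)) := by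
  obtain ⟨e', hn'⟩ := exists_isUnitNormal
    (h.regular q (mem_ball_zero_iff.2 (by linarith)) huq)
  have hle : ∀ w, ⟪e, w⟫ = 0 → ⟪e', w⟫ ≤ 1 / 5 * ‖w‖ := by
    intro w hw
    rcases eq_or_ne w 0 with rfl | hw0
    · simp
    have hpos := norm_pos_iff.2 hw0
    have := h.inner_normal_le hp hq hr₀ hr hΛr hup huq hpq hn hn' (v := ‖w‖⁻¹ • w)
      (by rw [norm_smul, norm_inv, norm_norm, inv_mul_cancel₀ hpos.ne'])
      (by rw [real_inner_smul_right, hw, mul_zero])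
    rwa [real_inner_smul_right, inv_mul_le_iff₀ hpos, mul_comm] at this
  have habs : ∀ w, ⟪e, w⟫ = 0 → |⟪e', w⟫| ≤ 1 / 5 * ‖w‖ := by
    intro w hw
    have := hle (-w) (by rw [inner_neg_right, hw, neg_zero])
    rw [inner_neg_right, norm_neg] at this
    exact abs_le.2 ⟨by linarith, hle w hw⟩
  have hcos : 4 / 5 ≤ |⟪e', e⟫| := by
    have h1 := habs _ (inner_sub_inner_smul_eq_zero (v := e') hn.norm_eq).1
    have h2 := norm_sub_sq_real e' (⟪e, e'⟫ • e)
    rw [inner_sub_right, real_inner_smul_right, real_inner_self_eq_norm_sq] at h1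
    rw [real_inner_smul_right, norm_smul, hn.norm_eq, Real.norm_eq_abs, mul_one, sq_abs] at h2
    rw [real_inner_comm e' e, hn'.norm_eq] at h1 h2
    set k := ‖e' - ⟪e', e⟫ • e‖
    have hk : 0 ≤ k := norm_nonneg _
    have h3 : k ^ 2 = 1 - ⟪e', e⟫ ^ 2 := by linarith
    have h4 : k ^ 2 ≤ 1 / 5 * k := by
      rw [h3]
      exact le_trans (le_trans (le_of_eq (by ring)) (le_abs_self _)) h1
    have h5 : k ≤ 1 / 5 := by nlinarith
    refine (sq_le_sq₀ (by norm_num) (abs_nonneg _)).1 ?_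
    rw [sq_abs]
    nlinarith
  intro v
  have h1 := habs (chart Φ (v, 0)) (inner_chart he _)
  rw [norm_chart_inl] at h1
  rw [chartDeriv_apply, chartDeriv_apply, (chart Φ).apply_symm_apply, chart_inr he,
    hn'.fderiv_eq, hn'.fderiv_eq, abs_mul, abs_mul]
  have h2 : |⟪e', chart Φ (v, 0)⟫| ≤ 1 / 4 * |⟪e', e⟫| * ‖v‖ := by
    nlinarith [norm_nonneg v]
  have := mul_le_mul_of_nonneg_left h2 (abs_nonneg ‖gradient u q‖)
  linarith

end Tilt

section LocalGraph

variable {m : ℕ} {u : Euc (m+1) → ℝ} {c Λ r : ℝ}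

/-- Near a point of small slope the level set coincides with the graph of a function with
`C^{1,1}` bounds. -/
lemma LevelBound.exists_local_graph (h : LevelBound u c Λ) {Φ : Euc (m+1) ≃ₗᵢ[ℝ] Euc (m+1)}
    {q : Euc (m+1)} (hq : ‖q‖ < 15 / 16) (hr₀ : 0 < r) (hr : r ≤ 1 / 32)
    (hΛr : 4 * Λ * r ≤ 1 / 80) (huq : u q = c)
    (hs : SlopeLE (1/4) (chartDeriv u Φ ((chart Φ).symm q))) :
    ∃ f : Euc m → ℝ,
      (∀ᶠ x in nhds q, u x = c → ((chart Φ).symm x).2 = f ((chart Φ).symm x).1) ∧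
      (∀ y ∈ ball ((chart Φ).symm q).1 r, u (chart Φ (y, f y)) = c) ∧
      ContDiffOn ℝ 1 f (ball ((chart Φ).symm q).1 r) ∧
      (∀ y ∈ ball ((chart Φ).symm q).1 r, |f y| ≤ 2 ∧ ‖gradient f y‖ ≤ 1) ∧
      (∀ y ∈ ball ((chart Φ).symm q).1 r, ∀ z ∈ ball ((chart Φ).symm q).1 r,
        ‖gradient f y - gradient f z‖ ≤ 4 * Λ * ‖y - z‖) := by
  have hG := h.curvedLevel Φ
  have hM : 0 ≤ 4 * Λ := by linarith [h.nonneg]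
  have hO := closedBall_subset_chart_preimage (Φ := Φ) hq hr
  obtain ⟨f, hf⟩ := h.exists_graph hq hr₀ hr hΛr huq hs
  have hd := fun y hy => (hf.hasFDerivAt hG le_rfl hO (y := y) hy).1
  have hlip : ∀ y ∈ ball ((chart Φ).symm q).1 r, ∀ z ∈ ball ((chart Φ).symm q).1 r,
      ‖fderiv ℝ f y - fderiv ℝ f z‖ ≤ 4 * Λ * ‖y - z‖ := by
    intro y hy z hz
    rw [(hd y hy).fderiv, (hd z hz).fderiv]
    exact hf.lipschitz_kerSlope hG hM le_rfl hO hy hz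
  refine ⟨f, ?_, fun y hy => sub_eq_zero.1 (hf.zero y hy), ?_, fun y hy => ⟨?_, ?_⟩, ?_⟩
  · have h1 := (hf.hasFDerivAt hG le_rfl hO (mem_ball_self hr₀)).2
    rw [hf.center] at h1
    filter_upwards [(chart Φ).symm.continuous.continuousAt.eventually h1] with x hx hux
    rw [(chart Φ).apply_symm_apply] at hx
    exact (hx.1 (sub_eq_zero.2 hux)).symm
  · rw [show (1 : WithTop ℕ∞) = 0 + 1 by norm_num, contDiffOn_succ_iff_fderiv_of_isOpen isOpen_ball]
    refine ⟨fun y hy => (hd y hy).differentiableAt.differentiableWithinAt, by simp, ?_⟩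
    rw [contDiffOn_zero]
    refine (LipschitzOnWith.of_dist_le_mul (K := ⟨4 * Λ, hM⟩) fun y hy z hz => ?_).continuousOn
    rw [dist_eq_norm, dist_eq_norm]
    exact hlip y hy z hz
  · have h1 := hf.near y hy
    have h2 := abs_snd_le_norm_chart Φ ((chart Φ).symm q)
    rw [(chart Φ).apply_symm_apply] at h2
    have h3 := abs_add_le (f y - ((chart Φ).symm q).2) ((chart Φ).symm q).2
    rw [sub_add_cancel] at h3
    linarith
  · rw [norm_gradient, (hd y hy).fderiv]
    exact (hf.norm_kerSlope_le hG hM le_rfl hO (by norm_num) hs hy).trans (by linarith)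
  · intro y hy z hz
    rw [gradient, gradient, ← map_sub, LinearIsometryEquiv.norm_map]
    exact hlip y hy z hz

end LocalGraph

/-- Lemma 2.2: locally, a level set of a stable solution is a finite union of
Lipschitz graphs with uniform `C^{1,1}` bounds, in a suitable orthonormal coordinate
system. -/
theorem stmt5 (m : ℕ) (W : ℝ → ℝ) (hW : IsDoubleWell W) (b Λ : ℝ)
    (hb : b ∈ Ioo (0:ℝ) 1) (hΛ : 0 < Λ) :
    ∃ σ ∈ Ioo (0:ℝ) (1/16), ∃ C > 0, ∃ ε₀ > 0, ∀ ε : ℝ, 0 < ε → ε ≤ ε₀ →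
      ∀ u : Euc (m+1) → ℝ,
        ACSolution W ε u (ball 0 1) → StableAC W ε u (ball 0 1) →
        CurvBound u b Λ (ball 0 1) →
        ∀ xstar ∈ ball (0:Euc (m+1)) (7/8), |u xstar| ≤ 1 - b →
          ∃ Φ : Euc (m+1) ≃ₗᵢ[ℝ] Euc (m+1), ∃ N : ℕ, ∃ f : Fin N → Euc m → ℝ,
            (∀ α : Fin N,
              ContDiffOn ℝ 1 (f α) (ball (projE m (Φ xstar)) (2*σ)) ∧
              (∀ y ∈ ball (projE m (Φ xstar)) (2*σ), |f α y| ≤ C ∧ ‖gradient (f α) y‖ ≤ C) ∧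
              (∀ y ∈ ball (projE m (Φ xstar)) (2*σ), ∀ z ∈ ball (projE m (Φ xstar)) (2*σ),
                ‖gradient (f α) y - gradient (f α) z‖ ≤ C * ‖y - z‖)) ∧
            {x | x ∈ ball xstar σ ∧ u x = u xstar} =
              {x | x ∈ ball xstar σ ∧ ∃ α : Fin N, (Φ x) (Fin.last m) = f α (projE m (Φ x))} := by
  obtain ⟨r, hr₀, hr, hΛr⟩ : ∃ r : ℝ, 0 < r ∧ r ≤ 1 / 32 ∧ 4 * Λ * r ≤ 1 / 80 := by
    refine ⟨min (1 / 32) (1 / (320 * Λ)), by positivity, min_le_left _ _, ?_⟩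
    calc 4 * Λ * min (1 / 32) (1 / (320 * Λ)) ≤ 4 * Λ * (1 / (320 * Λ)) := by
          gcongr; exact min_le_right _ _
      _ = 1 / 80 := by field_simp; norm_num
  refine ⟨r / 200, ⟨by positivity, by linarith⟩, 4 * Λ + 2, by positivity, 1, one_pos, ?_⟩
  intro ε _ _ u hac _ hcb p hp hup
  have h : LevelBound u (u p) Λ := ⟨hac.1, hΛ.le,
    fun x hx hux => (hcb x hx (by rwa [hux])).1, fun x hx hux => (hcb x hx (by rwa [hux])).2⟩
  rw [mem_ball_zero_iff] at hp
  obtain ⟨e, hn⟩ := exists_isUnitNormal (h.regular p (mem_ball_zero_iff.2 (by linarith)) rfl)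
  obtain ⟨Φ, he⟩ := exists_coordinates hn.norm_eq
  have hnear : ∀ q ∈ closedBall p (r / 200), ‖q - p‖ ≤ r / 200 ∧ ‖q‖ < 15 / 16 := by
    intro q hq
    rw [mem_closedBall, dist_eq_norm] at hq
    have := norm_add_le (q - p) p
    rw [sub_add_cancel] at this
    exact ⟨hq, by linarith⟩
  have hK : IsCompact (closedBall p (r / 200) ∩ u ⁻¹' {u p}) := by
    refine (isCompact_closedBall p (r / 200)).of_isClosed_subset ?_ inter_subset_left
    refine (h.contDiffOn.continuousOn.mono fun q hq => ?_).preimage_isClosed_of_isClosed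
      isClosed_closedBall isClosed_singleton
    exact mem_ball_zero_iff.2 (by linarith [(hnear q hq).2])
  have hloc := fun q (hq : q ∈ closedBall p (r / 200) ∩ u ⁻¹' {u p}) =>
    h.exists_local_graph (Φ := Φ) (hnear q hq.1).2 hr₀ hr hΛr hq.2
      (h.slopeLE_of_near (by linarith) (hnear q hq.1).2 hr₀ hr hΛr rfl hq.2 (hnear q hq.1).1 hn he)
  choose! f hfn hf0 hfd hfb hfl using hloc
  obtain ⟨t, htK, ht⟩ := hK.elim_nhds_subcover _ hfn
  have hsub : ∀ q ∈ t, ball (projE m (Φ p)) (2 * (r / 200)) ⊆ ball ((chart Φ).symm q).1 r := by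
    intro q hq
    refine ball_subset_ball' ?_
    have h1 := norm_fst_le_norm_chart Φ ((chart Φ).symm p - (chart Φ).symm q)
    rw [map_sub, (chart Φ).apply_symm_apply, (chart Φ).apply_symm_apply, norm_sub_rev p q] at h1
    have h2 := (hnear q (htK q hq).1).1
    rw [dist_eq_norm]
    rw [Prod.fst_sub, chart_symm_apply] at h1
    linarith
  refine ⟨Φ, t.card, fun α => f (t.equivFin.symm α), fun α => ⟨?_, fun y hy => ?_,
    fun y hy z hz => ?_⟩, ?_⟩
  · exact (hfd _ (htK _ (t.equivFin.symm α).2)).mono (hsub _ (t.equivFin.symm α).2)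
  · have := hfb _ (htK _ (t.equivFin.symm α).2) y (hsub _ (t.equivFin.symm α).2 hy)
    constructor <;> linarith
  · refine (hfl _ (htK _ (t.equivFin.symm α).2) y (hsub _ (t.equivFin.symm α).2 hy) z
      (hsub _ (t.equivFin.symm α).2 hz)).trans ?_
    gcongr
    linarith
  · ext x
    refine and_congr_right fun hx => ⟨fun hux => ?_, ?_⟩
    · obtain ⟨q, hqt, hq⟩ := mem_iUnion₂.1 (ht ⟨ball_subset_closedBall hx, hux⟩)
      refine ⟨t.equivFin ⟨q, hqt⟩, ?_⟩
      dsimp only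
      rw [Equiv.symm_apply_apply]
      exact hq hux
    · rintro ⟨α, hα⟩
      dsimp only at hα
      have hy : projE m (Φ x) ∈ ball (projE m (Φ p)) (2 * (r / 200)) := by
        have h1 := norm_fst_le_norm_chart Φ ((chart Φ).symm x - (chart Φ).symm p)
        rw [map_sub, (chart Φ).apply_symm_apply, (chart Φ).apply_symm_apply] at h1
        rw [mem_ball, dist_eq_norm] at hx ⊢
        rw [Prod.fst_sub, chart_symm_apply, chart_symm_apply] at h1
        linarith
      have h2 := hf0 _ (htK _ (t.equivFin.symm α).2) _ (hsub _ (t.equivFin.symm α).2 hy)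
      rw [← hα, ← chart_symm_apply, (chart Φ).apply_symm_apply] at h2
      exact h2
end
end

section
/- Suppose there exist constants A₁ > 0, A₋₁ > 0 and C₀ > 0 such that for all t ≥ 0: |g(t) − 1 + A₁ e^{−t}| ≤ C₀ e^{−2t} and |g′(t) − A₁ e^{−t}| ≤ C₀ e^{−2t}, and for all t ≤ 0: |g(t) + 1 − A₋₁ e^{t}| ≤ C₀ e^{2t} and |g′(t) − A₋₁ e^{t}| ≤ C₀ e^{2t}. Then there exists a constant C (depending only on W, C₀, A₁, A₋₁) such that for all T ≥ 1: | ∫_ℝ (W″(g(t)) − 1)(g(−t−T) + 1) g′(t) dt + 2 A₋₁² e^{−T} | ≤ C e^{−4T/3}, and | ∫_ℝ (W″(g(t)) − 1)(g(T−t) − 1) g′(t) dt − 2 A₁² e^{−T} | ≤ C e^{−4T/3}. -/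
open Set Metric MeasureTheory Filter
open scoped RealInnerProductSpace

noncomputable section

/-- If `f` is `C³` on `[a, b]` and the two-sided derivative `f'` is differentiable at both
endpoints, then `f'` is differentiable and `f''` is Lipschitz on the closed interval. -/
lemma differentiableAt_deriv_and_lipschitzOnWith_deriv_deriv {f : ℝ → ℝ} {a b : ℝ} (hab : a < b)
    (hf : ContDiffOn ℝ 3 f (Icc a b)) (ha : DifferentiableAt ℝ (deriv f) a)
    (hb : DifferentiableAt ℝ (deriv f) b) :
    (∀ x ∈ Icc a b, DifferentiableAt ℝ (deriv f) x) ∧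
      ∃ K, LipschitzOnWith K (deriv (deriv f)) (Icc a b) := by
  have hu := uniqueDiffOn_Icc hab
  have hd : ∀ x ∈ Icc a b, DifferentiableAt ℝ (deriv f) x := by
    intro x hx
    rcases eq_or_lt_of_le hx.1 with rfl | h1
    · exact ha
    rcases eq_or_lt_of_le hx.2 with rfl | h2
    · exact hb
    have h3 : ContDiffOn ℝ 2 (deriv f) (Ioo a b) :=
      (hf.mono Ioo_subset_Icc_self).deriv_of_isOpen isOpen_Ioo (by norm_num)
    exact (h3.differentiableOn (by norm_num)).differentiableAt (isOpen_Ioo.mem_nhds ⟨h1, h2⟩)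
  have hf1 : ContDiffOn ℝ 2 (derivWithin f (Icc a b)) (Icc a b) :=
    hf.derivWithin hu (by norm_num)
  have heq : EqOn (derivWithin f (Icc a b)) (deriv f) (Icc a b) := by
    have h0 : EqOn (derivWithin f (Icc a b)) (deriv f) (Ioo a b) := fun x hx =>
      derivWithin_of_mem_nhds (Icc_mem_nhds hx.1 hx.2)
    refine h0.of_subset_closure hf1.continuousOn
      (fun x hx => (hd x hx).continuousAt.continuousWithinAt) Ioo_subset_Icc_self ?_
    rw [closure_Ioo hab.ne]
  have hf2 : ContDiffOn ℝ 1 (derivWithin (deriv f) (Icc a b)) (Icc a b) :=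
    (hf1.congr fun x hx => (heq hx).symm).derivWithin hu (by norm_num)
  have hf3 : ContDiffOn ℝ 1 (deriv (deriv f)) (Icc a b) :=
    hf2.congr fun x hx => ((hd x hx).derivWithin (hu x hx)).symm
  exact ⟨hd, hf3.exists_lipschitzOnWith (by norm_num) (convex_Icc a b) isCompact_Icc⟩

/-- Exponential weights with different rates on the two half-lines are integrable. -/
lemma integrable_exp_mul_sub_mul_abs {a b : ℝ} (h : |a| < b) :
    Integrable fun t : ℝ => Real.exp (a * t - b * |t|) := by
  have h1 := (abs_lt.1 h).1
  have h2 := (abs_lt.1 h).2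
  rw [← integrableOn_univ, ← Iic_union_Ioi (a := (0 : ℝ))]
  refine IntegrableOn.union ?_ ?_
  · refine (integrableOn_exp_mul_Iic (a := a + b) (by linarith) 0).congr_fun (fun t ht => ?_)
      measurableSet_Iic
    simp only [abs_of_nonpos (mem_Iic.1 ht)]
    ring_nf
  · refine (integrableOn_exp_mul_Ioi (a := a - b) (by linarith) 0).congr_fun (fun t ht => ?_)
      measurableSet_Ioi
    simp only [abs_of_pos (mem_Ioi.1 ht)]
    ring_nf

/-- If `φ'' = (1 + q) φ` on `ℝ`, then `∫ q φ e^{-t}` is the difference of the limits of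
`(φ' + φ) e^{-t}` at `±∞`. -/
lemma integral_mul_exp_neg_of_hasDerivAt {φ ψ q : ℝ → ℝ} {m n : ℝ}
    (hφ : ∀ t, HasDerivAt φ (ψ t) t) (hψ : ∀ t, HasDerivAt ψ ((1 + q t) * φ t) t)
    (hint : Integrable fun t => q t * φ t * Real.exp (-t))
    (hbot : Tendsto (fun t => (ψ t + φ t) * Real.exp (-t)) atBot (nhds m))
    (htop : Tendsto (fun t => (ψ t + φ t) * Real.exp (-t)) atTop (nhds n)) :
    ∫ t, q t * φ t * Real.exp (-t) = n - m := by
  refine integral_of_hasDerivAt_of_tendsto (fun t => ?_) hint hbot htop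
  have he : HasDerivAt (fun t : ℝ => Real.exp (-t)) (-Real.exp (-t)) t := by
    simpa using (hasDerivAt_neg t).exp
  refine (((hψ t).add (hφ t)).mul he).congr_deriv ?_
  simp only [Pi.add_apply]
  ring

/-- If `q` and `φ` decay like `e^{-|t|}` and `p(s) = B e^s + O(e^{2s})` as `s → -∞` with `p`
bounded, then `∫ q(t) p(-t-T) φ(t) dt = B e^{-T} ∫ q φ e^{-t} + O(e^{-4T/3})`. -/
lemma exists_abs_integral_translate_sub_le {q φ p : ℝ → ℝ} {K B : ℝ} (hq : Continuous q)
    (hφ : Continuous φ) (hp : Continuous p) (hqK : ∀ t, |q t| ≤ K * Real.exp (-|t|))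
    (hφK : ∀ t, |φ t| ≤ K * Real.exp (-|t|)) (hpK : ∀ s, |p s| ≤ K)
    (hpB : ∀ s ≤ 0, |p s - B * Real.exp s| ≤ K * Real.exp (2 * s)) :
    Integrable (fun t => q t * φ t * Real.exp (-t)) ∧
    ∃ C > 0, ∀ T : ℝ,
      |(∫ t, q t * p (-t - T) * φ t) -
        B * Real.exp (-T) * ∫ t, q t * φ t * Real.exp (-t)| ≤ C * Real.exp (-(4 / 3) * T) := by
  have hK : 0 ≤ K := (abs_nonneg _).trans (hpK 0)
  have hqφ : ∀ t, |q t * φ t| ≤ K ^ 2 * Real.exp (-(2 * |t|)) := by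
    intro t
    calc |q t * φ t| = |q t| * |φ t| := abs_mul _ _
      _ ≤ (K * Real.exp (-|t|)) * (K * Real.exp (-|t|)) :=
        mul_le_mul (hqK t) (hφK t) (abs_nonneg _) (by positivity)
      _ = K ^ 2 * (Real.exp (-|t|) * Real.exp (-|t|)) := by ring
      _ = K ^ 2 * Real.exp (-(2 * |t|)) := by rw [← Real.exp_add]; ring_nf
  have hpM : ∀ s, |p s - B * Real.exp s| ≤ (K + |B|) * Real.exp (4 / 3 * s) := by
    intro s
    rcases le_total s 0 with hs | hs
    · calc |p s - B * Real.exp s| ≤ K * Real.exp (2 * s) := hpB s hs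
        _ ≤ (K + |B|) * Real.exp (4 / 3 * s) := by
          have hs' : Real.exp (2 * s) ≤ Real.exp (4 / 3 * s) := Real.exp_le_exp.2 (by linarith)
          exact mul_le_mul (le_add_of_nonneg_right (abs_nonneg B)) hs' (Real.exp_pos _).le
            (by positivity)
    · have h1 : (1 : ℝ) ≤ Real.exp (4 / 3 * s) := Real.one_le_exp (by linarith)
      have h2 : Real.exp s ≤ Real.exp (4 / 3 * s) := Real.exp_le_exp.2 (by linarith)
      calc |p s - B * Real.exp s| ≤ |p s| + |B * Real.exp s| := abs_sub _ _
        _ = |p s| + |B| * Real.exp s := by rw [abs_mul, abs_of_pos (Real.exp_pos s)]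
        _ ≤ K * Real.exp (4 / 3 * s) + |B| * Real.exp (4 / 3 * s) := by
          gcongr
          exact (hpK s).trans (le_mul_of_one_le_right hK h1)
        _ = _ := by ring
  have hint : Integrable (fun t => q t * φ t * Real.exp (-t)) := by
    refine ((integrable_exp_mul_sub_mul_abs (a := -1) (b := 2) (by norm_num)).const_mul
      (K ^ 2)).mono' (by fun_prop) (Eventually.of_forall fun t => ?_)
    calc ‖q t * φ t * Real.exp (-t)‖ = |q t * φ t| * Real.exp (-t) := by
          rw [Real.norm_eq_abs, abs_mul, abs_of_pos (Real.exp_pos _)]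
      _ ≤ K ^ 2 * Real.exp (-(2 * |t|)) * Real.exp (-t) := by gcongr; exact hqφ t
      _ = K ^ 2 * Real.exp (-1 * t - 2 * |t|) := by
          rw [mul_assoc, ← Real.exp_add]; ring_nf
  have hI : Integrable fun t : ℝ => Real.exp (-(4 / 3) * t - 2 * |t|) :=
    integrable_exp_mul_sub_mul_abs (by norm_num [abs_of_pos])
  have hI0 : 0 ≤ ∫ t : ℝ, Real.exp (-(4 / 3) * t - 2 * |t|) :=
    integral_nonneg fun t => (Real.exp_pos _).le
  refine ⟨hint, K ^ 2 * (K + |B|) * (∫ t : ℝ, Real.exp (-(4 / 3) * t - 2 * |t|)) + 1,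
    by positivity, fun T => ?_⟩
  set R : ℝ → ℝ := fun t => q t * φ t * (p (-t - T) - B * Real.exp (-t - T)) with hR
  have hRb : ∀ t, ‖R t‖ ≤ K ^ 2 * (K + |B|) * Real.exp (-(4 / 3) * T) *
      Real.exp (-(4 / 3) * t - 2 * |t|) := by
    intro t
    calc ‖R t‖ = |q t * φ t| * |p (-t - T) - B * Real.exp (-t - T)| := by
          rw [Real.norm_eq_abs, hR, abs_mul]
      _ ≤ (K ^ 2 * Real.exp (-(2 * |t|))) * ((K + |B|) * Real.exp (4 / 3 * (-t - T))) :=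
          mul_le_mul (hqφ t) (hpM _) (abs_nonneg _) (by positivity)
      _ = K ^ 2 * (K + |B|) * (Real.exp (-(2 * |t|)) * Real.exp (4 / 3 * (-t - T))) := by ring
      _ = K ^ 2 * (K + |B|) * (Real.exp (-(4 / 3) * T) *
          Real.exp (-(4 / 3) * t - 2 * |t|)) := by
          rw [← Real.exp_add, ← Real.exp_add]; ring_nf
      _ = _ := by ring
  have hRi : Integrable R := (hI.const_mul _).mono' (by fun_prop) (Eventually.of_forall hRb)
  have hsplit : (∫ t, q t * p (-t - T) * φ t) =
      (∫ t, R t) + B * Real.exp (-T) * ∫ t, q t * φ t * Real.exp (-t) := by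
    rw [← integral_const_mul, ← integral_add hRi (hint.const_mul _)]
    refine integral_congr_ae (Eventually.of_forall fun t => ?_)
    have : Real.exp (-t - T) = Real.exp (-T) * Real.exp (-t) := by
      rw [← Real.exp_add]; ring_nf
    simp only [hR, this]
    ring
  rw [hsplit, add_sub_cancel_right]
  calc |∫ t, R t| ≤ ∫ t, K ^ 2 * (K + |B|) * Real.exp (-(4 / 3) * T) *
        Real.exp (-(4 / 3) * t - 2 * |t|) :=
        norm_integral_le_of_norm_le (hI.const_mul _) (Eventually.of_forall hRb)
    _ = K ^ 2 * (K + |B|) * (∫ t : ℝ, Real.exp (-(4 / 3) * t - 2 * |t|)) *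
        Real.exp (-(4 / 3) * T) := by rw [integral_const_mul]; ring
    _ ≤ _ := by gcongr; linarith

/-- A function within `C e^{2t}` of `A e^{t}` on the negative half-line is asymptotic to it. -/
lemma tendsto_mul_exp_neg_atBot {f : ℝ → ℝ} {A C : ℝ}
    (h : ∀ t ≤ 0, |f t - A * Real.exp t| ≤ C * Real.exp (2 * t)) :
    Tendsto (fun t => f t * Real.exp (-t)) atBot (nhds A) := by
  have h0 : Tendsto (fun t => C * Real.exp t) atBot (nhds 0) := by
    simpa using Real.tendsto_exp_atBot.const_mul C
  refine tendsto_iff_norm_sub_tendsto_zero.2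
    (squeeze_zero' (Eventually.of_forall fun t => norm_nonneg _) ?_ h0)
  filter_upwards [eventually_le_atBot 0] with t ht
  have e1 : Real.exp t * Real.exp (-t) = 1 := by rw [← Real.exp_add]; simp
  have e2 : Real.exp (2 * t) * Real.exp (-t) = Real.exp t := by rw [← Real.exp_add]; ring_nf
  calc ‖f t * Real.exp (-t) - A‖ = |(f t - A * Real.exp t) * Real.exp (-t)| := by
        rw [Real.norm_eq_abs, sub_mul, mul_assoc, e1, mul_one]
    _ = |f t - A * Real.exp t| * Real.exp (-t) := by rw [abs_mul, abs_of_pos (Real.exp_pos _)]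
    _ ≤ C * Real.exp (2 * t) * Real.exp (-t) := by gcongr; exact h t ht
    _ = C * Real.exp t := by rw [mul_assoc, e2]

/-- A function within `C e^{2t}` of `A e^{t}` on the negative half-line is `O(e^{t})` there. -/
lemma abs_le_mul_exp_of_abs_sub_le {x A C t : ℝ} (hA : 0 ≤ A) (hC : 0 ≤ C) (ht : t ≤ 0)
    (h : |x - A * Real.exp t| ≤ C * Real.exp (2 * t)) : |x| ≤ (A + C) * Real.exp t := by
  have h1 : Real.exp (2 * t) ≤ Real.exp t := Real.exp_le_exp.2 (by linarith)
  have h2 : |x| ≤ |x - A * Real.exp t| + |A * Real.exp t| := by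
    simpa using abs_add_le (x - A * Real.exp t) (A * Real.exp t)
  rw [abs_of_nonneg (by positivity : 0 ≤ A * Real.exp t)] at h2
  nlinarith

/-- Interaction integral of a heteroclinic profile of `g'' = w(g)` with its reflected translate. -/
lemma exists_abs_interaction_integral_le {w g : ℝ → ℝ} {L : NNReal} {A B C₀ : ℝ}
    (hw : ∀ x ∈ Icc (-1 : ℝ) 1, DifferentiableAt ℝ w x)
    (hL : LipschitzOnWith L (deriv w) (Icc (-1) 1))
    (hw0 : w (-1) = 0) (hw1 : w 1 = 0) (hdw0 : deriv w (-1) = 1) (hdw1 : deriv w 1 = 1)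
    (hg : ContDiff ℝ 2 g) (hode : ∀ t, deriv (deriv g) t = w (g t))
    (hgr : ∀ t, g t ∈ Ioo (-1 : ℝ) 1)
    (htop : Tendsto g atTop (nhds 1)) (hbot : Tendsto g atBot (nhds (-1)))
    (hA : 0 < A) (hB : 0 < B) (hC₀ : 0 < C₀)
    (h1 : ∀ t : ℝ, 0 ≤ t → |g t - 1 + A * Real.exp (-t)| ≤ C₀ * Real.exp (-2 * t))
    (h2 : ∀ t : ℝ, 0 ≤ t → |deriv g t - A * Real.exp (-t)| ≤ C₀ * Real.exp (-2 * t))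
    (h3 : ∀ t : ℝ, t ≤ 0 → |g t + 1 - B * Real.exp t| ≤ C₀ * Real.exp (2 * t))
    (h4 : ∀ t : ℝ, t ≤ 0 → |deriv g t - B * Real.exp t| ≤ C₀ * Real.exp (2 * t)) :
    ∃ C > 0, ∀ T : ℝ,
      |(∫ t : ℝ, (deriv w (g t) - 1) * (g (-t - T) + 1) * deriv g t) +
        2 * B ^ 2 * Real.exp (-T)| ≤ C * Real.exp (-(4 / 3) * T) := by
  have hgI : ∀ t, g t ∈ Icc (-1 : ℝ) 1 := fun t => Ioo_subset_Icc_self (hgr t)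
  have hgc : Continuous g := hg.continuous
  have hdg : ContDiff ℝ 1 (deriv g) :=
    ((contDiff_succ_iff_deriv (n := 1)).1 (by simpa [one_add_one_eq_two] using hg)).2.2
  have hφ : ∀ t, HasDerivAt (deriv g) (w (g t)) t := fun t => by
    rw [← hode t]; exact (hdg.differentiable (by norm_num) t).hasDerivAt
  have hψ : ∀ t, HasDerivAt (fun t => w (g t)) ((1 + (deriv w (g t) - 1)) * deriv g t) t :=
    fun t => by
      rw [add_sub_cancel]
      exact (hw _ (hgI t)).hasDerivAt.comp t (hg.differentiable (by norm_num) t).hasDerivAt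
  have hL' : ∀ x ∈ Icc (-1 : ℝ) 1, ∀ y ∈ Icc (-1 : ℝ) 1,
      |deriv w x - deriv w y| ≤ L * |x - y| := fun x hx y hy => by
    simpa [Real.dist_eq] using hL.dist_le_mul x hx y hy
  have hqc : Continuous fun t => deriv w (g t) - 1 :=
    (hL.continuousOn.comp_continuous hgc hgI).sub continuous_const
  have hgp : ∀ t, 0 ≤ t → |g t - 1| ≤ (A + C₀) * Real.exp (-t) := fun t ht => by
    rw [abs_sub_comm]
    refine abs_le_mul_exp_of_abs_sub_le hA.le hC₀.le (by linarith) ?_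
    rw [abs_sub_comm]
    convert h1 t ht using 2 <;> ring_nf
  have hgm : ∀ t, t ≤ 0 → |g t + 1| ≤ (B + C₀) * Real.exp t := fun t ht =>
    abs_le_mul_exp_of_abs_sub_le hB.le hC₀.le ht (h3 t ht)
  have hφp : ∀ t, 0 ≤ t → |deriv g t| ≤ (A + C₀) * Real.exp (-t) := fun t ht => by
    refine abs_le_mul_exp_of_abs_sub_le hA.le hC₀.le (by linarith) ?_
    convert h2 t ht using 3
    ring
  have hφm : ∀ t, t ≤ 0 → |deriv g t| ≤ (B + C₀) * Real.exp t := fun t ht =>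
    abs_le_mul_exp_of_abs_sub_le hB.le hC₀.le ht (h4 t ht)
  obtain ⟨K, hK⟩ : ∃ K : ℝ, K = (1 + L) * (A + B + C₀) + 2 := ⟨_, rfl⟩
  have hL0 : (0 : ℝ) ≤ L := L.2
  have hKA : A + C₀ ≤ K := by rw [hK]; nlinarith
  have hKB : B + C₀ ≤ K := by rw [hK]; nlinarith
  have hKLA : L * (A + C₀) ≤ K := by rw [hK]; nlinarith
  have hKLB : L * (B + C₀) ≤ K := by rw [hK]; nlinarith
  have hφK : ∀ t, |deriv g t| ≤ K * Real.exp (-|t|) := fun t => by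
    rcases le_total t 0 with ht | ht
    · rw [abs_of_nonpos ht, neg_neg]
      exact (hφm t ht).trans (by gcongr)
    · rw [abs_of_nonneg ht]
      exact (hφp t ht).trans (by gcongr)
  have hqK : ∀ t, |deriv w (g t) - 1| ≤ K * Real.exp (-|t|) := fun t => by
    rcases le_total t 0 with ht | ht
    · rw [abs_of_nonpos ht, neg_neg]
      calc |deriv w (g t) - 1| ≤ L * |g t - -1| := by
            simpa [hdw0] using hL' _ (hgI t) (-1) (by norm_num)
        _ ≤ L * ((B + C₀) * Real.exp t) := by
            rw [sub_neg_eq_add]; gcongr; exact hgm t ht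
        _ = L * (B + C₀) * Real.exp t := by ring
        _ ≤ K * Real.exp t := by gcongr
    · rw [abs_of_nonneg ht]
      calc |deriv w (g t) - 1| ≤ L * |g t - 1| := by
            simpa [hdw1] using hL' _ (hgI t) 1 (by norm_num)
        _ ≤ L * ((A + C₀) * Real.exp (-t)) := by gcongr; exact hgp t ht
        _ = L * (A + C₀) * Real.exp (-t) := by ring
        _ ≤ K * Real.exp (-t) := by gcongr
  have hpK : ∀ s, |g s + 1| ≤ K := fun s => by
    have := hgr s
    have h2K : 2 ≤ K := by rw [hK]; nlinarith
    rw [abs_le]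
    constructor <;> linarith [this.1, this.2]
  have hpB : ∀ s ≤ 0, |g s + 1 - B * Real.exp s| ≤ K * Real.exp (2 * s) := fun s hs =>
    (h3 s hs).trans (by gcongr; linarith)
  obtain ⟨hint, C, hC, hCT⟩ := exists_abs_integral_translate_sub_le (B := B)
    (p := fun s => g s + 1) hqc hdg.continuous (by fun_prop) hqK hφK hpK hpB
  have hlimbot : Tendsto (fun t => (w (g t) + deriv g t) * Real.exp (-t)) atBot
      (nhds (2 * B)) := by
    have hslope := hasDerivAt_iff_tendsto_slope.1 (hw (-1) (by norm_num)).hasDerivAt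
    have hgne : Tendsto g atBot (nhdsWithin (-1) {-1}ᶜ) :=
      tendsto_nhdsWithin_iff.2 ⟨hbot, Eventually.of_forall fun t => (hgr t).1.ne'⟩
    have hlim := ((hslope.comp hgne).mul (tendsto_mul_exp_neg_atBot h3)).add
      (tendsto_mul_exp_neg_atBot h4)
    rw [hdw0, one_mul, ← two_mul] at hlim
    refine hlim.congr fun t => ?_
    have hne : g t + 1 ≠ 0 := by linarith [(hgr t).1]
    simp only [Function.comp, slope_def_field, hw0, sub_neg_eq_add, sub_zero]
    field_simp
  have hlimtop : Tendsto (fun t => (w (g t) + deriv g t) * Real.exp (-t)) atTop (nhds 0) := by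
    have he : Tendsto (fun t : ℝ => Real.exp (-t)) atTop (nhds 0) :=
      Real.tendsto_exp_neg_atTop_nhds_zero
    have hw' : Tendsto (fun t => w (g t)) atTop (nhds 0) := by
      simpa [Function.comp_def, hw1] using (hw 1 (by norm_num)).continuousAt.tendsto.comp htop
    have hg' : Tendsto (deriv g) atTop (nhds 0) := by
      refine squeeze_zero_norm' (a := fun t => (A + C₀) * Real.exp (-t)) ?_
        (by simpa using he.const_mul (A + C₀))
      filter_upwards [eventually_ge_atTop 0] with t ht using hφp t ht
    simpa using (hw'.add hg').mul he
  have hval := integral_mul_exp_neg_of_hasDerivAt hφ hψ hint hlimbot hlimtop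
  refine ⟨C, hC, fun T => ?_⟩
  have := hCT T
  rw [hval] at this
  convert this using 2
  ring

/-- Lemma A.1: interaction integrals between two one-dimensional profiles. -/
theorem stmt12 (W : ℝ → ℝ) (hW : IsDoubleWell W)
    (g : ℝ → ℝ) (hg : ContDiff ℝ 2 g) (hode : ∀ t, deriv (deriv g) t = deriv W (g t))
    (hg0 : g 0 = 0) (hgr : ∀ t, g t ∈ Ioo (-1:ℝ) 1) (hg' : ∀ t, 0 < deriv g t)
    (htop : Tendsto g atTop (nhds 1)) (hbot : Tendsto g atBot (nhds (-1)))
    (A₁ Am₁ C₀ : ℝ) (hA₁ : 0 < A₁) (hAm₁ : 0 < Am₁) (hC₀ : 0 < C₀)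
    (h1 : ∀ t : ℝ, 0 ≤ t → |g t - 1 + A₁ * Real.exp (-t)| ≤ C₀ * Real.exp (-2*t))
    (h2 : ∀ t : ℝ, 0 ≤ t → |deriv g t - A₁ * Real.exp (-t)| ≤ C₀ * Real.exp (-2*t))
    (h3 : ∀ t : ℝ, t ≤ 0 → |g t + 1 - Am₁ * Real.exp t| ≤ C₀ * Real.exp (2*t))
    (h4 : ∀ t : ℝ, t ≤ 0 → |deriv g t - Am₁ * Real.exp t| ≤ C₀ * Real.exp (2*t)) :
    ∃ C > 0, ∀ T : ℝ, 1 ≤ T →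
      |(∫ t : ℝ, (iteratedDeriv 2 W (g t) - 1) * (g (-t - T) + 1) * deriv g t) +
          2 * Am₁ ^ 2 * Real.exp (-T)| ≤ C * Real.exp (-(4/3) * T) ∧
      |(∫ t : ℝ, (iteratedDeriv 2 W (g t) - 1) * (g (T - t) - 1) * deriv g t) -
          2 * A₁ ^ 2 * Real.exp (-T)| ≤ C * Real.exp (-(4/3) * T) := by
  
  obtain ⟨hW3, -, -, -, hWm, hWp, hWm2, hWp2, -, -⟩ := hW
  simp only [iteratedDeriv_succ, iteratedDeriv_zero] at hWm2 hWp2 ⊢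
  obtain ⟨hd, L, hL⟩ := differentiableAt_deriv_and_lipschitzOnWith_deriv_deriv (by norm_num) hW3
    (differentiableAt_of_deriv_ne_zero (by rw [hWm2]; exact one_ne_zero))
    (differentiableAt_of_deriv_ne_zero (by rw [hWp2]; exact one_ne_zero))
  obtain ⟨C, hC, hCT⟩ := exists_abs_interaction_integral_le hd hL hWm hWp hWm2 hWp2 hg hode hgr
    htop hbot hA₁ hAm₁ hC₀ h1 h2 h3 h4
  have hneg : ∀ x ∈ Icc (-1 : ℝ) 1, -x ∈ Icc (-1 : ℝ) 1 := fun x hx =>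
    ⟨by linarith [hx.2], by linarith [hx.1]⟩
  have hdg : deriv (fun t => -g (-t)) = fun t => deriv g (-t) := by
    funext t
    rw [deriv.fun_neg, deriv_comp_neg, neg_neg]
  have hdw : deriv (fun x => -deriv W (-x)) = fun x => deriv (deriv W) (-x) := by
    funext x
    rw [deriv.fun_neg, deriv_comp_neg (deriv W), neg_neg]
  obtain ⟨D, hD, hDT⟩ := exists_abs_interaction_integral_le (w := fun x => -deriv W (-x))
    (g := fun t => -g (-t)) (L := L) (A := Am₁) (B := A₁) (C₀ := C₀)
    (fun x hx => ((hd _ (hneg x hx)).comp x differentiableAt_id.neg).neg)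
    (by
      rw [hdw]
      refine LipschitzOnWith.of_dist_le_mul fun x hx y hy => ?_
      simpa only [dist_neg_neg] using hL.dist_le_mul _ (hneg x hx) _ (hneg y hy))
    (by simp [hWp]) (by simp [hWm]) (by simp [hdw, hWp2]) (by simp [hdw, hWm2])
    (hg.comp contDiff_neg).neg
    (fun t => by rw [hdg, deriv_comp_neg (deriv g), hode, neg_neg])
    (fun t => ⟨by linarith [(hgr (-t)).2], by linarith [(hgr (-t)).1]⟩)
    (by simpa using (hbot.comp tendsto_neg_atTop_atBot).neg)
    (htop.comp tendsto_neg_atBot_atTop).neg hAm₁ hA₁ hC₀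
    (fun t ht => by
      have := h3 (-t) (by linarith)
      rw [← abs_neg]
      convert this using 2 <;> ring_nf)
    (fun t ht => by
      rw [hdg]
      convert h4 (-t) (by linarith) using 3
      ring)
    (fun t ht => by
      have := h1 (-t) (by linarith)
      rw [← abs_neg]
      convert this using 2 <;> ring_nf)
    (fun t ht => by
      rw [hdg]
      convert h2 (-t) (by linarith) using 3 <;> ring_nf)
  refine ⟨C + D, by positivity, fun T _ => ⟨(hCT T).trans (by gcongr; linarith), ?_⟩⟩
  refine le_trans (le_of_eq ?_) ((hDT T).trans (by gcongr; linarith))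
  have hint : (∫ t : ℝ, (deriv (fun x => -deriv W (-x)) (-g (-t)) - 1) *
      (-g (-(-t - T)) + 1) * deriv (fun t => -g (-t)) t) =
      -∫ t : ℝ, (deriv (deriv W) (g t) - 1) * (g (T - t) - 1) * deriv g t := by
    rw [hdw, hdg, ← integral_neg, ← integral_neg_eq_self]
    refine integral_congr_ae (Eventually.of_forall fun t => ?_)
    simp only [neg_neg, neg_sub]
    ring_nf
  rw [hint, ← abs_neg, neg_sub, sub_eq_neg_add, add_comm]
end
end

section
/- There exists a constant μ > 0 (depending only on W) such that for every compactly supported C¹ function φ : ℝ → ℝ satisfying the orthogonality condition ∫_ℝ φ(t) g′(t) dt = 0, one has ∫_ℝ ( φ′(t)² + W″(g(t)) φ(t)² ) dt ≥ μ ∫_ℝ φ(t)² dt. -/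
open Set Metric MeasureTheory Filter
open scoped RealInnerProductSpace

noncomputable section

/-- Weighted Hardy inequality on a finite interval `[0, T]`, for a weight `w ^ 2` with `w`
nonincreasing and decaying at least exponentially away from the origin. -/
theorem hardy_interval {w w' χ χ' : ℝ → ℝ} {m : ℝ} (hm : 0 < m)
    (hw : ∀ t, HasDerivAt w (w' t) t) (hw'c : Continuous w')
    (hχ : ∀ t, HasDerivAt χ (χ' t) t) (hχ'c : Continuous χ')
    (hpos : ∀ t, 0 < w t) (hw' : ∀ t, 0 ≤ t → w' t ≤ 0)
    (hdec : ∀ t, 0 ≤ t → m * w t ≤ Real.exp (-t) * w t - 2 * w' t)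
    (h0 : χ 0 = 0) {T : ℝ} (hT : 0 ≤ T) :
    m ^ 2 / 16 * ∫ t in (0:ℝ)..T, (w t * χ t) ^ 2 ≤ ∫ t in (0:ℝ)..T, (w t * χ' t) ^ 2 := by
  have hwc : Continuous w := continuous_iff_continuousAt.2 fun t => (hw t).continuousAt
  have hχc : Continuous χ := continuous_iff_continuousAt.2 fun t => (hχ t).continuousAt
  set F : ℝ → ℝ := fun t => m / 8 * (1 + Real.exp (-t)) with hF
  have hFd : ∀ t, HasDerivAt F (m / 8 * (-Real.exp (-t))) t := fun t => by
    have h := (((hasDerivAt_neg t).exp).const_add 1).const_mul (m / 8)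
    refine h.congr_deriv ?_
    ring
  have hFc : Continuous F := continuous_iff_continuousAt.2 fun t => (hFd t).continuousAt
  set f' : ℝ → ℝ := fun t => m / 8 * (-Real.exp (-t)) * (w t * χ t) ^ 2 +
    F t * (2 * (w t * χ t) * (w' t * χ t + w t * χ' t)) with hf'
  have hfd : ∀ t, HasDerivAt (fun t => F t * (w t * χ t) ^ 2) (f' t) t := fun t => by
    have h := (hFd t).mul (((hw t).mul (hχ t)).pow 2)
    refine h.congr_deriv ?_
    simp [hf']
  have hf'c : Continuous f' := by simp only [hf']; fun_prop
  have hftc := intervalIntegral.integral_eq_sub_of_hasDerivAt (a := 0) (b := T)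
    (fun t _ => hfd t) (hf'c.intervalIntegrable _ _)
  have hle : ∫ t in (0:ℝ)..T, f' t ≤
      ∫ t in (0:ℝ)..T, ((w t * χ' t) ^ 2 - m ^ 2 / 16 * (w t * χ t) ^ 2) := by
    refine intervalIntegral.integral_mono_on hT (hf'c.intervalIntegrable _ _)
      (Continuous.intervalIntegrable (by fun_prop) _ _) fun t ht => ?_
    have hw't := hw' t ht.1
    have hE0 : 0 < Real.exp (-t) := Real.exp_pos _
    have hE1 : Real.exp (-t) ≤ 1 := Real.exp_le_one_iff.2 (by linarith [ht.1])
    have hd := hdec t ht.1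
    have hwt := hpos t
    simp only [hf', hF]
    generalize Real.exp (-t) = e at *
    have hF2 : (m / 8 * (1 + e)) ^ 2 ≤ m ^ 2 / 16 := by
      have : m / 8 * (1 + e) ≤ m / 4 := by nlinarith
      nlinarith [mul_nonneg hm.le hE0.le]
    have h1 : 0 ≤ (w t * χ' t - m / 8 * (1 + e) * (w t * χ t)) ^ 2 := sq_nonneg _
    have h2 : m / 8 * (-e) * w t + 2 * (m / 8 * (1 + e)) * w' t + m ^ 2 / 8 * w t ≤ 0 := by
      have : m * (e * w' t) ≤ 0 :=
        mul_nonpos_of_nonneg_of_nonpos hm.le (mul_nonpos_of_nonneg_of_nonpos hE0.le hw't)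
      nlinarith [mul_le_mul_of_nonneg_left hd hm.le]
    have h3 := mul_nonpos_of_nonneg_of_nonpos (mul_nonneg hwt.le (sq_nonneg (χ t))) h2
    have h4 := mul_le_mul_of_nonneg_right hF2 (sq_nonneg (w t * χ t))
    nlinarith
  have hfT : 0 ≤ F T * (w T * χ T) ^ 2 := by simp only [hF]; positivity
  rw [hftc, intervalIntegral.integral_sub (Continuous.intervalIntegrable (by fun_prop) _ _)
    (Continuous.intervalIntegrable (by fun_prop) _ _), intervalIntegral.integral_const_mul] at hle
  simp only [h0, mul_zero, zero_pow two_ne_zero, sub_zero] at hle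
  linarith

/-- Weighted Hardy inequality on the half-line `(0, ∞)`. -/
theorem hardy_Ioi {w w' χ χ' : ℝ → ℝ} {m : ℝ} (hm : 0 < m)
    (hw : ∀ t, HasDerivAt w (w' t) t) (hw'c : Continuous w')
    (hχ : ∀ t, HasDerivAt χ (χ' t) t) (hχ'c : Continuous χ')
    (hpos : ∀ t, 0 < w t) (hw' : ∀ t, 0 ≤ t → w' t ≤ 0)
    (hdec : ∀ t, 0 ≤ t → m * w t ≤ Real.exp (-t) * w t - 2 * w' t)
    (h0 : χ 0 = 0) (hi : IntegrableOn (fun t => (w t * χ t) ^ 2) (Ioi 0))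
    (hi' : IntegrableOn (fun t => (w t * χ' t) ^ 2) (Ioi 0)) :
    m ^ 2 / 16 * ∫ t in Ioi (0:ℝ), (w t * χ t) ^ 2 ≤ ∫ t in Ioi (0:ℝ), (w t * χ' t) ^ 2 := by
  refine le_of_tendsto_of_tendsto
    ((intervalIntegral_tendsto_integral_Ioi 0 hi tendsto_id).const_mul _)
    (intervalIntegral_tendsto_integral_Ioi 0 hi' tendsto_id) ?_
  filter_upwards [eventually_ge_atTop 0] with T hT
  exact hardy_interval hm hw hw'c hχ hχ'c hpos hw' hdec h0 hT

/-- Decay of the derivative `w` of a heteroclinic solution of `g'' = V g` on the half-line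
where `g` tends to a nondegenerate zero of `V`. -/
theorem heteroclinic_decay {g w V : ℝ → ℝ} (hg : ∀ t, HasDerivAt g (w t) t)
    (hw : ∀ t, HasDerivAt w (V (g t)) t) (hpos : ∀ t, 0 < w t) (hg0 : g 0 = 0)
    (hg1 : ∀ t, g t < 1) (htop : Tendsto g atTop (nhds 1))
    (hV : ∀ s ∈ Ico (0:ℝ) 1, V s ≤ 0) (hV1 : V 1 = 0) (hV' : HasDerivAt V 1 1) :
    (∀ t, 0 ≤ t → V (g t) ≤ 0) ∧ IntegrableOn (fun t => w t ^ 2) (Ioi 0) ∧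
      ∃ m > 0, ∀ t, 0 ≤ t → m * w t ≤ Real.exp (-t) * w t - 2 * V (g t) := by
  have hgc : Continuous g := continuous_iff_continuousAt.2 fun t => (hg t).continuousAt
  have hwc : Continuous w := continuous_iff_continuousAt.2 fun t => (hw t).continuousAt
  have hgm : StrictMono g := strictMono_of_hasDerivAt_pos hg hpos
  have hVg : ∀ t, 0 ≤ t → V (g t) ≤ 0 := fun t ht =>
    hV _ ⟨hg0 ▸ hgm.monotone ht, hg1 t⟩
  have hanti : AntitoneOn w (Ici 0) :=
    antitoneOn_of_hasDerivWithinAt_nonpos (convex_Ici 0) hwc.continuousOn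
      (fun t _ => (hw t).hasDerivWithinAt)
      (fun t ht => hVg t (interior_subset ht))
  have hwi : IntegrableOn w (Ioi 0) :=
    integrableOn_Ioi_deriv_of_nonneg hgc.continuousWithinAt (fun t _ => hg t)
      (fun t _ => (hpos t).le) htop
  have hw0 : Tendsto w atTop (nhds 0) := by
    have h1 : Tendsto (fun t => g t - g (t - 1)) atTop (nhds 0) := by
      have := htop.sub (htop.comp (tendsto_atTop_add_const_right atTop (-1 : ℝ) tendsto_id))
      simpa [Function.comp_def, sub_eq_add_neg] using this
    refine squeeze_zero' (Eventually.of_forall fun t => (hpos t).le) ?_ h1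
    filter_upwards [eventually_ge_atTop 1] with t ht
    obtain ⟨c, hc, hc'⟩ := exists_hasDerivAt_eq_slope g w (show t - 1 < t by linarith)
      hgc.continuousOn (fun x _ => hg x)
    have : w c = g t - g (t - 1) := by rw [hc']; ring
    rw [← this]
    exact hanti (mem_Ici.2 (by linarith [hc.1])) (mem_Ici.2 (by linarith)) hc.2.le
  refine ⟨hVg, ?_, ?_⟩
  · refine Integrable.mono' (hwi.const_mul (w 0)) (by fun_prop) ?_
    filter_upwards [ae_restrict_mem measurableSet_Ioi] with t ht
    rw [Real.norm_of_nonneg (by positivity), sq]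
    exact mul_le_mul_of_nonneg_right
      (hanti (mem_Ici.2 le_rfl) (mem_Ici.2 (le_of_lt ht)) (le_of_lt ht)) (hpos t).le
  · have hlin : ∀ᶠ t in atTop, |V (g t) + (1 - g t)| ≤ 1 / 2 * (1 - g t) := by
      have := htop.eventually (hV'.isLittleO.bound (show (0:ℝ) < 1 / 2 by norm_num))
      filter_upwards [this] with t ht
      have hgt := hg1 t
      simp only [hV1, smul_eq_mul, mul_one, sub_zero, Real.norm_eq_abs] at ht
      rw [abs_of_neg (show g t - 1 < 0 by linarith)] at ht
      convert ht using 2 <;> ring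
    obtain ⟨R, hR⟩ := eventually_atTop.1 hlin
    have hmono : MonotoneOn (fun t => w t ^ 2 - 2 * (1 - g t) ^ 2) (Ici R) := by
      refine monotoneOn_of_hasDerivWithinAt_nonneg (convex_Ici R) (by fun_prop)
        (f' := fun t => 2 * w t * (V (g t) + 2 * (1 - g t)))
        (fun t _ => HasDerivAt.hasDerivWithinAt ?_) fun t ht => ?_
      · have h := ((hw t).pow 2).sub ((((hg t).const_sub 1).pow 2).const_mul 2)
        refine h.congr_deriv ?_
        simp
        ring
      · have h1 := abs_le.1 (hR t (interior_subset ht))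
        have h2 := hg1 t
        have h3 := hpos t
        exact mul_nonneg (by linarith) (by linarith)
    have hlim : Tendsto (fun t => w t ^ 2 - 2 * (1 - g t) ^ 2) atTop (nhds 0) := by
      have h := (hw0.pow 2).sub (((htop.const_sub 1).pow 2).const_mul 2)
      simpa using h
    have hwle : ∀ t, R ≤ t → w t ≤ 2 * (1 - g t) := fun t ht => by
      have h1 : w t ^ 2 - 2 * (1 - g t) ^ 2 ≤ 0 := by
        refine ge_of_tendsto hlim ?_
        filter_upwards [eventually_ge_atTop t] with s hs
        exact hmono (mem_Ici.2 ht) (mem_Ici.2 (ht.trans hs)) hs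
      have h2 := hg1 t
      nlinarith [hpos t]
    refine ⟨min (1 / 2) (Real.exp (-R)), lt_min (by norm_num) (Real.exp_pos _), fun t ht => ?_⟩
    have hwt := hpos t
    rcases le_total R t with h | h
    · have h1 := abs_le.1 (hR t h)
      have h2 := hwle t h
      have h3 : min (1 / 2) (Real.exp (-R)) * w t ≤ 1 / 2 * w t :=
        mul_le_mul_of_nonneg_right (min_le_left _ _) hwt.le
      have h4 : 0 ≤ Real.exp (-t) * w t := by positivity
      linarith [h1.2]
    · have h1 : min (1 / 2) (Real.exp (-R)) * w t ≤ Real.exp (-t) * w t :=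
        mul_le_mul_of_nonneg_right
          ((min_le_right _ _).trans (Real.exp_le_exp.2 (by linarith))) hwt.le
      linarith [hVg t ht]

theorem derivative_nonpos_of_no_critical_point {W V : ℝ → ℝ} (hc : ContinuousOn W (Icc 0 1))
    (hd : ∀ s ∈ Ioo (0:ℝ) 1, HasDerivAt W (V s) s) (h01 : W 1 < W 0)
    (hne : ∀ s ∈ Ioo (0:ℝ) 1, V s ≠ 0) (hV0 : V 0 = 0) : ∀ s ∈ Ico (0:ℝ) 1, V s ≤ 0 := by
  intro s hs
  rcases hs.1.eq_or_lt with rfl | h0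
  · exact hV0.le
  rcases hasDerivWithinAt_forall_lt_or_forall_gt_of_forall_ne (convex_Ioo (0:ℝ) 1)
    (fun x hx => (hd x hx).hasDerivWithinAt) hne with h | h
  · exact (h s ⟨h0, hs.2⟩).le
  · obtain ⟨c, hcm, hc'⟩ := exists_hasDerivAt_eq_slope W V one_pos hc hd
    have := h c hcm
    rw [hc'] at this
    norm_num at this
    linarith

/-- Ground state substitution: `φ = w ψ` with `w'' = q w` turns the quadratic form of
`-d²/dt² + q` into the Dirichlet form of `ψ` with weight `w ^ 2`. -/
theorem integral_ground_state {w w' q ψ ψ' : ℝ → ℝ} (hw : ∀ t, HasDerivAt w (w' t) t)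
    (hw' : ∀ t, HasDerivAt w' (q t * w t) t) (hq : Continuous q)
    (hψ : ∀ t, HasDerivAt ψ (ψ' t) t) (hψ'c : Continuous ψ') (hs : HasCompactSupport ψ) :
    ∫ t, ((w' t * ψ t + w t * ψ' t) ^ 2 + q t * (w t * ψ t) ^ 2) = ∫ t, (w t * ψ' t) ^ 2 := by
  have hwc : Continuous w := continuous_iff_continuousAt.2 fun t => (hw t).continuousAt
  have hw'c : Continuous w' := continuous_iff_continuousAt.2 fun t => (hw' t).continuousAt
  have hψc : Continuous ψ := continuous_iff_continuousAt.2 fun t => (hψ t).continuousAt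
  have hs' : HasCompactSupport ψ' := by
    have : deriv ψ = ψ' := funext fun t => (hψ t).deriv
    exact this ▸ hs.deriv
  set B : ℝ → ℝ := fun t => w t * w' t * ψ t ^ 2 with hB
  set B' : ℝ → ℝ := fun t => (w' t * w' t + w t * (q t * w t)) * ψ t ^ 2 +
    w t * w' t * (2 * ψ t * ψ' t) with hB'
  have hBd : ∀ t, HasDerivAt B (B' t) t := fun t => by
    have h := ((hw t).mul (hw' t)).mul ((hψ t).pow 2)
    refine h.congr_deriv ?_
    simp [hB']
  have hBs : HasCompactSupport B := hs.mono fun t ht h => ht (by simp [hB, h])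
  have hB'eq : deriv B = B' := funext fun t => (hBd t).deriv
  have hB's : HasCompactSupport B' := hB'eq ▸ hBs.deriv
  have hBc : Continuous B := by simp only [hB]; fun_prop
  have hB'c : Continuous B' := by simp only [hB']; fun_prop
  have hBi := hBc.integrable_of_hasCompactSupport (μ := volume) hBs
  have hB'i := hB'c.integrable_of_hasCompactSupport (μ := volume) hB's
  have hzero : ∫ t, B' t = 0 := integral_eq_zero_of_hasDerivAt_of_integrable hBd hB'i hBi
  have hDi : Integrable fun t => (w t * ψ' t) ^ 2 :=
    Continuous.integrable_of_hasCompactSupport (by fun_prop)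
      (hs'.mono fun t ht h => ht (by simp [h]))
  calc _ = ∫ t, ((w t * ψ' t) ^ 2 + B' t) := by
        congr 1 with t
        simp only [hB']
        ring
    _ = _ := by rw [integral_add hDi hB'i, hzero, add_zero]

theorem integrable_of_integrableOn_Ioi_comp_neg {f : ℝ → ℝ} (h : IntegrableOn f (Ioi 0))
    (h' : IntegrableOn (fun t => f (-t)) (Ioi 0)) : Integrable f := by
  rw [← integrableOn_univ, ← Iic_union_Ioi (a := (0:ℝ))]
  refine IntegrableOn.union ?_ h
  have := (integrableOn_Ici_iff_integrableOn_Ioi).2 h'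
  simpa using this.comp_neg

/-- Weighted Poincaré-type inequality on the line for functions vanishing at the origin. -/
theorem hardy_real {w w' χ χ' : ℝ → ℝ} {m₁ m₂ : ℝ} (hm₁ : 0 < m₁) (hm₂ : 0 < m₂)
    (hw : ∀ t, HasDerivAt w (w' t) t) (hw'c : Continuous w')
    (hχ : ∀ t, HasDerivAt χ (χ' t) t) (hχ'c : Continuous χ')
    (hpos : ∀ t, 0 < w t) (hw' : ∀ t, 0 ≤ t → w' t ≤ 0) (hw'n : ∀ t, 0 ≤ t → -w' (-t) ≤ 0)
    (hdec : ∀ t, 0 ≤ t → m₁ * w t ≤ Real.exp (-t) * w t - 2 * w' t)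
    (hdecn : ∀ t, 0 ≤ t → m₂ * w (-t) ≤ Real.exp (-t) * w (-t) - 2 * -w' (-t))
    (h0 : χ 0 = 0) (hi : Integrable fun t => (w t * χ t) ^ 2)
    (hi' : Integrable fun t => (w t * χ' t) ^ 2) :
    min (m₁ ^ 2 / 16) (m₂ ^ 2 / 16) * ∫ t, (w t * χ t) ^ 2 ≤ ∫ t, (w t * χ' t) ^ 2 := by
  have hr := hardy_Ioi hm₁ hw hw'c hχ hχ'c hpos hw' hdec h0 hi.integrableOn hi'.integrableOn
  have hneg : ∀ {f f' : ℝ → ℝ}, (∀ t, HasDerivAt f (f' t) t) →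
      ∀ t, HasDerivAt (fun s => f (-s)) (-f' (-t)) t := fun hf t => by
    have := (hf (-t)).comp t (hasDerivAt_neg t)
    simpa [Function.comp_def] using this
  have hl := hardy_Ioi hm₂ (hneg hw) (by fun_prop) (hneg hχ) (by fun_prop)
    (fun t => hpos (-t)) hw'n hdecn (by simpa using h0) hi.comp_neg.integrableOn
    (by simpa using hi'.comp_neg.integrableOn)
  simp only [mul_neg, neg_sq] at hl
  rw [integral_comp_neg_Ioi 0 fun t => (w t * χ t) ^ 2,
    integral_comp_neg_Ioi 0 fun t => (w t * χ' t) ^ 2, neg_zero] at hl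
  have e := integral_add_compl (measurableSet_Iic (a := (0:ℝ))) hi
  have e' := integral_add_compl (measurableSet_Iic (a := (0:ℝ))) hi'
  rw [compl_Iic] at e e'
  rw [← e, ← e', mul_add]
  refine add_le_add (le_trans ?_ hl) (le_trans ?_ hr)
  · exact mul_le_mul_of_nonneg_right (min_le_right _ _)
      (integral_nonneg fun t => sq_nonneg _)
  · exact mul_le_mul_of_nonneg_right (min_le_left _ _)
      (integral_nonneg fun t => sq_nonneg _)

/-- Theorem A.2: spectral gap for the linearized operator `−d²/dt² + W″(g)` above its
ground state `g′`. -/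
theorem stmt13 (W : ℝ → ℝ) (hW : IsDoubleWell W)
    (g : ℝ → ℝ) (hg : ContDiff ℝ 2 g) (hode : ∀ t, deriv (deriv g) t = deriv W (g t))
    (hg0 : g 0 = 0) (hgr : ∀ t, g t ∈ Ioo (-1:ℝ) 1) (hg' : ∀ t, 0 < deriv g t)
    (htop : Tendsto g atTop (nhds 1)) (hbot : Tendsto g atBot (nhds (-1))) :
    ∃ μ > 0, ∀ φ : ℝ → ℝ, ContDiff ℝ 1 φ → HasCompactSupport φ →
      (∫ t : ℝ, φ t * deriv g t) = 0 →
      μ * ∫ t : ℝ, (φ t) ^ 2 ≤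
        ∫ t : ℝ, ((deriv φ t) ^ 2 + iteratedDeriv 2 W (g t) * (φ t) ^ 2) := by
  obtain ⟨hWc, hWpos, hWl, hWr, hVl, hVr, hV'l, hV'r, hV0, hcrit⟩ := hW
  have hWo : ContDiffOn ℝ 3 W (Ioo (-1) 1) := hWc.mono Ioo_subset_Icc_self
  have hVo : ContDiffOn ℝ 2 (deriv W) (Ioo (-1) 1) := hWo.deriv_of_isOpen isOpen_Ioo (by norm_num)
  have hQo : ContDiffOn ℝ 1 (deriv (deriv W)) (Ioo (-1) 1) :=
    hVo.deriv_of_isOpen isOpen_Ioo (by norm_num)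
  have hQ : iteratedDeriv 2 W = deriv (deriv W) := by rw [iteratedDeriv_succ, iteratedDeriv_one]
  rw [hQ] at hV'l hV'r ⊢
  have hWd : ∀ s ∈ Ioo (-1:ℝ) 1, HasDerivAt W (deriv W s) s := fun s hs =>
    ((hWo.differentiableOn (by norm_num)).differentiableAt (isOpen_Ioo.mem_nhds hs)).hasDerivAt
  have hVd : ∀ s ∈ Ioo (-1:ℝ) 1, HasDerivAt (deriv W) (deriv (deriv W) s) s := fun s hs =>
    ((hVo.differentiableOn (by norm_num)).differentiableAt (isOpen_Ioo.mem_nhds hs)).hasDerivAt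
  have hVdr : HasDerivAt (deriv W) 1 1 := by
    have := (differentiableAt_of_deriv_ne_zero (by rw [hV'r]; exact one_ne_zero)).hasDerivAt
    rwa [hV'r] at this
  have hVdl : HasDerivAt (deriv W) 1 (-1) := by
    have := (differentiableAt_of_deriv_ne_zero (by rw [hV'l]; exact one_ne_zero)).hasDerivAt
    rwa [hV'l] at this
  have hneg : ∀ {f : ℝ → ℝ} {a t : ℝ}, HasDerivAt f a (-t) →
      HasDerivAt (fun s => f (-s)) (-a) t := fun {f a t} hf => by
    have := hf.comp t (hasDerivAt_neg t)
    simpa [Function.comp_def] using this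
  have hgd : ∀ t, HasDerivAt g (deriv g t) t := fun t =>
    (hg.differentiable (by norm_num) t).hasDerivAt
  have hw1 : ContDiff ℝ 1 (deriv g) := ((contDiff_succ_iff_deriv (n := 1)).1 hg).2.2
  have hwd : ∀ t, HasDerivAt (deriv g) (deriv W (g t)) t := fun t =>
    hode t ▸ (hw1.differentiable (by norm_num) t).hasDerivAt
  have hw'd : ∀ t, HasDerivAt (fun t => deriv W (g t)) (deriv (deriv W) (g t) * deriv g t) t :=
    fun t => (hVd _ (hgr t)).comp t (hgd t)
  have hw'c : Continuous fun t => deriv W (g t) :=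
    continuous_iff_continuousAt.2 fun t => (hw'd t).continuousAt
  have hqc : Continuous fun t => deriv (deriv W) (g t) :=
    hQo.continuousOn.comp_continuous hg.continuous hgr
  have hW0 : 0 < W 0 := hWpos 0 (by norm_num)
  obtain ⟨hsr, hir, m₁, hm₁, hdr⟩ := heteroclinic_decay hgd hwd hg' hg0 (fun t => (hgr t).2) htop
    (derivative_nonpos_of_no_critical_point
      (hWc.continuousOn.mono (Icc_subset_Icc (by norm_num) le_rfl))
      (fun s hs => hWd s ⟨by linarith [hs.1], hs.2⟩) (by rwa [hWr])
      (fun s hs h => hs.1.ne' (hcrit s ⟨by linarith [hs.1], hs.2⟩ h)) hV0) hVr hVdr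
  obtain ⟨hsl, hil, m₂, hm₂, hdl⟩ := heteroclinic_decay (g := fun t => -g (-t))
    (w := fun t => deriv g (-t)) (V := fun s => -deriv W (-s))
    (fun t => (hneg (hgd (-t))).neg.congr_deriv (neg_neg _))
    (fun t => by simpa using hneg (hwd (-t))) (fun t => hg' (-t)) (by simp [hg0])
    (fun t => by linarith [(hgr (-t)).1])
    (by simpa [Function.comp_def] using (hbot.comp tendsto_neg_atTop_atBot).neg)
    (derivative_nonpos_of_no_critical_point (W := fun s => W (-s))
      (hWc.continuousOn.comp continuousOn_neg
        (fun s hs => ⟨by linarith [hs.2], by linarith [hs.1]⟩))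
      (fun s hs => hneg (hWd (-s) ⟨by linarith [hs.2], by linarith [hs.1]⟩))
      (by simpa [hWl] using hW0)
      (fun s hs h => hs.1.ne' (neg_eq_zero.1
        (hcrit (-s) ⟨by linarith [hs.2], by linarith [hs.1]⟩ (neg_eq_zero.1 h))))
      (by simp [hV0]))
    (by simp [hVl]) ((hneg hVdl).neg.congr_deriv (neg_neg _))
  simp only [neg_neg] at hsl hdl
  have hwi : Integrable fun t => deriv g t ^ 2 := integrable_of_integrableOn_Ioi_comp_neg hir hil
  refine ⟨min (m₁ ^ 2 / 16) (m₂ ^ 2 / 16), by positivity, fun φ hφ hφs horth => ?_⟩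
  have hwc : Continuous (deriv g) := hw1.continuous
  have hφc : Continuous φ := hφ.continuous
  set ψ : ℝ → ℝ := fun t => φ t / deriv g t with hψ
  have hwψ : ∀ t, deriv g t * ψ t = φ t := fun t => mul_div_cancel₀ _ (hg' t).ne'
  have hψ1 : ContDiff ℝ 1 ψ := hφ.div hw1 fun t => (hg' t).ne'
  have hψd : ∀ t, HasDerivAt ψ (deriv ψ t) t := fun t =>
    (hψ1.differentiable (by norm_num) t).hasDerivAt
  have hψ'c : Continuous (deriv ψ) := hψ1.continuous_deriv (by norm_num)
  have hψs : HasCompactSupport ψ := hφs.mono fun t ht h => ht (by simp [hψ, h])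
  have hφ' : ∀ t, deriv φ t = deriv W (g t) * ψ t + deriv g t * deriv ψ t := fun t => by
    have h := (hwd t).mul (hψd t)
    have e : deriv g * ψ = φ := funext hwψ
    rw [e] at h
    exact h.deriv
  have hground := integral_ground_state hwd hw'd hqc hψd hψ'c hψs
  simp only [hwψ, ← hφ'] at hground
  rw [hground]
  have hφ2 : Integrable fun t => φ t ^ 2 :=
    Continuous.integrable_of_hasCompactSupport (by fun_prop)
      (hφs.mono fun t ht h => ht (by simp [h]))
  have hφw : Integrable fun t => φ t * deriv g t :=
    Continuous.integrable_of_hasCompactSupport (by fun_prop)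
      (hφs.mono fun t ht h => ht (by simp [h]))
  have hψ'i : Integrable fun t => (deriv g t * deriv ψ t) ^ 2 :=
    Continuous.integrable_of_hasCompactSupport (by fun_prop)
      (hψs.deriv.mono fun t ht h => ht (by simp [h]))
  have hexp : (fun t => (deriv g t * (ψ t - ψ 0)) ^ 2) =
      fun t => φ t ^ 2 - 2 * ψ 0 * (φ t * deriv g t) + ψ 0 ^ 2 * deriv g t ^ 2 := by
    funext t
    rw [mul_sub, hwψ]
    ring
  have hdiff : Integrable fun t => φ t ^ 2 - 2 * ψ 0 * (φ t * deriv g t) :=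
    hφ2.sub (hφw.const_mul _)
  have hχi : Integrable fun t => (deriv g t * (ψ t - ψ 0)) ^ 2 :=
    hexp ▸ hdiff.add (hwi.const_mul _)
  have hmain := hardy_real hm₁ hm₂ hwd hw'c (fun t => (hψd t).sub_const (ψ 0)) hψ'c hg' hsr hsl
    hdr hdl (sub_self _) hχi hψ'i
  refine le_trans (mul_le_mul_of_nonneg_left ?_ (by positivity)) hmain
  rw [hexp, integral_add hdiff (hwi.const_mul _),
    integral_sub hφ2 (hφw.const_mul _), integral_const_mul, integral_const_mul, horth]
  have : 0 ≤ ∫ t, deriv g t ^ 2 := integral_nonneg fun t => sq_nonneg _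
  nlinarith [mul_nonneg (sq_nonneg (ψ 0)) this]
end
end

section
/- Fix c₀ > 0 and let 2 ≤ n ≤ 10, m := n − 1. For every σ > 0 there exist K ≥ 2 and δ⋆ > 0 (depending only on n, c₀, σ) such that the following holds. Let A be a C¹ field of symmetric m×m matrices on B_K(0) ⊂ ℝ^m with |A(y) − Id| ≤ δ⋆ for all y, and let v ∈ C²(B_K(0)) satisfy div(A∇v) ≤ c₀ e^{−v} + δ⋆ in B_K(0), together with the stability-type inequality: for every η ∈ C_c^∞(B_K(0)), ∫ |∇η|² + δ⋆ ∫ η² ≥ c₀ ∫ e^{−v} η². Then ∫_{B₂(0)} e^{−v} ≤ σ. -/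
open Set Metric MeasureTheory Filter
open scoped RealInnerProductSpace

noncomputable section

/-- A field of symmetric continuous linear operators. -/
def SymmField {m : ℕ} (A : Euc m → (Euc m →L[ℝ] Euc m)) : Prop :=
  ∀ y v w, ⟪A y v, w⟫ = ⟪v, A y w⟫

theorem integrable_of_continuousOn_of_eq_zero {m : ℕ} {k : Set (Euc m)} (hk : IsCompact k)
    {h : Euc m → ℝ} (hc : ContinuousOn h k) (h0 : ∀ x ∉ k, h x = 0) : Integrable h := by
  rw [← integrableOn_iff_integrable_of_support_subset (s := k)
    (fun x hx => by_contra fun hxk => hx (h0 x hxk))]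
  exact hc.integrableOn_compact hk

theorem norm_gradient_eq {m : ℕ} (f : Euc m → ℝ) (x : Euc m) :
    ‖gradient f x‖ = ‖fderiv ℝ f x‖ := by
  simp [gradient]

theorem inner_gradient_eq {m : ℕ} (f : Euc m → ℝ) (x y : Euc m) :
    ⟪y, gradient f x⟫ = fderiv ℝ f x y := by
  rw [real_inner_comm]; simp [gradient]

/-- A compactly supported `C¹` function is a `C¹`-uniform limit of smooth functions whose supports
are contained in a prescribed neighbourhood of its support. -/
theorem exists_smooth_approx {m : ℕ} {f : Euc m → ℝ} (hf : ContDiff ℝ 1 f)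
    (hfc : HasCompactSupport f) {r ε : ℝ} (hr : 0 < r) (hε : 0 < ε) :
    ∃ g : Euc m → ℝ, ContDiff ℝ (⊤ : ℕ∞) g ∧ tsupport g ⊆ cthickening r (tsupport f) ∧
      (∀ x, dist (g x) (f x) ≤ ε) ∧ ∀ x, dist (fderiv ℝ g x) (fderiv ℝ f x) ≤ ε := by
  have huf : UniformContinuous f := hfc.uniformContinuous_of_continuous hf.continuous
  have hud : UniformContinuous (fderiv ℝ f) :=
    (hfc.fderiv ℝ).uniformContinuous_of_continuous (hf.continuous_fderiv one_ne_zero)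
  obtain ⟨d₁, hd₁, h₁⟩ := Metric.uniformContinuous_iff.mp huf ε hε
  obtain ⟨d₂, hd₂, h₂⟩ := Metric.uniformContinuous_iff.mp hud ε hε
  have hd : 0 < min r (min d₁ d₂) := lt_min hr (lt_min hd₁ hd₂)
  set d := min r (min d₁ d₂)
  let φ : ContDiffBump (0 : Euc m) := ⟨d / 2, d, half_pos hd, half_lt_self hd⟩
  have hφi : LocallyIntegrable (φ.normed volume) :=
    (φ.contDiff_normed (n := 0)).continuous.locallyIntegrable
  refine ⟨MeasureTheory.convolution (φ.normed volume) f (ContinuousLinearMap.lsmul ℝ ℝ) volume,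
    ?_, ?_, ?_, ?_⟩
  · exact φ.hasCompactSupport_normed.contDiff_convolution_left _ φ.contDiff_normed
      hf.continuous.locallyIntegrable
  · refine closure_minimal ?_ isClosed_cthickening
    intro x hx
    obtain ⟨y, hy, z, hz, rfl⟩ := support_convolution_subset _ hx
    rw [φ.support_normed_eq] at hy
    refine mem_cthickening_of_dist_le _ z _ _ (subset_tsupport _ hz) ?_
    simp only [mem_ball, dist_zero_right] at hy
    simpa using hy.le.trans (min_le_left _ _)
  · intro x
    refine φ.dist_normed_convolution_le hf.continuous.aestronglyMeasurable fun y hy => ?_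
    exact (h₁ (lt_of_lt_of_le (mem_ball.mp hy)
      ((min_le_right _ _).trans (min_le_left _ _)))).le
  · intro x
    rw [(hfc.hasFDerivAt_convolution_right (ContinuousLinearMap.lsmul ℝ ℝ) hφi hf x).fderiv]
    have : (ContinuousLinearMap.lsmul ℝ ℝ : ℝ →L[ℝ] ℝ →L[ℝ] ℝ).precompR (Euc m) =
        ContinuousLinearMap.lsmul ℝ ℝ := by
      ext c L; simp
    rw [this]
    refine φ.dist_normed_convolution_le
      (hf.continuous_fderiv one_ne_zero).aestronglyMeasurable fun y hy => ?_
    exact (h₂ (lt_of_lt_of_le (mem_ball.mp hy)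
      ((min_le_right _ _).trans (min_le_right _ _)))).le

/-- A stability inequality for smooth compactly supported test functions extends to `C¹` ones. -/
theorem stability_of_contDiff_one {m : ℕ} {U : Set (Euc m)} (hU : IsOpen U) {V : Euc m → ℝ}
    (hV : ContinuousOn V U) {c δ : ℝ}
    (H : ∀ η : Euc m → ℝ, ContDiff ℝ (⊤ : ℕ∞) η → HasCompactSupport η → tsupport η ⊆ U →
      c * ∫ x in U, V x * (η x) ^ 2 ≤
        (∫ x in U, ‖gradient η x‖ ^ 2) + δ * ∫ x in U, (η x) ^ 2)
    {η : Euc m → ℝ} (hη : ContDiff ℝ 1 η) (hηc : HasCompactSupport η) (hηU : tsupport η ⊆ U) :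
    c * ∫ x in U, V x * (η x) ^ 2 ≤
      (∫ x in U, ‖gradient η x‖ ^ 2) + δ * ∫ x in U, (η x) ^ 2 := by
  obtain ⟨r, hr, hrU⟩ := hηc.isCompact.exists_cthickening_subset_open hU hηU
  set k := cthickening r (tsupport η)
  have hk : IsCompact k := hηc.isCompact.cthickening
  choose g hg hgk hg0 hg1 using fun i : ℕ =>
    exists_smooth_approx hη hηc hr (Nat.one_div_pos_of_nat (α := ℝ) (n := i))
  have hgc : ∀ i, HasCompactSupport (g i) := fun i => hk.of_isClosed_subset
    (isClosed_tsupport _) (hgk i)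
  obtain ⟨B, hB⟩ := hk.exists_bound_of_continuousOn (hV.mono hrU)
  obtain ⟨B₀, hB₀⟩ := hη.continuous.bounded_above_of_compact_support hηc
  obtain ⟨B₁, hB₁⟩ := (hη.continuous_fderiv one_ne_zero).bounded_above_of_compact_support
    (hηc.fderiv ℝ)
  have hi1 : ∀ i : ℕ, 1 / ((i : ℝ) + 1) ≤ 1 := fun i => by
    rw [div_le_one (by positivity)]; linarith [Nat.cast_nonneg (α := ℝ) i]
  have hb0 : ∀ i x, |g i x| ≤ B₀ + 1 := fun i x => by
    have h1 := hg0 i x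
    have h2 := hB₀ x
    rw [Real.dist_eq] at h1
    rw [Real.norm_eq_abs] at h2
    have h3 := hi1 i
    have h4 := abs_sub_abs_le_abs_sub (g i x) (η x)
    linarith
  have hb1 : ∀ i x, ‖gradient (g i) x‖ ≤ B₁ + 1 := fun i x => by
    have h1 := hg1 i x
    have h2 := hB₁ x
    rw [dist_eq_norm] at h1
    have h3 := hi1 i
    have h4 := norm_sub_norm_le (fderiv ℝ (g i) x) (fderiv ℝ η x)
    rw [norm_gradient_eq]
    linarith
  have hz0 : ∀ i, ∀ x ∉ k, g i x = 0 := fun i x hx =>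
    image_eq_zero_of_notMem_tsupport fun h => hx (hgk i h)
  have hz1 : ∀ i, ∀ x ∉ k, ‖gradient (g i) x‖ = 0 := fun i x hx => by
    rw [norm_gradient_eq, fderiv_of_notMem_tsupport ℝ (fun h => hx (hgk i h)), norm_zero]
  have hcg : ∀ i, Continuous fun x => ‖gradient (g i) x‖ := fun i => by
    simp_rw [norm_gradient_eq]
    exact ((hg i).continuous_fderiv (by simp)).norm
  have hl0 : ∀ x, Tendsto (fun i => g i x) atTop (nhds (η x)) := fun x =>
    tendsto_iff_dist_tendsto_zero.mpr (squeeze_zero (fun _ => dist_nonneg) (fun i => hg0 i x)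
      tendsto_one_div_add_atTop_nhds_zero_nat)
  have hl1 : ∀ x, Tendsto (fun i => ‖gradient (g i) x‖) atTop (nhds ‖gradient η x‖) := fun x => by
    simp_rw [norm_gradient_eq]
    exact (tendsto_iff_dist_tendsto_zero.mpr (squeeze_zero (fun _ => dist_nonneg)
      (fun i => hg1 i x) tendsto_one_div_add_atTop_nhds_zero_nat)).norm
  have hint : ∀ D : ℝ, Integrable (k.indicator fun _ => D) (volume.restrict U) := fun D =>
    ((integrable_indicator_iff hk.measurableSet).mpr
      (integrableOn_const hk.measure_lt_top.ne)).integrableOn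
  have key : ∀ (G : ℕ → Euc m → ℝ) (G' : Euc m → ℝ) (D : ℝ), (∀ i, ContinuousOn (G i) k) →
      (∀ i, ∀ x ∉ k, G i x = 0) → (∀ i, ∀ x ∈ k, |G i x| ≤ D) →
      (∀ x, Tendsto (fun i => G i x) atTop (nhds (G' x))) →
      Tendsto (fun i => ∫ x in U, G i x) atTop (nhds (∫ x in U, G' x)) := by
    intro G G' D hGc hG0 hGD hGl
    refine tendsto_integral_of_dominated_convergence (k.indicator fun _ => D) (fun i => ?_)
      (hint D) (fun i => ae_of_all _ fun x => ?_) (ae_of_all _ hGl)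
    · exact (integrable_of_continuousOn_of_eq_zero hk (hGc i) (hG0 i)).aestronglyMeasurable.restrict
    · by_cases hx : x ∈ k
      · rw [indicator_of_mem hx]; exact hGD i x hx
      · rw [indicator_of_notMem hx, hG0 i x hx, norm_zero]
  refine le_of_tendsto_of_tendsto'
    ((key (fun i x => V x * g i x ^ 2) _ (B * (B₀ + 1) ^ 2) ?_ ?_ ?_ ?_).const_mul c)
    ((key (fun i x => ‖gradient (g i) x‖ ^ 2) _ ((B₁ + 1) ^ 2) ?_ ?_ ?_ ?_).add
      ((key (fun i x => g i x ^ 2) _ ((B₀ + 1) ^ 2) ?_ ?_ ?_ ?_).const_mul δ))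
    fun i => H (g i) (hg i) (hgc i) ((hgk i).trans hrU)
  · exact fun i => (hV.mono hrU).mul ((hg i).continuous.pow 2).continuousOn
  · exact fun i x hx => by simp [hz0 i x hx]
  · intro i x hx
    rw [abs_mul, abs_pow]
    have h1 := hB x hx
    rw [Real.norm_eq_abs] at h1
    have := hb0 i x
    have := (abs_nonneg _).trans h1
    gcongr
  · exact fun x => ((hl0 x).pow 2).const_mul _
  · exact fun i => ((hcg i).pow 2).continuousOn
  · exact fun i x hx => by simp [hz1 i x hx]
  · intro i x _
    rw [abs_of_nonneg (by positivity)]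
    have := hb1 i x
    gcongr
  · exact fun x => (hl1 x).pow 2
  · exact fun i => ((hg i).continuous.pow 2).continuousOn
  · exact fun i x hx => by simp [hz0 i x hx]
  · intro i x _
    rw [abs_pow]
    have := hb0 i x
    gcongr
  · exact fun x => (hl0 x).pow 2

/-- Integration by parts against a compactly supported `C¹` function. -/
theorem integral_divg_mul {m : ℕ} {U : Set (Euc m)} (hU : IsOpen U) {F : Euc m → Euc m}
    (hF : ContDiffOn ℝ 1 F U) {w : Euc m → ℝ} (hw : ContDiff ℝ 1 w) (hwc : HasCompactSupport w)
    (hwU : tsupport w ⊆ U) :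
    ∫ x, divg F x * w x = -∫ x, ⟪F x, gradient w x⟫ := by
  have hFc : ContinuousOn F (tsupport w) := hF.continuousOn.mono hwU
  have hF'c : ContinuousOn (fderiv ℝ F) (tsupport w) :=
    (hF.continuousOn_fderiv_of_isOpen hU le_rfl).mono hwU
  have hw' : Continuous (fderiv ℝ w) := hw.continuous_fderiv one_ne_zero
  have hFd : ∀ x ∈ tsupport w, DifferentiableAt ℝ F x := fun x hx =>
    (hF.differentiableOn one_ne_zero).differentiableAt (hU.mem_nhds (hwU hx))
  have hw0 : ∀ x ∉ tsupport w, w x = 0 := fun x hx => image_eq_zero_of_notMem_tsupport hx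
  have hw'0 : ∀ x ∉ tsupport w, fderiv ℝ w x = 0 := fun x hx => fderiv_of_notMem_tsupport ℝ hx
  have hint1 : ∀ i, Integrable fun x => w x * ⟪fderiv ℝ F x (eb m i), eb m i⟫ := fun i =>
    integrable_of_continuousOn_of_eq_zero hwc.isCompact
      (hw.continuous.continuousOn.mul ((hF'c.clm_apply continuousOn_const).inner
        continuousOn_const)) fun x hx => by simp [hw0 x hx]
  have hint2 : ∀ i, Integrable fun x => fderiv ℝ w x (eb m i) * ⟪F x, eb m i⟫ := fun i =>
    integrable_of_continuousOn_of_eq_zero hwc.isCompact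
      ((hw'.continuousOn.clm_apply continuousOn_const).mul (hFc.inner continuousOn_const))
      fun x hx => by simp [hw'0 x hx]
  have hint3 : ∀ i, Integrable fun x => w x * ⟪F x, eb m i⟫ := fun i =>
    integrable_of_continuousOn_of_eq_zero hwc.isCompact
      (hw.continuous.continuousOn.mul (hFc.inner continuousOn_const))
      fun x hx => by simp [hw0 x hx]
  have hd : ∀ i, ∀ x ∈ tsupport w,
      fderiv ℝ (fun y => ⟪F y, eb m i⟫) x (eb m i) = ⟪fderiv ℝ F x (eb m i), eb m i⟫ := by
    intro i x hx
    rw [fderiv_inner_apply ℝ (hFd x hx) (differentiableAt_const _)]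
    simp
  have hparts : ∀ i, ∫ x, w x * ⟪fderiv ℝ F x (eb m i), eb m i⟫ =
      -∫ x, fderiv ℝ w x (eb m i) * ⟪F x, eb m i⟫ := by
    intro i
    have heq : (fun x => w x * ⟪fderiv ℝ F x (eb m i), eb m i⟫) =
        fun x => w x * fderiv ℝ (fun y => ⟪F y, eb m i⟫) x (eb m i) := by
      funext x
      by_cases hx : x ∈ tsupport w
      · rw [hd i x hx]
      · simp [hw0 x hx]
    have h1 := hint1 i
    rw [heq] at h1 ⊢
    exact integral_mul_fderiv_eq_neg_fderiv_mul_of_integrable (hint2 i) h1 (hint3 i)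
      (fun x _ => (hw.differentiable one_ne_zero) x)
      (fun x hx => (hFd x hx).inner ℝ (differentiableAt_const _))
  have hgrad : ∀ x, ⟪F x, gradient w x⟫ = ∑ i, fderiv ℝ w x (eb m i) * ⟪F x, eb m i⟫ := by
    intro x
    rw [← (EuclideanSpace.basisFun (Fin m) ℝ).sum_inner_mul_inner]
    refine Finset.sum_congr rfl fun i _ => ?_
    rw [inner_gradient_eq, mul_comm]; rfl
  simp_rw [hgrad]
  rw [integral_finsetSum _ fun i _ => hint2 i, ← Finset.sum_neg_distrib]
  simp_rw [← hparts]
  rw [← integral_finsetSum _ fun i _ => hint1 i]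
  refine integral_congr_ae (ae_of_all _ fun x => ?_)
  simp only [divg]
  rw [mul_comm, Finset.mul_sum]

theorem rpow_mul_pow_mul_le {ε t s a : ℝ} (hε : 0 < ε) (ht : 0 < t) (hs0 : 0 ≤ s) (hs1 : s ≤ 1)
    (ha : 0 ≤ a) :
    t ^ (18 / 5 : ℝ) * s ^ 8 * a ≤
      ε * (t * (t ^ (18 / 5 : ℝ) * s ^ 10)) + ε⁻¹ ^ (18 / 5 : ℝ) * a ^ (23 / 5 : ℝ) := by
  rcases le_or_gt a (ε * (t * s ^ 2)) with h | h
  · have h1 : t ^ (18 / 5 : ℝ) * s ^ 8 * a ≤ t ^ (18 / 5 : ℝ) * s ^ 8 * (ε * (t * s ^ 2)) := by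
      gcongr
    have h2 : 0 ≤ ε⁻¹ ^ (18 / 5 : ℝ) * a ^ (23 / 5 : ℝ) := by positivity
    linarith
  · have h1 : t * s ^ 2 ≤ ε⁻¹ * a := by
      rw [inv_mul_eq_div, le_div_iff₀ hε]; linarith
    have ha' : 0 < a := lt_of_le_of_lt (by positivity) h
    have h2 : s ^ 8 ≤ (s ^ 2) ^ (18 / 5 : ℝ) := by
      have : s ^ 8 = (s ^ 2) ^ (4 : ℝ) := by
        rw [show (4 : ℝ) = ((4 : ℕ) : ℝ) by norm_num, Real.rpow_natCast]; ring
      rw [this]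
      rcases hs0.eq_or_lt with h0 | h0
      · rw [← h0]; norm_num
      · exact Real.rpow_le_rpow_of_exponent_ge (by positivity) (pow_le_one₀ hs0 hs1) (by norm_num)
    have h3 : t ^ (18 / 5 : ℝ) * s ^ 8 ≤ (ε⁻¹ * a) ^ (18 / 5 : ℝ) := by
      calc t ^ (18 / 5 : ℝ) * s ^ 8 ≤ t ^ (18 / 5 : ℝ) * (s ^ 2) ^ (18 / 5 : ℝ) := by gcongr
        _ = (t * s ^ 2) ^ (18 / 5 : ℝ) := (Real.mul_rpow ht.le (by positivity)).symm
        _ ≤ _ := by gcongr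
    have h4 : a ^ (23 / 5 : ℝ) = a ^ (18 / 5 : ℝ) * a := by
      rw [show (23 / 5 : ℝ) = 18 / 5 + 1 by norm_num, Real.rpow_add_one ha'.ne']
    have h5 : 0 ≤ ε * (t * (t ^ (18 / 5 : ℝ) * s ^ 10)) := by positivity
    calc t ^ (18 / 5 : ℝ) * s ^ 8 * a ≤ (ε⁻¹ * a) ^ (18 / 5 : ℝ) * a := by gcongr
      _ = ε⁻¹ ^ (18 / 5 : ℝ) * a ^ (23 / 5 : ℝ) := by
        rw [Real.mul_rpow (by positivity) ha, h4, mul_assoc]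
      _ ≤ _ := by linarith

theorem le_add_rpow_mul {τ t : ℝ} (hτ : 0 < τ) (ht : 0 < t) :
    t ≤ τ + τ⁻¹ ^ (18 / 5 : ℝ) * (t * t ^ (18 / 5 : ℝ)) := by
  rcases le_or_gt t τ with h | h
  · have : 0 ≤ τ⁻¹ ^ (18 / 5 : ℝ) * (t * t ^ (18 / 5 : ℝ)) := by positivity
    linarith
  · have h1 : 1 ≤ (τ⁻¹ * t) ^ (18 / 5 : ℝ) := by
      refine Real.one_le_rpow ?_ (by norm_num)
      rw [inv_mul_eq_div, one_le_div hτ]; exact h.le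
    rw [Real.mul_rpow (by positivity) ht.le] at h1
    nlinarith

/-- The quadratic form coming from testing with `e ^ (-9v/5)` is nonnegative up to a multiple of
the squared gradient of the cutoff. -/
theorem quadratic_form_le {E : Type*} [NormedAddCommGroup E] [InnerProductSpace ℝ E]
    {g p a : E} {s δ : ℝ} (hδ : δ ≤ 1 / 100) (hs : 0 ≤ s) (ha : ‖a - g‖ ≤ δ * ‖g‖) :
    ‖(5 : ℝ) • p - (9 / 5 * s) • g‖ ^ 2 +
      19 / 20 * (2 * s * ⟪a, (5 : ℝ) • p - (9 / 5 * s) • g⟫) ≤ 1425 * ‖p‖ ^ 2 := by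
  obtain ⟨e, rfl⟩ : ∃ e, a = g + e := ⟨a - g, by abel⟩
  rw [add_sub_cancel_left] at ha
  have he : ‖e‖ ≤ 1 / 100 * ‖g‖ := ha.trans (by gcongr)
  have h1 := abs_le.mp (abs_real_inner_le_norm e g)
  have h2 := abs_le.mp (abs_real_inner_le_norm e p)
  have h3 := abs_le.mp (abs_real_inner_le_norm g p)
  rw [norm_sub_sq_real]
  simp only [inner_sub_right, inner_add_left, inner_smul_left, inner_smul_right, norm_smul,
    mul_pow, real_inner_self_eq_norm_sq, Real.norm_eq_abs, sq_abs, RCLike.conj_to_real]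
  rw [real_inner_comm g p]
  have h4 : ‖e‖ * ‖g‖ ≤ 1 / 100 * ‖g‖ ^ 2 := by nlinarith [norm_nonneg g]
  have h5 : ‖e‖ * ‖p‖ ≤ 1 / 100 * (‖g‖ * ‖p‖) := by nlinarith [norm_nonneg p]
  have h6 : -(s ^ 2 * ⟪e, g⟫) ≤ s ^ 2 * (1 / 100 * ‖g‖ ^ 2) := by nlinarith [sq_nonneg s]
  have h7 : s * ⟪e, p⟫ ≤ s * (1 / 100 * (‖g‖ * ‖p‖)) := by
    gcongr; linarith
  have h8 : -(s * ⟪g, p⟫) ≤ s * (‖g‖ * ‖p‖) := by nlinarith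
  nlinarith [sq_nonneg (s * ‖g‖ - 100 * ‖p‖), sq_nonneg (s * ‖g‖),
    mul_nonneg hs (mul_nonneg (norm_nonneg g) (norm_nonneg p))]

theorem exists_cutoff (m : ℕ) : ∃ M : ℝ, 0 ≤ M ∧ ∀ R : ℝ, 0 < R → ∃ φ : Euc m → ℝ,
    ContDiff ℝ 1 φ ∧ (∀ x, 0 ≤ φ x) ∧ (∀ x, φ x ≤ 1) ∧ (∀ x ∈ ball 0 R, φ x = 1) ∧
      tsupport φ ⊆ closedBall 0 (2 * R) ∧ ∀ x, ‖gradient φ x‖ ≤ M / R := by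
  let ψ : ContDiffBump (0 : Euc m) := ⟨1, 2, one_pos, one_lt_two⟩
  have hψ : ContDiff ℝ 1 ψ := ψ.contDiff
  obtain ⟨M, hM⟩ := (hψ.continuous_fderiv one_ne_zero).bounded_above_of_compact_support
    (ψ.hasCompactSupport.fderiv ℝ)
  refine ⟨M, (norm_nonneg _).trans (hM 0), fun R hR => ⟨fun x => ψ (R⁻¹ • x), ?_,
    fun x => ψ.nonneg, fun x => ψ.le_one, fun x hx => ?_, ?_, fun x => ?_⟩⟩
  · exact hψ.comp (contDiff_const_smul _)
  · refine ψ.one_of_mem_closedBall ?_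
    rw [mem_closedBall_zero_iff, norm_smul, norm_inv, Real.norm_of_nonneg hR.le,
      inv_mul_le_one₀ hR]
    exact (mem_ball_zero_iff.mp hx).le
  · refine closure_minimal (fun x hx => ?_) isClosed_closedBall
    have h : R⁻¹ • x ∈ Function.support ψ := hx
    rw [ψ.support_eq, mem_ball_zero_iff, norm_smul, norm_inv, Real.norm_of_nonneg hR.le,
      inv_mul_lt_iff₀ hR] at h
    rw [mem_closedBall_zero_iff, mul_comm]
    exact h.le
  · rw [norm_gradient_eq, fderiv_comp_smul, norm_smul, norm_inv, Real.norm_of_nonneg hR.le,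
      div_eq_inv_mul]
    gcongr
    exact hM _

theorem hasGradientAt_exp_mul_pow {m : ℕ} {v φ : Euc m → ℝ} {x : Euc m}
    (hv : DifferentiableAt ℝ v x) (hφ : DifferentiableAt ℝ φ x) :
    gradient (fun y => Real.exp (-(9 / 5) * v y) * φ y ^ 5) x =
      (Real.exp (-(9 / 5) * v x) * φ x ^ 4) •
        ((5 : ℝ) • gradient φ x - (9 / 5 * φ x) • gradient v x) := by
  have h : HasFDerivAt (fun y => Real.exp (-(9 / 5) * v y) * φ y ^ 5) _ x :=
    (hv.hasFDerivAt.const_mul (-(9 / 5) : ℝ)).exp.mul (hφ.hasFDerivAt.pow 5)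
  refine ext_inner_left ℝ fun y => ?_
  rw [inner_gradient_eq, h.fderiv, inner_smul_right, inner_sub_right, inner_smul_right,
    inner_smul_right, inner_gradient_eq, inner_gradient_eq]
  simp
  ring

theorem gradient_sq {m : ℕ} {η : Euc m → ℝ} {x : Euc m} (hη : DifferentiableAt ℝ η x) :
    gradient (fun y => η y ^ 2) x = (2 * η x) • gradient η x := by
  refine ext_inner_left ℝ fun y => ?_
  rw [inner_gradient_eq, (hη.hasFDerivAt.pow 2).fderiv, inner_smul_right, inner_gradient_eq]
  simp

/-- Farina-type energy estimate with exponent `9 / 5`. -/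
theorem energy_estimate {m : ℕ} {U : Set (Euc m)} (hU : IsOpen U) {c δ : ℝ}
    (hδ0 : 0 ≤ δ) (hδ : δ ≤ 1 / 100) {A : Euc m → (Euc m →L[ℝ] Euc m)} {v : Euc m → ℝ}
    (hA : ContDiffOn ℝ 1 A U) (hAδ : ∀ y ∈ U, ‖A y - ContinuousLinearMap.id ℝ (Euc m)‖ ≤ δ)
    (hv : ContDiffOn ℝ 2 v U)
    (hdiv : ∀ x ∈ U, divg (fun y => A y (gradient v y)) x ≤ c * Real.exp (-(v x)) + δ)
    (hst : ∀ η : Euc m → ℝ, ContDiff ℝ (⊤ : ℕ∞) η → HasCompactSupport η → tsupport η ⊆ U →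
      c * ∫ x in U, Real.exp (-(v x)) * (η x) ^ 2 ≤
        (∫ x in U, ‖gradient η x‖ ^ 2) + δ * ∫ x in U, (η x) ^ 2)
    {φ : Euc m → ℝ} (hφ : ContDiff ℝ 1 φ) (hφ0 : ∀ x, 0 ≤ φ x) (hφc : HasCompactSupport φ)
    (hφU : tsupport φ ⊆ U) :
    1 / 20 * c * ∫ x, Real.exp (-(v x)) * (Real.exp (-(9 / 5) * v x) * φ x ^ 5) ^ 2 ≤
      ∫ x, Real.exp (-(9 / 5) * v x) ^ 2 * φ x ^ 8 *
        (1425 * ‖gradient φ x‖ ^ 2 + 2 * δ * φ x ^ 2) := by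
  set k := tsupport φ
  have hk : IsCompact k := hφc.isCompact
  have hφk : ∀ x ∉ k, φ x = 0 := fun x hx => image_eq_zero_of_notMem_tsupport hx
  set η : Euc m → ℝ := fun y => Real.exp (-(9 / 5) * v y) * φ y ^ 5 with hη_def
  have hηk : tsupport η ⊆ k := closure_mono fun x hx => by
    intro h0
    exact hx (by simp [hη_def, h0])
  have hηc : HasCompactSupport η := hk.of_isClosed_subset (isClosed_tsupport _) hηk
  have hη0 : ∀ x ∉ k, η x = 0 := fun x hx => by simp [hη_def, hφk x hx]
  have hvd : ∀ x ∈ U, DifferentiableAt ℝ v x := fun x hx =>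
    (hv.differentiableOn two_ne_zero).differentiableAt (hU.mem_nhds hx)
  have hη : ContDiff ℝ 1 η := by
    rw [contDiff_iff_contDiffAt]
    intro x
    by_cases hx : x ∈ k
    · have hvx : ContDiffAt ℝ 1 v x :=
        ((hv.of_le one_le_two).contDiffAt (hU.mem_nhds (hφU hx)))
      exact (contDiffAt_const.mul hvx).exp.mul (hφ.contDiffAt.pow 5)
    · have : η =ᶠ[nhds x] fun _ => 0 := by
        filter_upwards [(isClosed_tsupport φ).isOpen_compl.mem_nhds hx] with y hy
        exact hη0 y hy
      exact contDiffAt_const.congr_of_eventuallyEq this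
  have hgη : ∀ x ∈ U, gradient η x = (Real.exp (-(9 / 5) * v x) * φ x ^ 4) •
        ((5 : ℝ) • gradient φ x - (9 / 5 * φ x) • gradient v x) := fun x hx =>
    hasGradientAt_exp_mul_pow (hvd x hx) ((hφ.differentiable one_ne_zero) x)
  have hgη0 : ∀ x ∉ k, gradient η x = 0 := fun x hx => by
    rw [← norm_eq_zero, norm_gradient_eq, fderiv_of_notMem_tsupport ℝ (fun h => hx (hηk h)),
      norm_zero]
  set w : Euc m → ℝ := fun y => η y ^ 2 with hw_def
  have hw : ContDiff ℝ 1 w := hη.pow 2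
  have hwk : tsupport w ⊆ k := (closure_mono fun x hx => by
    intro h0
    exact hx (by simp [hw_def, h0])).trans hηk
  have hwc : HasCompactSupport w := hk.of_isClosed_subset (isClosed_tsupport _) hwk
  have hgw : ∀ x, gradient w x = (2 * η x) • gradient η x := fun x =>
    gradient_sq ((hη.differentiable one_ne_zero) x)
  have hw0 : ∀ x ∉ k, w x = 0 := fun x hx => by simp [hw_def, hη0 x hx]
  set F : Euc m → Euc m := fun y => A y (gradient v y)
  have hgv : ContDiffOn ℝ 1 (gradient v) U :=
    (InnerProductSpace.toDual ℝ (Euc m)).symm.toContinuousLinearEquiv.contDiff.comp_contDiffOn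
      (hv.fderiv_of_isOpen hU (by norm_num))
  have hF : ContDiffOn ℝ 1 F U := hA.clm_apply hgv
  have hFk : ContinuousOn F k := hF.continuousOn.mono hφU
  have hdFk : ContinuousOn (divg F) k := by
    have := (hF.continuousOn_fderiv_of_isOpen hU le_rfl).mono hφU
    exact continuousOn_finsetSum _ fun i _ =>
      (this.clm_apply continuousOn_const).inner continuousOn_const
  have hvk : ContinuousOn v k := hv.continuousOn.mono hφU
  have hgηc : Continuous (gradient η) :=
    (InnerProductSpace.toDual ℝ (Euc m)).symm.continuous.comp (hη.continuous_fderiv one_ne_zero)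
  have hgφc : Continuous (gradient φ) :=
    (InnerProductSpace.toDual ℝ (Euc m)).symm.continuous.comp (hφ.continuous_fderiv one_ne_zero)
  have hgwc : Continuous (gradient w) :=
    (InnerProductSpace.toDual ℝ (Euc m)).symm.continuous.comp (hw.continuous_fderiv one_ne_zero)
  have iT : Integrable fun x => Real.exp (-(v x)) * η x ^ 2 :=
    integrable_of_continuousOn_of_eq_zero hk
      (hvk.neg.rexp.mul (hη.continuous.pow 2).continuousOn) fun x hx => by simp [hη0 x hx]
  have iN : Integrable fun x => ‖gradient η x‖ ^ 2 :=
    integrable_of_continuousOn_of_eq_zero hk (hgηc.norm.pow 2).continuousOn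
      fun x hx => by simp [hgη0 x hx]
  have iW : Integrable w :=
    integrable_of_continuousOn_of_eq_zero hk hw.continuous.continuousOn hw0
  have iD : Integrable fun x => divg F x * w x :=
    integrable_of_continuousOn_of_eq_zero hk (hdFk.mul hw.continuous.continuousOn)
      fun x hx => by simp [hw0 x hx]
  have iI : Integrable fun x => ⟪F x, gradient w x⟫ :=
    integrable_of_continuousOn_of_eq_zero hk (hFk.inner hgwc.continuousOn)
      fun x hx => by simp [hgw, hη0 x hx]
  have iQ : Integrable fun x => Real.exp (-(9 / 5) * v x) ^ 2 * φ x ^ 8 *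
      (1425 * ‖gradient φ x‖ ^ 2) :=
    integrable_of_continuousOn_of_eq_zero hk
      ((((continuousOn_const.mul hvk).rexp.pow 2).mul (hφ.continuous.pow 8).continuousOn).mul
        (continuous_const.mul (hgφc.norm.pow 2)).continuousOn)
      fun x hx => by simp [hφk x hx]
  have hS := stability_of_contDiff_one hU (hv.continuousOn.neg.rexp) hst hη hηc
    (hηk.trans hφU)
  simp only [Pi.neg_apply] at hS
  rw [setIntegral_eq_integral_of_forall_compl_eq_zero
      (fun x hx => by simp [hη0 x fun h => hx (hφU h)]),
    setIntegral_eq_integral_of_forall_compl_eq_zero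
      (fun x hx => by simp [hgη0 x fun h => hx (hφU h)]),
    setIntegral_eq_integral_of_forall_compl_eq_zero
      (fun x hx => by simp [hη0 x fun h => hx (hφU h)])] at hS
  have hD := integral_divg_mul hU hF hw hwc (hwk.trans hφU)
  have hD' : ∫ x, divg F x * w x ≤ c * (∫ x, Real.exp (-(v x)) * η x ^ 2) + δ * ∫ x, w x := by
    rw [← integral_const_mul, ← integral_const_mul,
      ← integral_add (iT.const_mul c) (iW.const_mul δ)]
    refine integral_mono iD ((iT.const_mul c).add (iW.const_mul δ)) fun x => ?_
    by_cases hx : x ∈ k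
    · have := mul_le_mul_of_nonneg_right (hdiv x (hφU hx)) (sq_nonneg (η x))
      simp only [hw_def]
      linarith
    · simp [hw0 x hx, hη0 x hx]
  have hP : (∫ x, ‖gradient η x‖ ^ 2) + 19 / 20 * ∫ x, ⟪F x, gradient w x⟫ ≤
      ∫ x, Real.exp (-(9 / 5) * v x) ^ 2 * φ x ^ 8 * (1425 * ‖gradient φ x‖ ^ 2) := by
    rw [← integral_const_mul, ← integral_add iN (iI.const_mul _)]
    refine integral_mono (iN.add (iI.const_mul _)) iQ fun x => ?_
    by_cases hx : x ∈ k
    · have hAx : ‖F x - gradient v x‖ ≤ δ * ‖gradient v x‖ := by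
        have h1 := (A x - ContinuousLinearMap.id ℝ (Euc m)).le_opNorm (gradient v x)
        exact h1.trans (mul_le_mul_of_nonneg_right (hAδ x (hφU hx)) (norm_nonneg _))
      have hq := mul_le_mul_of_nonneg_left
        (quadratic_form_le (p := gradient φ x) hδ (hφ0 x) hAx)
        (show 0 ≤ Real.exp (-(9 / 5) * v x) ^ 2 * φ x ^ 8 by positivity)
      refine le_trans (le_of_eq ?_) hq
      simp only [hgw, hgη x (hφU hx), norm_smul, inner_smul_right, mul_pow, Real.norm_eq_abs,
        abs_mul, abs_pow, sq_abs]
      simp only [hη_def, abs_of_nonneg (hφ0 x)]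
      ring
    · simp [hgη0 x hx, hgw, hφk x hx]
  have hsplit : ∫ x, Real.exp (-(9 / 5) * v x) ^ 2 * φ x ^ 8 *
        (1425 * ‖gradient φ x‖ ^ 2 + 2 * δ * φ x ^ 2) =
      (∫ x, Real.exp (-(9 / 5) * v x) ^ 2 * φ x ^ 8 * (1425 * ‖gradient φ x‖ ^ 2)) +
        2 * δ * ∫ x, w x := by
    rw [← integral_const_mul, ← integral_add iQ (iW.const_mul _)]
    refine integral_congr_ae (ae_of_all _ fun x => ?_)
    simp only [hw_def, hη_def]
    ring
  have hW : 0 ≤ δ * ∫ x, w x := mul_nonneg hδ0 (integral_nonneg fun x => sq_nonneg _)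
  rw [hsplit]
  simp only [← hw_def] at hS
  change 1 / 20 * c * (∫ x, Real.exp (-(v x)) * η x ^ 2) ≤ _
  linarith

/-- Quantitative decay: with `δ = R⁻²`, the integral over `B₂` is controlled by a small multiple of
the volume of `B₂` and a negative power of `R`. -/
theorem exists_integral_exp_neg_le {m : ℕ} (hm : m ≤ 9) {c τ : ℝ} (hc : 0 < c) (hτ : 0 < τ) :
    ∃ D : ℝ, ∀ R : ℝ, 10 ≤ R → ∀ A : Euc m → (Euc m →L[ℝ] Euc m), ∀ v : Euc m → ℝ,
      ContDiffOn ℝ 1 A (ball 0 (3 * R)) →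
      (∀ y ∈ ball (0 : Euc m) (3 * R), ‖A y - ContinuousLinearMap.id ℝ (Euc m)‖ ≤ (R ^ 2)⁻¹) →
      ContDiffOn ℝ 2 v (ball 0 (3 * R)) →
      (∀ x ∈ ball (0 : Euc m) (3 * R),
        divg (fun y => A y (gradient v y)) x ≤ c * Real.exp (-(v x)) + (R ^ 2)⁻¹) →
      (∀ η : Euc m → ℝ, ContDiff ℝ (⊤ : ℕ∞) η → HasCompactSupport η →
          tsupport η ⊆ ball 0 (3 * R) →
        c * ∫ x in ball (0 : Euc m) (3 * R), Real.exp (-(v x)) * (η x) ^ 2 ≤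
          (∫ x in ball (0 : Euc m) (3 * R), ‖gradient η x‖ ^ 2) +
            (R ^ 2)⁻¹ * ∫ x in ball (0 : Euc m) (3 * R), (η x) ^ 2) →
      ∫ x in ball (0 : Euc m) 2, Real.exp (-(v x)) ≤
        τ * volume.real (ball (0 : Euc m) 2) + D * R ^ (-(1 / 5) : ℝ) := by
  obtain ⟨M, hM, hcut⟩ := exists_cutoff m
  set ε := c / 40 with hε_def
  have hε : 0 < ε := by positivity
  set B := 1425 * M ^ 2 + 2 with hB_def
  have hB : 0 ≤ B := by positivity
  set N := ε⁻¹ ^ (18 / 5 : ℝ) * (B ^ (23 / 5 : ℝ) * (2 ^ m * volume.real (ball (0 : Euc m) 1)))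
    with hN_def
  have hN : 0 ≤ N := by positivity
  refine ⟨τ⁻¹ ^ (18 / 5 : ℝ) * (ε⁻¹ * N), fun R hR A v hA hAδ hv hdiv hst => ?_⟩
  have hR0 : 0 < R := by linarith
  obtain ⟨φ, hφ, hφ0, hφ1, hφR, hφk, hgφ⟩ := hcut R hR0
  have hkU : closedBall (0 : Euc m) (2 * R) ⊆ ball 0 (3 * R) :=
    closedBall_subset_ball (by linarith)
  have hk : IsCompact (closedBall (0 : Euc m) (2 * R)) := isCompact_closedBall _ _
  set k := closedBall (0 : Euc m) (2 * R) with hk_def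
  have hφc : HasCompactSupport φ := hk.of_isClosed_subset (isClosed_tsupport _) hφk
  have hδ : (R ^ 2)⁻¹ ≤ 1 / 100 := by
    rw [inv_le_comm₀ (by positivity) (by norm_num)]; nlinarith
  have hE := energy_estimate isOpen_ball (by positivity) hδ hA hAδ hv hdiv hst hφ hφ0 hφc
    (hφk.trans hkU)
  have hφz : ∀ x ∉ k, φ x = 0 := fun x hx =>
    image_eq_zero_of_notMem_tsupport fun h => hx (hφk h)
  have hvk : ContinuousOn v k := hv.continuousOn.mono hkU
  have hexp : ∀ x, Real.exp (-(9 / 5) * v x) ^ 2 = Real.exp (-(v x)) ^ (18 / 5 : ℝ) := fun x => by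
    rw [← Real.exp_mul, ← Real.exp_nat_mul]; congr 1; push_cast; ring
  have hgφc : Continuous (gradient φ) :=
    (InnerProductSpace.toDual ℝ (Euc m)).symm.continuous.comp (hφ.continuous_fderiv one_ne_zero)
  have iT : Integrable fun x =>
      Real.exp (-(v x)) * (Real.exp (-(9 / 5) * v x) * φ x ^ 5) ^ 2 :=
    integrable_of_continuousOn_of_eq_zero hk (hvk.neg.rexp.mul
      (((continuousOn_const.mul hvk).rexp.mul (hφ.continuous.pow 5).continuousOn).pow 2))
      fun x hx => by simp [hφz x hx]
  have iQ : Integrable fun x => Real.exp (-(9 / 5) * v x) ^ 2 * φ x ^ 8 *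
      (1425 * ‖gradient φ x‖ ^ 2 + 2 * (R ^ 2)⁻¹ * φ x ^ 2) :=
    integrable_of_continuousOn_of_eq_zero hk
      ((((continuousOn_const.mul hvk).rexp.pow 2).mul (hφ.continuous.pow 8).continuousOn).mul
        ((continuous_const.mul (hgφc.norm.pow 2)).add
          (continuous_const.mul (hφ.continuous.pow 2))).continuousOn)
      fun x hx => by simp [hφz x hx]
  set L := ε⁻¹ ^ (18 / 5 : ℝ) * (B / R ^ 2) ^ (23 / 5 : ℝ) with hL_def
  have iL : Integrable (k.indicator fun _ => L) :=
    (integrable_indicator_iff hk.measurableSet).mpr (integrableOn_const hk.measure_lt_top.ne)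
  have hQ : ∫ x, Real.exp (-(9 / 5) * v x) ^ 2 * φ x ^ 8 *
        (1425 * ‖gradient φ x‖ ^ 2 + 2 * (R ^ 2)⁻¹ * φ x ^ 2) ≤
      ε * (∫ x, Real.exp (-(v x)) * (Real.exp (-(9 / 5) * v x) * φ x ^ 5) ^ 2) +
        L * volume.real k := by
    have hL : ∫ x, k.indicator (fun _ => L) x = L * volume.real k := by
      rw [integral_indicator_const L hk.measurableSet, smul_eq_mul, mul_comm]
    rw [← integral_const_mul, ← hL, ← integral_add (iT.const_mul ε) iL]
    refine integral_mono iQ ((iT.const_mul ε).add iL) fun x => ?_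
    by_cases hx : x ∈ k
    · simp only [indicator_of_mem hx]
      have h1 := rpow_mul_pow_mul_le hε (Real.exp_pos (-(v x))) (hφ0 x) (hφ1 x)
        (a := 1425 * ‖gradient φ x‖ ^ 2 + 2 * (R ^ 2)⁻¹ * φ x ^ 2) (by positivity)
      have h2 : 1425 * ‖gradient φ x‖ ^ 2 + 2 * (R ^ 2)⁻¹ * φ x ^ 2 ≤ B / R ^ 2 := by
        calc _ ≤ 1425 * (M / R) ^ 2 + 2 * (R ^ 2)⁻¹ * 1 := by
              gcongr
              · exact hgφ x
              · exact pow_le_one₀ (hφ0 x) (hφ1 x)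
          _ = B / R ^ 2 := by rw [hB_def]; field_simp
      have h3 : (1425 * ‖gradient φ x‖ ^ 2 + 2 * (R ^ 2)⁻¹ * φ x ^ 2) ^ (23 / 5 : ℝ) ≤
          (B / R ^ 2) ^ (23 / 5 : ℝ) := by gcongr
      have h4 := mul_le_mul_of_nonneg_left h3
        (show 0 ≤ ε⁻¹ ^ (18 / 5 : ℝ) by positivity)
      rw [mul_pow, hexp, ← pow_mul]
      linarith
    · simp [indicator_of_notMem hx, hφz x hx]
  have hLN : L * volume.real k ≤ N * R ^ (-(1 / 5) : ℝ) := by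
    have h1 : volume.real k = (2 * R) ^ m * volume.real (ball (0 : Euc m) 1) := by
      rw [hk_def, measureReal_def, Measure.addHaar_closedBall _ _ (by positivity),
        ENNReal.toReal_mul, ENNReal.toReal_ofReal (by positivity), finrank_euclideanSpace_fin]
      rfl
    have h2 : (B / R ^ 2) ^ (23 / 5 : ℝ) = B ^ (23 / 5 : ℝ) * R ^ (-(46 / 5) : ℝ) := by
      rw [Real.div_rpow hB (by positivity), div_eq_mul_inv, ← Real.rpow_natCast R 2,
        ← Real.rpow_mul hR0.le, ← Real.rpow_neg hR0.le]
      norm_num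
    have h3 : R ^ (-(46 / 5) : ℝ) * R ^ m ≤ R ^ (-(1 / 5) : ℝ) := by
      rw [← Real.rpow_natCast R m, ← Real.rpow_add hR0]
      refine Real.rpow_le_rpow_of_exponent_le (by linarith) ?_
      have : (m : ℝ) ≤ 9 := by exact_mod_cast hm
      linarith
    rw [hL_def, h1, h2, mul_pow]
    calc _ = N * (R ^ (-(46 / 5) : ℝ) * R ^ m) := by rw [hN_def]; ring
      _ ≤ _ := by gcongr
  set T := ∫ x, Real.exp (-(v x)) * (Real.exp (-(9 / 5) * v x) * φ x ^ 5) ^ 2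
  have hT : T ≤ ε⁻¹ * N * R ^ (-(1 / 5) : ℝ) := by
    rw [mul_assoc, inv_mul_eq_div, le_div_iff₀ hε]
    have : 1 / 20 * c * T = 2 * (T * ε) := by rw [hε_def]; ring
    linarith
  have h2k : ball (0 : Euc m) 2 ⊆ k :=
    ball_subset_closedBall.trans (closedBall_subset_closedBall (by linarith))
  have iτ : IntegrableOn (fun _ : Euc m => τ) (ball 0 2) :=
    integrableOn_const measure_ball_lt_top.ne
  have iT' := (iT.const_mul (τ⁻¹ ^ (18 / 5 : ℝ))).integrableOn (s := ball 0 2)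
  calc ∫ x in ball (0 : Euc m) 2, Real.exp (-(v x))
      ≤ ∫ x in ball (0 : Euc m) 2, (τ + τ⁻¹ ^ (18 / 5 : ℝ) *
          (Real.exp (-(v x)) * (Real.exp (-(9 / 5) * v x) * φ x ^ 5) ^ 2)) := by
        refine setIntegral_mono_on ((hvk.neg.rexp.integrableOn_compact hk).mono_set h2k)
          (iτ.add iT') measurableSet_ball fun x hx => ?_
        rw [hφR x (ball_subset_ball (by linarith) hx), one_pow, mul_one, hexp]
        exact le_add_rpow_mul hτ (Real.exp_pos _)
    _ = τ * volume.real (ball (0 : Euc m) 2) + τ⁻¹ ^ (18 / 5 : ℝ) *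
          ∫ x in ball (0 : Euc m) 2,
            Real.exp (-(v x)) * (Real.exp (-(9 / 5) * v x) * φ x ^ 5) ^ 2 := by
        rw [integral_add iτ iT', setIntegral_const, integral_const_mul, smul_eq_mul, mul_comm τ]
    _ ≤ τ * volume.real (ball (0 : Euc m) 2) + τ⁻¹ ^ (18 / 5 : ℝ) * T := by
        gcongr
        exact setIntegral_le_integral iT (ae_of_all _ fun x => by positivity)
    _ ≤ τ * volume.real (ball (0 : Euc m) 2) +
          τ⁻¹ ^ (18 / 5 : ℝ) * (ε⁻¹ * N * R ^ (-(1 / 5) : ℝ)) := by gcongr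
    _ = _ := by ring

/-- Lemma 10.4: smallness of `∫_{B₂} e^{−v}` for almost-stable solutions of the
Liouville-type inequality in dimension `m = n − 1 ≤ 9`. -/
theorem stmt15 (n : ℕ) (hn2 : 2 ≤ n) (hn : n ≤ 10) (c₀ : ℝ) (hc₀ : 0 < c₀) :
    ∀ σ : ℝ, 0 < σ → ∃ K : ℝ, 2 ≤ K ∧ ∃ δstar > 0,
      ∀ A : Euc (n-1) → (Euc (n-1) →L[ℝ] Euc (n-1)), ∀ v : Euc (n-1) → ℝ,
        ContDiffOn ℝ 1 A (ball 0 K) → SymmField A →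
        (∀ y ∈ ball (0:Euc (n-1)) K, ‖A y - ContinuousLinearMap.id ℝ (Euc (n-1))‖ ≤ δstar) →
        ContDiffOn ℝ 2 v (ball 0 K) →
        (∀ x ∈ ball (0:Euc (n-1)) K,
          divg (fun y => A y (gradient v y)) x ≤ c₀ * Real.exp (-(v x)) + δstar) →
        (∀ η : Euc (n-1) → ℝ, ContDiff ℝ (⊤ : ℕ∞) η → HasCompactSupport η →
            tsupport η ⊆ ball 0 K →
          c₀ * ∫ x in ball (0:Euc (n-1)) K, Real.exp (-(v x)) * (η x) ^ 2 ≤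
            (∫ x in ball (0:Euc (n-1)) K, ‖gradient η x‖ ^ 2) +
              δstar * ∫ x in ball (0:Euc (n-1)) K, (η x) ^ 2) →
        (∫ x in ball (0:Euc (n-1)) 2, Real.exp (-(v x))) ≤ σ := by
  intro σ hσ
  have hvol : 0 < volume.real (ball (0 : Euc (n - 1)) 2) :=
    ENNReal.toReal_pos (measure_ball_pos _ _ two_pos).ne' measure_ball_lt_top.ne
  obtain ⟨D, hD⟩ := exists_integral_exp_neg_le (m := n - 1) (by omega) hc₀
    (div_pos (half_pos hσ) hvol)
  have hlim : Tendsto (fun R : ℝ => D * R ^ (-(1 / 5) : ℝ)) atTop (nhds 0) := by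
    simpa using (tendsto_rpow_neg_atTop (show (0 : ℝ) < 1 / 5 by norm_num)).const_mul D
  obtain ⟨R, hRσ, hR⟩ :=
    ((hlim.eventually_lt_const (half_pos hσ)).and (eventually_ge_atTop 10)).exists
  refine ⟨3 * R, by linarith, (R ^ 2)⁻¹, by positivity, fun A v hA _ hAδ hv hdiv hst => ?_⟩
  have h := hD R hR A v hA hAδ hv hdiv hst
  rw [div_mul_cancel₀ _ hvol.ne'] at h
  linarith
end
end
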